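/- Let Σ be a finite type with decidable equality and I an irreflexive symmetric relation on Σ, and let π : List (Σ ⊕ Σ) → G(Σ,I) be the evaluation homomorphism of the graph group. Then the following are equivalent: (i) for every finite set W of words in List (Σ ⊕ Σ), the predicate on words w ↦ (π w ∈ Submonoid.closure (π '' W)) is computable (ComputablePred); (ii) (Σ,I) is a transitive forest. (Decidability of the submonoid membership problem for graph groups.) -/

import Mathlib

/-- The relators of the graph group: commutators of independent generators. -/
def GraphGroupRels {S : Type} (I : S → S → Prop) : Set (FreeGroup S) :=
  { r | ∃ a b : S, I a b ∧
      r = FreeGroup.of a * FreeGroup.of b * (FreeGroup.of a)⁻¹ * (FreeGroup.of b)⁻¹ }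

/-- The graph group of an independence alphabet. -/
abbrev GraphGroup {S : Type} (I : S → S → Prop) : Type :=
  PresentedGroup (GraphGroupRels I)

/-- Evaluation homomorphism from the free monoid on `S ⊕ S` to the graph group,
sending `inl a` to the generator `a` and `inr a` to its inverse. -/
noncomputable def graphEval {S : Type} (I : S → S → Prop) :
    FreeMonoid (S ⊕ S) →* GraphGroup I :=
  FreeMonoid.lift (Sum.elim
    (fun a => (PresentedGroup.of (rels := GraphGroupRels I) a))
    (fun a => (PresentedGroup.of (rels := GraphGroupRels I) a)⁻¹))

/-- `(S, I)` is a transitive forest: there is a strict partial order whose strict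
down-sets are linearly ordered, realizing `I` as the comparability relation. -/
def IsTransitiveForest {S : Type} (I : S → S → Prop) : Prop :=
  ∃ r : S → S → Prop, IsStrictOrder S r ∧
    (∀ a b c : S, r b a → r c a → (r b c ∨ b = c ∨ r c b)) ∧
    (∀ a b : S, I a b ↔ (a ≠ b ∧ (r a b ∨ r b a)))

/-- Any finite type with decidable equality is primcodable. -/
noncomputable instance (priority := 50) fintypePrimcodable {α : Type} [Fintype α] [DecidableEq α] :
    Primcodable α :=
  Primcodable.ofEquiv (Fin (Fintype.card α)) (Fintype.equivFin α)

/-- The rules `n = p k * j + r k ↦ q k * j + s k`. -/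
def AffineStep {m : ℕ} (p r q s : Fin m → ℕ) (n n' : ℕ) : Prop :=
  ∃ k j, n = p k * j + r k ∧ n' = q k * j + s k

/-- Reachability by affine rules. -/
def AffineReach {m : ℕ} (p r q s : Fin m → ℕ) : ℕ → ℕ → Prop :=
  Relation.ReflTransGen (AffineStep p r q s)

section Strings
variable {m : ℕ}

/-- Doubling of every letter. -/
def dbl {α : Type} : List α → List α
  | [] => []
  | x :: l => x :: x :: dbl l

theorem dbl_append {α : Type} (l l' : List α) : dbl (l ++ l') = dbl l ++ dbl l' := by
  induction l with
  | nil => rfl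
  | cons x l ih => simp [dbl, ih]

theorem dbl_length {α : Type} (l : List α) : (dbl l).length = 2 * l.length := by
  induction l with
  | nil => rfl
  | cons x l ih => simp [dbl, ih]; omega

theorem dbl_shift {α : Type} {k k₁ : α} : ∀ {ws xs : List α},
    dbl ws ++ [k₁] = k :: dbl xs → k₁ = k ∧ ws = xs ∧ ∀ x ∈ xs, x = k
  | [], [], h => by simpa [dbl] using h
  | [], x :: xs, h => by simp [dbl] at h
  | w :: ws, [], h => by simp [dbl] at h
  | w :: ws, x :: xs, h => by
    simp only [dbl, List.cons_append, List.cons.injEq] at h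
    obtain ⟨rfl, rfl, h⟩ := h
    obtain ⟨h1, h2, h3⟩ := dbl_shift h
    refine ⟨h1, by rw [h2], ?_⟩
    simpa using h3

/-- String of `c`-levels of the left hand side. -/
def lhsC : List (Fin m ⊕ Fin m) → List ℕ
  | [] => []
  | Sum.inl _ :: l => 0 :: lhsC l
  | Sum.inr _ :: l => 1 :: lhsC l

/-- String of `c`-levels of the right hand side. -/
def rhsC (q s : Fin m → ℕ) : List (Fin m ⊕ Fin m) → List ℕ
  | [] => []
  | Sum.inl k :: l => List.replicate (q k) 0 ++ rhsC q s l
  | Sum.inr k :: l => 1 :: List.replicate (s k) 0 ++ rhsC q s l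

/-- String of `b`-levels of the left hand side. -/
def lhsB : ℕ → List (Fin m ⊕ Fin m) → List (ℕ × Fin m)
  | _, [] => []
  | h, Sum.inl k :: l => (h, k) :: (h, k) :: lhsB h l
  | h, Sum.inr k :: l => (h, k) :: lhsB (h + 1) l

/-- String of `b`-levels of the right hand side. -/
def rhsB (p r : Fin m → ℕ) : ℕ → List (Fin m ⊕ Fin m) → List (ℕ × Fin m)
  | _, [] => []
  | h, Sum.inl k :: l => dbl (List.replicate (p k) (h, k)) ++ rhsB p r h l
  | h, Sum.inr k :: l => (h + 1, k) :: dbl (List.replicate (r k) (h + 1, k)) ++ rhsB p r (h + 1) l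

/-- Either empty or starting with a step token. -/
def StartsStep (l : List (Fin m ⊕ Fin m)) : Prop := ∀ k l', l ≠ Sum.inl k :: l'

theorem exists_units (l : List (Fin m ⊕ Fin m)) :
    ∃ (us : List (Fin m)) (l' : List (Fin m ⊕ Fin m)), l = us.map Sum.inl ++ l' ∧ StartsStep l' := by
  induction l with
  | nil => exact ⟨[], [], rfl, by simp [StartsStep]⟩
  | cons x l ih =>
    rcases x with k | k
    · obtain ⟨us, l', rfl, h⟩ := ih
      exact ⟨k :: us, l', by simp, h⟩
    · exact ⟨[], Sum.inr k :: l, rfl, by simp [StartsStep]⟩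

theorem lhsB_le {h : ℕ} {l : List (Fin m ⊕ Fin m)} : ∀ x ∈ lhsB h l, h ≤ x.1 := by
  induction l generalizing h with
  | nil => simp [lhsB]
  | cons x l ih =>
    rcases x with k | k
    · simpa [lhsB] using fun a b hh => @ih h (a, b) hh
    · simpa [lhsB] using fun a b hh => Nat.le_of_succ_le (@ih (h + 1) (a, b) hh)

theorem mem_dbl {α : Type} {l : List α} {x : α} : x ∈ dbl l ↔ x ∈ l := by
  induction l with
  | nil => rfl
  | cons y l ih => simp [dbl, ih]

theorem rhsB_le {p r : Fin m → ℕ} {h : ℕ} {l : List (Fin m ⊕ Fin m)} :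
    ∀ x ∈ rhsB p r h l, h ≤ x.1 := by
  induction l generalizing h with
  | nil => simp [rhsB]
  | cons t l ih =>
    intro x hx
    rcases t with k | k
    · simp only [rhsB, List.mem_append, mem_dbl, List.mem_replicate] at hx
      rcases hx with ⟨-, rfl⟩ | hx
      · exact le_rfl
      · exact ih _ hx
    · simp only [rhsB, List.mem_append, List.mem_cons, mem_dbl, List.mem_replicate] at hx
      rcases hx with (rfl | ⟨-, rfl⟩) | hx
      · exact Nat.le_succ _
      · exact Nat.le_succ _
      · exact Nat.le_of_succ_le (ih _ hx)

theorem rhsB_lt {p r : Fin m → ℕ} {h : ℕ} {l : List (Fin m ⊕ Fin m)} (hl : StartsStep l) :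
    ∀ x ∈ rhsB p r h l, h < x.1 := by
  rcases l with _ | ⟨k | k, l⟩
  · simp [rhsB]
  · exact absurd rfl (hl k l)
  · intro x hx
    simp only [rhsB, List.mem_append, List.mem_cons, mem_dbl, List.mem_replicate] at hx
    rcases hx with (rfl | ⟨-, rfl⟩) | hx
    · exact Nat.lt_succ_self _
    · exact Nat.lt_succ_self _
    · exact rhsB_le _ hx

theorem lhsB_units (h : ℕ) (us : List (Fin m)) (l) :
    lhsB h (us.map Sum.inl ++ l) = dbl (us.map fun k => (h, k)) ++ lhsB h l := by
  induction us with
  | nil => rfl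
  | cons k us ih => simp [lhsB, dbl, ih]

theorem rhsB_units (p r : Fin m → ℕ) (h : ℕ) (us : List (Fin m)) (l) :
    rhsB p r h (us.map Sum.inl ++ l) =
      dbl ((us.flatMap fun k => List.replicate (p k) k).map fun k => (h, k)) ++ rhsB p r h l := by
  induction us with
  | nil => rfl
  | cons k us ih => simp [rhsB, dbl_append, ih]

theorem lhsC_units (us : List (Fin m)) (l) :
    lhsC (us.map Sum.inl ++ l) = List.replicate us.length 0 ++ lhsC l := by
  induction us with
  | nil => rfl
  | cons k us ih => simp [lhsC, List.replicate_succ, ih]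

theorem rhsC_units (q s : Fin m → ℕ) (us : List (Fin m)) (l) {k : Fin m} (hus : ∀ x ∈ us, x = k) :
    rhsC q s (us.map Sum.inl ++ l) = List.replicate (q k * us.length) 0 ++ rhsC q s l := by
  induction us with
  | nil => simp
  | cons k us ih =>
    simp only [List.mem_cons, forall_eq_or_imp] at hus
    obtain ⟨rfl, hus⟩ := hus
    simp only [List.map_cons, List.cons_append, rhsC, ih hus, List.length_cons, Nat.mul_succ,
      Nat.add_comm _ (q k), List.replicate_add, List.append_assoc]

theorem append_split {α : Type} {P : α → Prop} {a b a' b' : List α} (h : a ++ b = a' ++ b')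
    (ha : ∀ x ∈ a, P x) (ha' : ∀ x ∈ a', P x) (hb : ∀ x ∈ b, ¬ P x) (hb' : ∀ x ∈ b', ¬ P x) :
    a = a' ∧ b = b' := by
  induction a generalizing a' with
  | nil =>
    cases a' with
    | nil => exact ⟨rfl, h⟩
    | cons y a' =>
      simp only [List.nil_append, List.cons_append] at h
      exact absurd (ha' y (by simp)) (hb y (by simp [h]))
  | cons x a ih =>
    cases a' with
    | nil =>
      simp only [List.nil_append, List.cons_append] at h
      exact absurd (ha x (by simp)) (hb' x (by simp [← h]))
    | cons y a' =>
      simp only [List.cons_append, List.cons.injEq] at h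
      obtain ⟨rfl, h⟩ := h
      obtain ⟨rfl, rfl⟩ := ih h (fun z hz => ha z (by simp [hz])) (fun z hz => ha' z (by simp [hz]))
      exact ⟨rfl, rfl⟩

theorem replicate_one_split {n n' : ℕ} {l l' : List ℕ}
    (h : List.replicate n 0 ++ 1 :: l = List.replicate n' 0 ++ 1 :: l') : n = n' ∧ l = l' := by
  induction n generalizing n' with
  | zero =>
    cases n' with
    | zero => simpa using h
    | succ n' => simp [List.replicate_succ] at h
  | succ n ih =>
    cases n' with
    | zero => simp [List.replicate_succ] at h
    | succ n' =>
      simp only [List.replicate_succ, List.cons_append, List.cons.injEq, true_and] at h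
      exact ⟨congrArg _ (ih h).1, (ih h).2⟩

theorem affineReach_of_strings (p r q s : Fin m → ℕ) (hp : ∀ k, 0 < p k) (nf : ℕ) :
    ∀ (N : ℕ) (V U : List (Fin m ⊕ Fin m)) (h n : ℕ), V.length ≤ N →
      lhsB (h + 1) U = rhsB p r h V →
      lhsC U ++ List.replicate nf 0 = List.replicate n 0 ++ rhsC q s V →
      AffineReach p r q s n nf := by
  intro N
  induction N with
  | zero =>
    intro V U h n hV hB hC
    obtain rfl : V = [] := by simpa using hV
    obtain rfl : U = [] := by
      rcases U with _ | ⟨k | k, U⟩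
      · rfl
      · simp [lhsB, rhsB] at hB
      · simp [lhsB, rhsB] at hB
    have : nf = n := by simpa [lhsC, rhsC] using hC
    subst this; exact Relation.ReflTransGen.refl
  | succ N ih =>
    intro V U h n hV hB hC
    rcases V with _ | ⟨k | k, V⟩
    · exact ih [] U h n (by simp) hB hC
    · -- a leading unit produces a letter of too low level
      have h1 : (h, k) ∈ rhsB p r h (Sum.inl k :: V) := by
        simp [rhsB, mem_dbl, (hp k).ne']
      rw [← hB] at h1
      have := lhsB_le _ h1
      simp at this
    · obtain ⟨us, V, rfl, hVs⟩ := exists_units V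
      obtain ⟨ws, U, rfl, hUs⟩ := exists_units U
      rw [lhsB_units] at hB
      simp only [rhsB, rhsB_units] at hB
      set xs : List (Fin m) := List.replicate (r k) k ++ us.flatMap fun k => List.replicate (p k) k
        with hxs
      have hB' : dbl (ws.map fun k => (h + 1, k)) ++ lhsB (h + 1) U =
          (h + 1, k) :: dbl (xs.map fun k => (h + 1, k)) ++ rhsB p r (h + 1) V := by
        rw [hB]; simp [hxs, dbl_append]
      rcases U with _ | ⟨k₁ | k₁, U⟩
      · have hVe : rhsB p r (h + 1) V = [] := by
          by_contra hne
          obtain ⟨x, hx⟩ := List.exists_mem_of_ne_nil _ hne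
          have h1 := rhsB_lt hVs x hx
          have h2 : x ∈ dbl (ws.map fun k => (h + 1, k)) ++ lhsB (h + 1) [] := by
            rw [hB']; simp [hx]
          simp only [lhsB, List.append_nil, mem_dbl, List.mem_map] at h2
          obtain ⟨y, -, rfl⟩ := h2
          simp at h1
        have := congrArg List.length hB'
        rw [hVe] at this
        simp [lhsB, dbl_length] at this
        omega
      · exact absurd rfl (hUs _ _)
      · have hB2 : (dbl (ws.map fun k => (h + 1, k)) ++ [(h + 1, k₁)]) ++ lhsB (h + 2) U =
            ((h + 1, k) :: dbl (xs.map fun k => (h + 1, k))) ++ rhsB p r (h + 1) V := by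
          rw [← hB']; simp [lhsB]
        obtain ⟨e1, e2⟩ := append_split (P := fun x => x.1 = h + 1) hB2 (by
            intro x hx
            simp only [List.mem_append, mem_dbl, List.mem_map, List.mem_singleton] at hx
            rcases hx with ⟨_, _, rfl⟩ | rfl <;> rfl) (by
            intro x hx
            simp only [List.mem_cons, mem_dbl, List.mem_map] at hx
            rcases hx with rfl | ⟨_, _, rfl⟩ <;> rfl)
          (fun x hx => (Nat.lt_of_succ_le (lhsB_le x hx)).ne') (fun x hx => (rhsB_lt hVs x hx).ne')
        obtain ⟨hk, hws, hx⟩ := dbl_shift e1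
        have hinj : Function.Injective fun k : Fin m => (h + 1, k) := fun a b h => by simpa using h
        have hws := List.map_injective_iff.2 hinj hws
        have hk : k₁ = k := by simpa using hk
        have hus : ∀ x ∈ us, x = k := by
          intro x hxu
          have : x ∈ xs := by
            simp [hxs, hxu, (hp x).ne']
          simpa using hx _ (List.mem_map_of_mem this)
        have hlen : ws.length = p k * us.length + r k := by
          have : (us.flatMap fun k => List.replicate (p k) k).length = p k * us.length := by
            clear_value xs
            clear hC hB' hB2 hB hV hxs
            induction us with
            | nil => simp
            | cons x us ih =>
              simp only [List.mem_cons, forall_eq_or_imp] at hus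
              rw [List.flatMap_cons, List.length_append, ih hus.2, hus.1]
              simp [Nat.mul_succ, Nat.add_comm]
          rw [hws, hxs, List.length_append, this]
          simp [Nat.add_comm]
        rw [lhsC_units] at hC
        simp only [lhsC, rhsC] at hC
        rw [rhsC_units q s us V hus] at hC
        simp only [List.append_assoc, List.cons_append] at hC
        obtain ⟨hn, hC⟩ := replicate_one_split hC
        have hC' : lhsC U ++ List.replicate nf 0 =
            List.replicate (q k * us.length + s k) 0 ++ rhsC q s V := by
          rw [hC, Nat.add_comm, List.replicate_add, List.append_assoc]
        refine Relation.ReflTransGen.head ⟨k, us.length, hn ▸ hlen, rfl⟩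
          (ih V U (h + 1) _ ?_ e2 hC')
        simp at hV; omega

end Strings

section GenericGroup
variable {G H : Type*} [Group G] [Group H] {m : ℕ}

/-- Conjugate `d ^ k * x * d ^ (-k)`. -/
def powConj (d : G) (k : ℕ) (x : G) : G := d ^ k * x * (d ^ k)⁻¹

/-- Generators of the left hand side. -/
def lhsTok (a b c d : G) : Fin m ⊕ Fin m → G
  | Sum.inl k => c * powConj d k (b ^ 2)
  | Sum.inr k => powConj d k (a * c * a⁻¹ * b) * d ^ m

/-- Generators of the right hand side. -/
def rhsTok (p r q s : Fin m → ℕ) (a b c d : G) : Fin m ⊕ Fin m → G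
  | Sum.inl k => c ^ q k * powConj d k (b ^ 2) ^ p k
  | Sum.inr k => d ^ m * powConj d k (a * c * a⁻¹ * b) * c ^ s k * powConj d k (b ^ 2) ^ r k

/-- The generators of the submonoid simulating affine reachability. -/
def simTok (p r q s : Fin m → ℕ) (nf : ℕ) (a b c d : G) :
    Option ((Fin m ⊕ Fin m) ⊕ (Fin m ⊕ Fin m)) → G
  | none => c ^ nf * (d ^ m)⁻¹ * (a ^ 2)⁻¹
  | some (Sum.inl x) => lhsTok a b c d x
  | some (Sum.inr x) => a ^ 2 * (rhsTok p r q s a b c d x)⁻¹ * (a ^ 2)⁻¹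

/-- The element whose membership encodes reachability from `n`. -/
def simTarget (m n : ℕ) (a c d : G) : G := (d ^ m)⁻¹ * c ^ n * (a ^ 2)⁻¹

theorem map_powConj (f : G →* H) (d : G) (k : ℕ) (x : G) :
    f (powConj d k x) = powConj (f d) k (f x) := by simp [powConj]

theorem map_lhsTok (f : G →* H) (a b c d : G) (x : Fin m ⊕ Fin m) :
    f (lhsTok a b c d x) = lhsTok (f a) (f b) (f c) (f d) x := by
  rcases x with x | x <;> simp [lhsTok, map_powConj]

theorem map_rhsTok (f : G →* H) (p r q s : Fin m → ℕ) (a b c d : G) (x : Fin m ⊕ Fin m) :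
    f (rhsTok p r q s a b c d x) = rhsTok p r q s (f a) (f b) (f c) (f d) x := by
  rcases x with x | x <;> simp [rhsTok, map_powConj]

theorem map_simTok (f : G →* H) (p r q s : Fin m → ℕ) (nf : ℕ) (a b c d : G) (x) :
    f (simTok p r q s nf a b c d x) = simTok p r q s nf (f a) (f b) (f c) (f d) x := by
  rcases x with _ | x | x <;> simp [simTok, map_lhsTok, map_rhsTok]

theorem map_simTarget (f : G →* H) (n : ℕ) (a c d : G) :
    f (simTarget m n a c d) = simTarget m n (f a) (f c) (f d) := by
  simp [simTarget]

theorem simTarget_split (a c d l₁ l₂ : G) (n nf : ℕ)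
    (h : d ^ m * l₁ * c ^ nf = c ^ n * l₂ * d ^ m) :
    simTarget m n a c d =
      l₁ * (c ^ nf * (d ^ m)⁻¹ * (a ^ 2)⁻¹) * (a ^ 2 * l₂⁻¹ * (a ^ 2)⁻¹) := by
  have : l₁ * c ^ nf = (d ^ m)⁻¹ * c ^ n * l₂ * d ^ m := by
    rw [mul_assoc _ (c ^ n), mul_assoc, ← h]; group
  calc simTarget m n a c d = ((d ^ m)⁻¹ * c ^ n * l₂ * d ^ m) * (d ^ m)⁻¹ * l₂⁻¹ * (a ^ 2)⁻¹ := by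
        simp [simTarget]
    _ = _ := by rw [← this]; group

theorem exists_of_affineReach (p r q s : Fin m → ℕ) {a b c d : G} (hab : Commute a b)
    (hbc : Commute b c) (hcd : Commute c d) {n nf : ℕ} (h : AffineReach p r q s n nf) :
    ∃ U V : List (Fin m ⊕ Fin m), d ^ m * (U.map (lhsTok a b c d)).prod * c ^ nf =
      c ^ n * (V.map (rhsTok p r q s a b c d)).prod * d ^ m := by
  induction h using Relation.ReflTransGen.head_induction_on with
  | refl => exact ⟨[], [], by simpa using ((hcd.pow_left _).pow_right _).eq.symm⟩
  | @head n n' hstep _ ih =>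
    obtain ⟨U, V, ih⟩ := ih
    obtain ⟨k, j, rfl, rfl⟩ := hstep
    refine ⟨List.replicate (p k * j + r k) (Sum.inl k) ++ Sum.inr k :: U,
      Sum.inr k :: (List.replicate j (Sum.inl k) ++ V), ?_⟩
    simp only [List.map_append, List.map_replicate, List.prod_append, List.prod_replicate,
      List.map_cons, List.prod_cons, lhsTok, rhsTok]
    set B := powConj d (k : ℕ) (b ^ 2) with hB
    set A := powConj d (k : ℕ) (a * c * a⁻¹ * b) with hA
    set L := (U.map (lhsTok a b c d)).prod
    set R := (V.map (rhsTok p r q s a b c d)).prod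
    have hcB : Commute c B := by
      have h1 : Commute c (d ^ (k : ℕ)) := hcd.pow_right _
      exact ((h1.mul_right (hbc.symm.pow_right 2)).mul_right h1.inv_right)
    have hBA : Commute B A := by
      have h1 : Commute b (a * c * a⁻¹ * b) :=
        ((hab.symm.mul_right hbc).mul_right hab.symm.inv_right).mul_right (Commute.refl b)
      exact Commute.conj (h1.pow_left 2) (d ^ (k : ℕ))
    have hcD : Commute c (d ^ m) := hcd.pow_right _
    set N := p k * j + r k with hN
    have e1 : (c * B) ^ N = c ^ N * B ^ N := hcB.mul_pow N
    have e2 : (c ^ q k * B ^ p k) ^ j = c ^ (q k * j) * B ^ (p k * j) := by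
      rw [((hcB.pow_left _).pow_right _).mul_pow, ← pow_mul, ← pow_mul]
    have e3 : c ^ s k * B ^ r k * (c ^ (q k * j) * B ^ (p k * j)) = c ^ (q k * j + s k) * B ^ N := by
      have : B ^ r k * c ^ (q k * j) = c ^ (q k * j) * B ^ r k :=
        ((hcB.pow_left _).pow_right _).eq.symm
      calc _ = c ^ s k * (B ^ r k * c ^ (q k * j)) * B ^ (p k * j) := by group
        _ = c ^ s k * c ^ (q k * j) * (B ^ r k * B ^ (p k * j)) := by rw [this]; group
        _ = _ := by rw [← pow_add, ← pow_add, hN, Nat.add_comm, Nat.add_comm (r k)]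
    calc d ^ m * ((c * B) ^ N * (A * d ^ m * L)) * c ^ nf
        = d ^ m * (c ^ N * B ^ N) * A * (d ^ m * L * c ^ nf) := by rw [e1]; simp only [mul_assoc]
      _ = (d ^ m * c ^ N) * (B ^ N * A) * c ^ (q k * j + s k) * R * d ^ m := by
        rw [ih]; simp only [mul_assoc]
      _ = (c ^ N * d ^ m) * A * (B ^ N * c ^ (q k * j + s k)) * R * d ^ m := by
        rw [(hcD.pow_left N).eq, (hBA.pow_left N).eq]; simp only [mul_assoc]
      _ = (c ^ N * d ^ m) * A * (c ^ (q k * j + s k) * B ^ N) * R * d ^ m := by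
        rw [((hcB.pow_left (q k * j + s k)).pow_right N).eq]
      _ = _ := by rw [← e3, e2]; simp only [mul_assoc]

theorem simTarget_mem_of_affineReach (p r q s : Fin m → ℕ) {a b c d : G} (hab : Commute a b)
    (hbc : Commute b c) (hcd : Commute c d) {n nf : ℕ} (h : AffineReach p r q s n nf) :
    simTarget m n a c d ∈ Submonoid.closure (Set.range (simTok p r q s nf a b c d)) := by
  obtain ⟨U, V, h⟩ := exists_of_affineReach p r q s hab hbc hcd h
  rw [simTarget_split a c d _ _ n nf h]
  have hmem : ∀ x, simTok p r q s nf a b c d x ∈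
      Submonoid.closure (Set.range (simTok p r q s nf a b c d)) :=
    fun x => Submonoid.subset_closure ⟨x, rfl⟩
  refine mul_mem (mul_mem (list_prod_mem ?_) (hmem none)) ?_
  · intro y hy
    obtain ⟨x, -, rfl⟩ := List.mem_map.1 hy
    exact hmem (some (Sum.inl x))
  · clear h
    induction V with
    | nil => simp
    | cons x V ih =>
      have := mul_mem ih (hmem (some (Sum.inr x)))
      convert this using 1
      simp only [List.map_cons, List.prod_cons, simTok]
      group

end GenericGroup

section Shift

/-- Translation action of `ℤ` on the free group on `ℤ`. -/
def shiftAut : Multiplicative ℤ →* MulAut (FreeGroup ℤ) where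
  toFun z := FreeGroup.freeGroupCongr (Equiv.addLeft z.toAdd)
  map_one' := by
    ext x
    simp
  map_mul' y z := by
    ext x
    induction x using FreeGroup.induction_on with
    | C1 => simp
    | of x => simp [add_assoc]
    | inv_of x h => simp [add_assoc]
    | mul x y hx hy => rw [map_mul, hx, hy, map_mul]

/-- The wreath-like product of the free group on `ℤ` with `ℤ`. -/
abbrev ShiftGroup : Type := FreeGroup ℤ ⋊[shiftAut] Multiplicative ℤ

/-- The shift. -/
def shT : ShiftGroup := SemidirectProduct.inr (Multiplicative.ofAdd 1)

/-- The letter at level `j`. -/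
def shX (j : ℤ) : ShiftGroup := SemidirectProduct.inl (FreeGroup.of j)

theorem shT_pow (n : ℕ) :
    shT ^ n = SemidirectProduct.inr (Multiplicative.ofAdd (n : ℤ)) := by
  rw [shT, ← map_pow, ← ofAdd_nsmul]; simp

theorem shiftAut_of (z : Multiplicative ℤ) (j : ℤ) :
    shiftAut z (FreeGroup.of j) = FreeGroup.of (z.toAdd + j) := by
  simp [shiftAut]

theorem shT_pow_conj (n : ℕ) (j : ℤ) : shT ^ n * shX j * (shT ^ n)⁻¹ = shX (n + j) := by
  rw [shT_pow, ← map_inv, shX, ← SemidirectProduct.inl_aut, shiftAut_of]; rfl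

theorem shT_pow_mul (n : ℕ) (j : ℤ) : shT ^ n * shX j = shX (n + j) * shT ^ n := by
  rw [← shT_pow_conj]; group

theorem freeGroup_positive_injective {α : Type*} {l l' : List α}
    (h : (l.map FreeGroup.of).prod = (l'.map FreeGroup.of).prod) : l = l' := by
  classical
  have key : ∀ l : List α, (l.map FreeGroup.of).prod = FreeGroup.mk (l.map fun x => (x, true)) := by
    intro l
    induction l with
    | nil => rfl
    | cons x l ih => rw [List.map_cons, List.prod_cons, ih]; rfl
  have red : ∀ l : List α, (FreeGroup.mk (l.map fun x => (x, true))).toWord =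
      l.map fun x => (x, true) := by
    intro l
    rw [FreeGroup.toWord_mk]
    apply FreeGroup.IsReduced.reduce_eq
    rw [FreeGroup.IsReduced]
    rw [List.isChain_map]
    exact List.Pairwise.isChain (List.pairwise_of_forall (fun _ _ _ => rfl))
  rw [key, key] at h
  have := congrArg FreeGroup.toWord h
  rw [red, red] at this
  exact List.map_injective_iff.2 (fun a b h => by simpa using h) this

theorem shX_prod_injective {l l' : List ℤ} {u v : Multiplicative ℤ}
    (h : (l.map shX).prod * SemidirectProduct.inr u = (l'.map shX).prod * SemidirectProduct.inr v) :
    l = l' := by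
  have key : ∀ l : List ℤ, (l.map shX).prod =
      (SemidirectProduct.inl (l.map FreeGroup.of).prod : ShiftGroup) := by
    intro l
    rw [map_list_prod, List.map_map]; rfl
  rw [key, key] at h
  have := congrArg SemidirectProduct.left h
  simp at this
  exact freeGroup_positive_injective this

end Shift

section Soundness
variable {m : ℕ}

theorem powConj_one_left {G : Type*} [Group G] (k : ℕ) (x : G) : powConj 1 k x = x := by
  simp [powConj]

theorem powConj_pow {G : Type*} [Group G] (d : G) (k n : ℕ) (x : G) :
    powConj d k (x ^ n) = powConj d k x ^ n := by
  simp [powConj, conj_pow]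

theorem powConj_shX (k : ℕ) (j : ℤ) : powConj shT k (shX j) = shX (k + j) := shT_pow_conj k j

theorem shT_conj (j : ℤ) : shT * shX j * shT⁻¹ = shX (1 + j) := by
  simpa using shT_pow_conj 1 j

/-- The `c`-levels contributed by a left hand token. -/
def lhsLev : Fin m ⊕ Fin m → List ℕ
  | Sum.inl _ => [0]
  | Sum.inr _ => [1]

/-- The `c`-levels contributed by a right hand token. -/
def rhsLev (q s : Fin m → ℕ) : Fin m ⊕ Fin m → List ℕ
  | Sum.inl k => List.replicate (q k) 0
  | Sum.inr k => 1 :: List.replicate (s k) 0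

theorem lhsC_eq (l : List (Fin m ⊕ Fin m)) : lhsC l = l.flatMap lhsLev := by
  induction l with
  | nil => rfl
  | cons x l ih => rcases x with k | k <;> simp [lhsC, lhsLev, ih]

theorem rhsC_eq (q s : Fin m → ℕ) (l : List (Fin m ⊕ Fin m)) :
    rhsC q s l = l.flatMap (rhsLev q s) := by
  induction l with
  | nil => rfl
  | cons x l ih => rcases x with k | k <;> simp [rhsC, rhsLev, ih]

/-- Positive product of letters at levels `h + j`. -/
def levProd (h : ℤ) (l : List ℕ) : FreeGroup ℤ :=
  (l.map fun j : ℕ => FreeGroup.of (h + (j : ℤ))).prod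

theorem levProd_append (h : ℤ) (l l' : List ℕ) :
    levProd h (l ++ l') = levProd h l * levProd h l' := by simp [levProd]

theorem levProd_replicate (h : ℤ) (n : ℕ) :
    levProd h (List.replicate n 0) = FreeGroup.of h ^ n := by simp [levProd]

theorem shiftAut_levProd (z : ℤ) (h : ℤ) (l : List ℕ) :
    shiftAut (Multiplicative.ofAdd z) (levProd h l) = levProd (z + h) l := by
  induction l with
  | nil => simp [levProd]
  | cons x l ih =>
    simp only [levProd, List.map_cons, List.prod_cons, map_mul] at ih ⊢
    rw [ih, shiftAut_of]; simp [add_assoc]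

theorem lhsTok_c (x : Fin m ⊕ Fin m) :
    lhsTok shT 1 (shX 0) 1 x = SemidirectProduct.inl (levProd 0 (lhsLev x)) := by
  rcases x with k | k
  · simp [lhsTok, lhsLev, levProd, powConj_one_left]; rfl
  · simp [lhsTok, lhsLev, levProd, powConj_one_left, shT_conj]; rfl

theorem rhsTok_c (p r q s : Fin m → ℕ) (x : Fin m ⊕ Fin m) :
    rhsTok p r q s shT 1 (shX 0) 1 x = SemidirectProduct.inl (levProd 0 (rhsLev q s x)) := by
  rcases x with k | k
  · simp [rhsTok, rhsLev, levProd, powConj_one_left]; rfl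
  · simp [rhsTok, rhsLev, levProd, powConj_one_left, shT_conj]; rfl

/-- Value of a token not of middle type under the `c`-homomorphism. -/
def simVal (q s : Fin m → ℕ) : (Fin m ⊕ Fin m) ⊕ (Fin m ⊕ Fin m) → FreeGroup ℤ
  | Sum.inl x => levProd 0 (lhsLev x)
  | Sum.inr x => (levProd 2 (rhsLev q s x))⁻¹

theorem simTok_c_some (p r q s : Fin m → ℕ) (nf : ℕ) (y) :
    simTok p r q s nf shT 1 (shX 0) 1 (some y) = SemidirectProduct.inl (simVal q s y) := by
  rcases y with x | x
  · simp [simTok, lhsTok_c, simVal]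
  · have := shiftAut_levProd 2 0 (rhsLev q s x)
    simp only [simTok, rhsTok_c, simVal, shT_pow]
    rw [← map_inv, ← map_inv, ← SemidirectProduct.inl_aut, map_inv]
    erw [this]
    simp

theorem simTok_c_none (p r q s : Fin m → ℕ) (nf : ℕ) :
    simTok p r q s nf shT 1 (shX 0) 1 none = SemidirectProduct.inl (FreeGroup.of 0 ^ nf) *
      SemidirectProduct.inr (Multiplicative.ofAdd (-2)) := by
  simp only [simTok, shT_pow, ← map_inv]
  simp [shX]

/-- Count letters with level in a set. -/
noncomputable def levCount (J : Set ℤ) : FreeGroup ℤ →* Multiplicative ℤ :=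
  open Classical in
  FreeGroup.lift fun j => if j ∈ J then Multiplicative.ofAdd 1 else 1

theorem levCount_levProd_of_mem (J : Set ℤ) (h : ℤ) (l : List ℕ) (hl : ∀ j ∈ l, h + (j : ℤ) ∈ J) :
    levCount J (levProd h l) = Multiplicative.ofAdd (l.length : ℤ) := by
  induction l with
  | nil => simp [levProd]
  | cons x l ih =>
    simp only [List.mem_cons, forall_eq_or_imp] at hl
    have := ih hl.2
    simp only [levProd, List.map_cons, List.prod_cons, map_mul] at this ⊢
    rw [this]
    simp [levCount, hl.1, ← ofAdd_add, add_comm]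

theorem levCount_levProd_of_notMem (J : Set ℤ) (h : ℤ) (l : List ℕ)
    (hl : ∀ j ∈ l, h + (j : ℤ) ∉ J) : levCount J (levProd h l) = 1 := by
  induction l with
  | nil => simp [levProd]
  | cons x l ih =>
    simp only [List.mem_cons, forall_eq_or_imp] at hl
    have := ih hl.2
    simp only [levProd, List.map_cons, List.prod_cons, map_mul] at this ⊢
    rw [this]
    simp [levCount, hl.1]

theorem lhsLev_le (x : Fin m ⊕ Fin m) : ∀ j ∈ lhsLev x, j ≤ 1 := by
  rcases x with k | k <;> simp [lhsLev]

theorem rhsLev_le (q s : Fin m → ℕ) (x : Fin m ⊕ Fin m) : ∀ j ∈ rhsLev q s x, j ≤ 1 := by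
  rcases x with k | k <;> simp [rhsLev]

theorem lhsLev_pos (x : Fin m ⊕ Fin m) : 0 < (lhsLev x).length := by
  rcases x with k | k <;> simp [lhsLev]

theorem rhsLev_pos {q s : Fin m → ℕ} (hq : ∀ k, 0 < q k) (x : Fin m ⊕ Fin m) :
    0 < (rhsLev q s x).length := by
  rcases x with k | k <;> simp [rhsLev, hq k]

theorem option_list_split {α : Type*} (T : List (Option α)) (h : T.countP Option.isNone = 1) :
    ∃ Y₁ Y₂ : List α, T = Y₁.map some ++ none :: Y₂.map some := by
  have hsome : ∀ L : List (Option α), none ∉ L → ∃ Y : List α, L = Y.map some := by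
    intro L hL
    induction L with
    | nil => exact ⟨[], rfl⟩
    | cons x L ih =>
      simp only [List.mem_cons, not_or] at hL
      obtain ⟨Y, rfl⟩ := ih hL.2
      rcases x with _ | x
      · exact absurd rfl hL.1
      · exact ⟨x :: Y, rfl⟩
  have hmem : none ∈ T := by
    obtain ⟨x, hx, h'⟩ := List.countP_pos_iff.1 (h ▸ Nat.one_pos : 0 < T.countP Option.isNone)
    rwa [Option.isNone_iff_eq_none.1 h'] at hx
  obtain ⟨T₁, T₂, rfl⟩ := List.append_of_mem hmem
  rw [List.countP_append, List.countP_cons_of_pos rfl] at h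
  obtain ⟨Y₁, rfl⟩ := hsome T₁ fun hn =>
    List.countP_eq_zero.1 (by omega : T₁.countP Option.isNone = 0) _ hn rfl
  obtain ⟨Y₂, rfl⟩ := hsome T₂ fun hn =>
    List.countP_eq_zero.1 (by omega : T₂.countP Option.isNone = 0) _ hn rfl
  exact ⟨Y₁, Y₂, rfl⟩

theorem sum_left_only {α β : Type*} (Y : List (α ⊕ β)) (h : ∀ x, Sum.inr x ∉ Y) :
    ∃ U : List α, Y = U.map Sum.inl := by
  induction Y with
  | nil => exact ⟨[], rfl⟩
  | cons x Y ih =>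
    obtain ⟨U, rfl⟩ := ih fun y hy => h y (by simp [hy])
    rcases x with x | x
    · exact ⟨x :: U, rfl⟩
    · exact absurd (by simp) (h x)

theorem sum_right_only {α β : Type*} (Y : List (α ⊕ β)) (h : ∀ x, Sum.inl x ∉ Y) :
    ∃ U : List β, Y = U.map Sum.inr := by
  induction Y with
  | nil => exact ⟨[], rfl⟩
  | cons x Y ih =>
    obtain ⟨U, rfl⟩ := ih fun y hy => h y (by simp [hy])
    rcases x with x | x
    · exact absurd (by simp) (h x)
    · exact ⟨x :: U, rfl⟩

/-- Letter index of a `b`-level. -/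
def blockIdx (x : ℕ × Fin m) : ℤ := (x.1 * m + x.2 : ℕ)

theorem blockIdx_injective : Function.Injective (blockIdx (m := m)) := by
  rintro ⟨h, k⟩ ⟨h', k'⟩ e
  have e : h * m + k = h' * m + (k' : ℕ) := by
    simp only [blockIdx] at e
    exact_mod_cast e
  have hm : 0 < m := k.pos
  have h1 : h = h' := by
    have := congrArg (· / m) e
    simpa [Nat.add_comm, Nat.mul_comm, Nat.add_mul_div_left _ _ hm,
      Nat.div_eq_of_lt k.2, Nat.div_eq_of_lt k'.2] using this
  subst h1
  have : k = k' := Fin.ext (by omega)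
  rw [this]

theorem shT_pow_mul_pow (n : ℕ) (j : ℤ) (e : ℕ) :
    shT ^ n * shX j ^ e = shX (n + j) ^ e * shT ^ n := by
  rw [← shT_pow_conj, conj_pow]; group

theorem lhsTok_b (h : ℕ) (l : List (Fin m ⊕ Fin m)) :
    ∃ n : ℕ, shT ^ (h * m) * (l.map (lhsTok 1 (shX 0) 1 shT)).prod =
      ((lhsB h l).map fun x => shX (blockIdx x)).prod * shT ^ n := by
  induction l generalizing h with
  | nil => exact ⟨h * m, by simp [lhsB]⟩
  | cons x l ih =>
    rcases x with k | k
    · obtain ⟨n, hn⟩ := ih h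
      refine ⟨n, ?_⟩
      simp only [List.map_cons, List.prod_cons, lhsTok, lhsB, mul_assoc, ← hn, one_mul,
        powConj_pow, powConj_shX, add_zero]
      rw [← mul_assoc, shT_pow_mul_pow, mul_assoc, pow_two]
      simp [blockIdx, mul_assoc]
    · obtain ⟨n, hn⟩ := ih (h + 1)
      refine ⟨n, ?_⟩
      simp only [List.map_cons, List.prod_cons, lhsTok, lhsB, mul_assoc, ← hn, one_mul,
        powConj_shX, add_zero, inv_one]
      rw [← mul_assoc, shT_pow_mul, mul_assoc, ← mul_assoc (shT ^ (h * m)), ← pow_add]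
      simp [blockIdx, add_mul]

theorem shX_dbl_replicate (n : ℕ) (x : ℕ × Fin m) :
    ((dbl (List.replicate n x)).map fun x => shX (blockIdx x)).prod = shX (blockIdx x) ^ (2 * n) := by
  induction n with
  | zero => simp [dbl]
  | succ n ih =>
    simp only [List.replicate_succ, dbl, List.map_cons, List.prod_cons, ih]
    rw [Nat.mul_succ, pow_add, pow_two, ← mul_assoc, ← pow_two, ← pow_add, ← pow_add, Nat.add_comm]

theorem rhsTok_b (p r q s : Fin m → ℕ) (h : ℕ) (l : List (Fin m ⊕ Fin m)) :
    ∃ n : ℕ, shT ^ (h * m) * (l.map (rhsTok p r q s 1 (shX 0) 1 shT)).prod =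
      ((rhsB p r h l).map fun x => shX (blockIdx x)).prod * shT ^ n := by
  induction l generalizing h with
  | nil => exact ⟨h * m, by simp [rhsB]⟩
  | cons x l ih =>
    rcases x with k | k
    · obtain ⟨n, hn⟩ := ih h
      refine ⟨n, ?_⟩
      simp only [List.map_cons, List.prod_cons, rhsTok, rhsB, mul_assoc, List.map_append,
        List.prod_append, ← hn, one_mul, one_pow, shX_dbl_replicate,
        powConj_pow, powConj_shX, add_zero, ← pow_mul]
      rw [← mul_assoc, shT_pow_mul_pow, mul_assoc]
      simp [blockIdx]
    · obtain ⟨n, hn⟩ := ih (h + 1)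
      refine ⟨n, ?_⟩
      simp only [List.map_cons, List.prod_cons, rhsTok, rhsB, mul_assoc, List.map_append,
        List.prod_append, ← hn, one_mul, one_pow, shX_dbl_replicate, List.cons_append,
        powConj_pow, powConj_shX, add_zero, ← pow_mul, inv_one, mul_one]
      rw [← mul_assoc, ← pow_add, ← mul_assoc, shT_pow_mul, mul_assoc, ← mul_assoc (shT ^ _),
        shT_pow_mul_pow]
      simp [blockIdx, add_mul, mul_assoc]

theorem affineReach_of_simTarget_mem (p r q s : Fin m → ℕ) (hp : ∀ k, 0 < p k)
    (hq : ∀ k, 0 < q k) (n nf : ℕ) {G : Type*} [Group G] {a b c d : G}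
    (f g : G →* ShiftGroup) (hfa : f a = shT) (hfb : f b = 1) (hfc : f c = shX 0) (hfd : f d = 1)
    (hga : g a = 1) (hgb : g b = shX 0) (hgc : g c = 1) (hgd : g d = shT)
    (h : simTarget m n a c d ∈ Submonoid.closure (Set.range (simTok p r q s nf a b c d))) :
    AffineReach p r q s n nf := by
  classical
  obtain ⟨T, hT⟩ : ∃ T, (List.map (simTok p r q s nf a b c d) T).prod = simTarget m n a c d := by
    obtain ⟨l, hl, he⟩ := Submonoid.exists_list_of_mem_closure h
    obtain ⟨T, rfl⟩ : l ∈ Set.range (List.map (simTok p r q s nf a b c d)) := by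
      rw [Set.range_list_map]; exact hl
    exact ⟨T, he⟩
  have hfT := congrArg f hT
  rw [map_list_prod, List.map_map, map_simTarget, hfa, hfc, hfd] at hfT
  have hft : (f ∘ simTok p r q s nf a b c d) = simTok p r q s nf shT 1 (shX 0) 1 := by
    funext x; simp [map_simTok, hfa, hfb, hfc, hfd]
  rw [hft] at hfT
  have htar : simTarget m n shT (shX 0) 1 = SemidirectProduct.inl (FreeGroup.of 0 ^ n) *
      SemidirectProduct.inr (Multiplicative.ofAdd (-2)) := by
    simp only [simTarget, shT_pow, ← map_inv]
    simp [shX]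
  rw [htar] at hfT
  -- exactly one middle token
  have hcount : T.countP Option.isNone = 1 := by
    have hr : ∀ T : List (Option ((Fin m ⊕ Fin m) ⊕ (Fin m ⊕ Fin m))),
        (T.map (simTok p r q s nf shT 1 (shX 0) 1)).prod.right =
          Multiplicative.ofAdd (-2 * (T.countP Option.isNone : ℤ)) := by
      intro T
      induction T with
      | nil => simp
      | cons x T ih =>
        rw [List.map_cons, List.prod_cons, SemidirectProduct.mul_right, ih]
        rcases x with _ | y
        · rw [simTok_c_none, List.countP_cons_of_pos rfl, SemidirectProduct.mul_right,
            SemidirectProduct.right_inl, SemidirectProduct.right_inr, one_mul, ← ofAdd_add]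
          push_cast; ring_nf
        · rw [simTok_c_some, List.countP_cons_of_neg (by simp), SemidirectProduct.right_inl, one_mul]
    have h1 := hr T
    rw [hfT, SemidirectProduct.mul_right, SemidirectProduct.right_inl, SemidirectProduct.right_inr,
      one_mul] at h1
    have h2 : (-2 : ℤ) = -2 * (T.countP Option.isNone : ℤ) := congrArg Multiplicative.toAdd h1
    omega
  obtain ⟨Y₁, Y₂, rfl⟩ := option_list_split T hcount
  have hprod : ∀ Y : List ((Fin m ⊕ Fin m) ⊕ (Fin m ⊕ Fin m)),
      ((Y.map some).map (simTok p r q s nf shT 1 (shX 0) 1)).prod =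
        SemidirectProduct.inl (Y.map (simVal q s)).prod := by
    intro Y
    rw [map_list_prod, List.map_map, List.map_map]
    congr 1
    exact List.map_congr_left fun y _ => simTok_c_some p r q s nf y
  rw [List.map_append, List.map_cons, List.prod_append, List.prod_cons, hprod, hprod,
    simTok_c_none] at hfT
  have hleft := congrArg SemidirectProduct.left hfT
  simp only [SemidirectProduct.mul_left, SemidirectProduct.left_inl, SemidirectProduct.left_inr,
    SemidirectProduct.right_inl, SemidirectProduct.right_inr, SemidirectProduct.mul_right,
    map_one, mul_one, one_mul, MulAut.one_apply] at hleft
  have hcount0 : ∀ (J : Set ℤ) (k : ℕ), (0 : ℤ) ∉ J → levCount J (FreeGroup.of 0 ^ k) = 1 := by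
    intro J k hJ
    simp [levCount, hJ]
  -- no right hand tokens before the middle token
  have hY₁ : ∀ x, Sum.inr x ∉ Y₁ := by
    have h1 := congrArg (levCount {2, 3}) hleft
    rw [map_mul, map_mul, hcount0 _ _ (by simp), hcount0 _ _ (by simp)] at h1
    have hz : levCount {2, 3} (shiftAut (Multiplicative.ofAdd (-2)) (Y₂.map (simVal q s)).prod)
        = 1 := by
      clear h1 hleft hfT hT hcount
      induction Y₂ with
      | nil => simp
      | cons y Y ih =>
        rw [List.map_cons, List.prod_cons, map_mul, map_mul, ih, mul_one]
        rcases y with x | x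
        · rw [simVal, shiftAut_levProd, levCount_levProd_of_notMem]
          intro j hj
          have := lhsLev_le x j hj
          simp; omega
        · rw [simVal, map_inv, map_inv, shiftAut_levProd, levCount_levProd_of_notMem, inv_one]
          intro j hj
          have := rhsLev_le q s x j hj
          simp; omega
    rw [hz, mul_one, mul_one] at h1
    have hneg : ∀ Y : List ((Fin m ⊕ Fin m) ⊕ (Fin m ⊕ Fin m)),
        (levCount {2, 3} (Y.map (simVal q s)).prod).toAdd ≤ 0 ∧
        ∀ x, Sum.inr x ∈ Y → (levCount {2, 3} (Y.map (simVal q s)).prod).toAdd < 0 := by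
      intro Y
      induction Y with
      | nil => simp
      | cons y Y ih =>
        rw [List.map_cons, List.prod_cons, map_mul, toAdd_mul]
        rcases y with x | x
        · rw [simVal, levCount_levProd_of_notMem _ _ _ (by
            intro j hj
            have := lhsLev_le x j hj
            simp; omega)]
          simpa using ih
        · rw [simVal, map_inv, levCount_levProd_of_mem _ _ _ (by
            intro j hj
            have := rhsLev_le q s x j hj
            simp; omega)]
          have := rhsLev_pos (s := s) hq x
          have h3 := ih.1
          simp only [toAdd_inv, toAdd_ofAdd]
          exact ⟨by omega, fun _ _ => by omega⟩
    intro x hx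
    have := (hneg Y₁).2 x hx
    rw [h1] at this
    simp at this
  have hY₂ : ∀ x, Sum.inl x ∉ Y₂ := by
    have h1 := congrArg (levCount {-2, -1}) hleft
    rw [map_mul, map_mul, hcount0 _ _ (by simp), hcount0 _ _ (by simp)] at h1
    have hz : levCount {-2, -1} (Y₁.map (simVal q s)).prod = 1 := by
      clear h1 hleft hfT hT hcount hY₁
      induction Y₁ with
      | nil => simp
      | cons y Y ih =>
        rw [List.map_cons, List.prod_cons, map_mul, ih, mul_one]
        rcases y with x | x
        · rw [simVal, levCount_levProd_of_notMem]
          intro j hj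
          have := lhsLev_le x j hj
          simp
        · rw [simVal, map_inv, levCount_levProd_of_notMem, inv_one]
          intro j hj
          have := rhsLev_le q s x j hj
          simp; omega
    rw [hz, one_mul, one_mul] at h1
    have hpos : ∀ Y : List ((Fin m ⊕ Fin m) ⊕ (Fin m ⊕ Fin m)),
        0 ≤ (levCount {-2, -1}
          (shiftAut (Multiplicative.ofAdd (-2)) (Y.map (simVal q s)).prod)).toAdd ∧
        ∀ x, Sum.inl x ∈ Y → 0 < (levCount {-2, -1}
          (shiftAut (Multiplicative.ofAdd (-2)) (Y.map (simVal q s)).prod)).toAdd := by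
      intro Y
      induction Y with
      | nil => simp
      | cons y Y ih =>
        rw [List.map_cons, List.prod_cons, map_mul, map_mul, toAdd_mul]
        rcases y with x | x
        · rw [simVal, shiftAut_levProd, levCount_levProd_of_mem _ _ _ (by
            intro j hj
            have := lhsLev_le x j hj
            simp; omega)]
          have := lhsLev_pos x
          have h3 := ih.1
          simp only [toAdd_ofAdd]
          exact ⟨by omega, fun _ _ => by omega⟩
        · rw [simVal, map_inv, map_inv, shiftAut_levProd, levCount_levProd_of_notMem _ _ _ (by
            intro j hj
            have := rhsLev_le q s x j hj
            simp)]
          simpa using ih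
    intro x hx
    have := (hpos Y₂).2 x hx
    rw [h1] at this
    simp at this
  obtain ⟨U, rfl⟩ := sum_left_only Y₁ hY₁
  obtain ⟨V', rfl⟩ := sum_right_only Y₂ hY₂
  -- back to the equation in `G`
  have hV : ((List.map some (V'.map Sum.inr)).map (simTok p r q s nf a b c d)).prod =
      a ^ 2 * ((V'.reverse.map (rhsTok p r q s a b c d)).prod)⁻¹ * (a ^ 2)⁻¹ := by
    clear hT hcount hfT hleft hY₂
    induction V' with
    | nil => simp
    | cons x V ih =>
      simp only [List.map_cons, List.prod_cons, ih, simTok, List.reverse_cons, List.map_append,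
        List.prod_append, List.map_nil, List.prod_nil, mul_one, mul_inv_rev]
      group
  have hU : ((List.map some (U.map Sum.inl)).map (simTok p r q s nf a b c d)).prod =
      (U.map (lhsTok a b c d)).prod := by
    rw [List.map_map, List.map_map]; rfl
  rw [List.map_append, List.map_cons, List.prod_append, List.prod_cons, hU, hV] at hT
  set V := V'.reverse
  have hmain : d ^ m * (U.map (lhsTok a b c d)).prod * c ^ nf =
      c ^ n * (V.map (rhsTok p r q s a b c d)).prod * d ^ m := by
    simp only [simTok, simTarget] at hT
    generalize (U.map (lhsTok a b c d)).prod = l₁ at hT ⊢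
    generalize (V.map (rhsTok p r q s a b c d)).prod = l₂ at hT ⊢
    calc d ^ m * l₁ * c ^ nf = d ^ m * (l₁ * (c ^ nf * (d ^ m)⁻¹ * (a ^ 2)⁻¹ *
          (a ^ 2 * l₂⁻¹ * (a ^ 2)⁻¹))) * a ^ 2 * l₂ * d ^ m := by group
      _ = _ := by rw [hT]; group
  have hf := congrArg f hmain
  have hg := congrArg g hmain
  simp only [map_mul, map_pow, map_list_prod, List.map_map, hfd, hfc, one_pow, one_mul, mul_one,
    hgd, hgc] at hf hg
  have e1 : f ∘ lhsTok (m := m) a b c d = lhsTok shT 1 (shX 0) 1 := by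
    funext x; simp [map_lhsTok, hfa, hfb, hfc, hfd]
  have e2 : f ∘ rhsTok p r q s a b c d = rhsTok p r q s shT 1 (shX 0) 1 := by
    funext x; simp [map_rhsTok, hfa, hfb, hfc, hfd]
  have e3 : g ∘ lhsTok (m := m) a b c d = lhsTok 1 (shX 0) 1 shT := by
    funext x; simp [map_lhsTok, hga, hgb, hgc, hgd]
  have e4 : g ∘ rhsTok p r q s a b c d = rhsTok p r q s 1 (shX 0) 1 shT := by
    funext x; simp [map_rhsTok, hga, hgb, hgc, hgd]
  rw [e1, e2] at hf
  rw [e3, e4] at hg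
  refine affineReach_of_strings p r q s hp nf V.length V U 0 n le_rfl ?_ ?_
  · obtain ⟨n₁, h₁⟩ := lhsTok_b 1 U
    obtain ⟨n₂, h₂⟩ := rhsTok_b p r q s 0 V
    rw [one_mul] at h₁
    rw [zero_mul, pow_zero, one_mul] at h₂
    rw [h₁, h₂, mul_assoc, ← pow_add, shT_pow, shT_pow] at hg
    have hg' : (((lhsB 1 U).map blockIdx).map shX).prod *
        SemidirectProduct.inr (Multiplicative.ofAdd (n₁ : ℤ)) =
        (((rhsB p r 0 V).map blockIdx).map shX).prod *
        SemidirectProduct.inr (Multiplicative.ofAdd ((n₂ + m : ℕ) : ℤ)) := by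
      rw [List.map_map, List.map_map]; exact hg
    exact List.map_injective_iff.2 blockIdx_injective (shX_prod_injective hg')
  · have l1 : ∀ l : List (Fin m ⊕ Fin m), (l.map (lhsTok shT 1 (shX 0) 1)).prod =
        SemidirectProduct.inl (levProd 0 (lhsC l)) := by
      intro l
      induction l with
      | nil => simp [levProd, lhsC]
      | cons x l ih =>
        rw [List.map_cons, List.prod_cons, ih, lhsTok_c, ← map_mul, ← levProd_append, lhsC_eq,
          lhsC_eq, List.flatMap_cons]
    have l2 : ∀ l : List (Fin m ⊕ Fin m), (l.map (rhsTok p r q s shT 1 (shX 0) 1)).prod =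
        SemidirectProduct.inl (levProd 0 (rhsC q s l)) := by
      intro l
      induction l with
      | nil => simp [levProd, rhsC]
      | cons x l ih =>
        rw [List.map_cons, List.prod_cons, ih, rhsTok_c, ← map_mul, ← levProd_append, rhsC_eq,
          rhsC_eq, List.flatMap_cons]
    have hx : ∀ k : ℕ, shX 0 ^ k = SemidirectProduct.inl (levProd 0 (List.replicate k 0)) := by
      intro k; rw [levProd_replicate, shX, map_pow]
    rw [l1, l2, hx, hx, ← map_mul, ← map_mul, ← levProd_append, ← levProd_append] at hf
    have := SemidirectProduct.inl_injective hf
    simp only [levProd] at this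
    have h3 : (List.map FreeGroup.of ((lhsC U ++ List.replicate nf 0).map fun j : ℕ => (0 + (j : ℤ)))).prod
        = (List.map FreeGroup.of ((List.replicate n 0 ++ rhsC q s V).map fun j : ℕ => (0 + (j : ℤ)))).prod := by
      rw [List.map_map, List.map_map]; exact this
    exact List.map_injective_iff.2 (fun a b h => by simpa using h) (freeGroup_positive_injective h3)

end Soundness

section CounterAutomata

open Relation

/-- Elementary actions on counters. -/
inductive CounterAct
  | skip
  | inc (i : ℕ)
  | dec (i : ℕ)
  | zero (i : ℕ)

/-- Semantics of elementary actions. -/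
def CounterAct.Sem : CounterAct → (ℕ → ℕ) → (ℕ → ℕ) → Prop
  | skip, x, y => y = x
  | inc i, x, y => y = Function.update x i (x i + 1)
  | dec i, x, y => 0 < x i ∧ y = Function.update x i (x i - 1)
  | zero i, x, y => x i = 0 ∧ y = x

/-- One step of a counter automaton with the given transitions. -/
def CounterStep {Q : Type} (Δ : Set (Q × CounterAct × Q)) (u v : Q × (ℕ → ℕ)) : Prop :=
  ∃ a, (u.1, a, v.1) ∈ Δ ∧ a.Sem u.2 v.2

/-- The relation is realized by a finite counter automaton. -/
def CounterImpl (R : (ℕ → ℕ) → (ℕ → ℕ) → Prop) : Prop :=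
  ∃ (Q : Type) (_ : Finite Q) (s t : Q) (Δ : Set (Q × CounterAct × Q)), Δ.Finite ∧
    ∀ x y, ReflTransGen (CounterStep Δ) (s, x) (t, y) ↔ R x y

theorem CounterImpl.act (a : CounterAct) : CounterImpl a.Sem := by
  refine ⟨Bool, inferInstance, false, true, {(false, a, true)}, Set.finite_singleton _,
    fun x y => ⟨fun h => ?_, fun h => ReflTransGen.single ⟨a, rfl, h⟩⟩⟩
  have : ∀ v : Bool × (ℕ → ℕ), ReflTransGen (CounterStep {(false, a, true)}) (false, x) v →
      if v.1 then a.Sem x v.2 else v.2 = x := by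
    intro v hv
    induction hv with
    | refl => rfl
    | @tail u v _ huv ih =>
      obtain ⟨b, hb, hs⟩ := huv
      simp only [Set.mem_singleton_iff, Prod.mk.injEq] at hb
      obtain ⟨h1, rfl, h3⟩ := hb
      rw [h1] at ih
      rw [h3]
      simp only [Bool.false_eq_true, if_false] at ih
      rw [ih] at hs
      simpa using hs
  simpa using this _ h

theorem CounterImpl.seq {R₁ R₂ : (ℕ → ℕ) → (ℕ → ℕ) → Prop} (h₁ : CounterImpl R₁)
    (h₂ : CounterImpl R₂) : CounterImpl fun x y => ∃ z, R₁ x z ∧ R₂ z y := by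
  obtain ⟨Q₁, _, s₁, t₁, Δ₁, hf₁, h₁⟩ := h₁
  obtain ⟨Q₂, _, s₂, t₂, Δ₂, hf₂, h₂⟩ := h₂
  let i₁ : Q₁ × CounterAct × Q₁ → (Q₁ ⊕ Q₂) × CounterAct × (Q₁ ⊕ Q₂) :=
    fun d => (Sum.inl d.1, d.2.1, Sum.inl d.2.2)
  let i₂ : Q₂ × CounterAct × Q₂ → (Q₁ ⊕ Q₂) × CounterAct × (Q₁ ⊕ Q₂) :=
    fun d => (Sum.inr d.1, d.2.1, Sum.inr d.2.2)
  let Δ := i₁ '' Δ₁ ∪ i₂ '' Δ₂ ∪ {(Sum.inl t₁, CounterAct.skip, Sum.inr s₂)}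
  refine ⟨Q₁ ⊕ Q₂, inferInstance, Sum.inl s₁, Sum.inr t₂, Δ,
    ((hf₁.image _).union (hf₂.image _)).union (Set.finite_singleton _), fun x y => ⟨fun h => ?_, ?_⟩⟩
  · have : ∀ v : (Q₁ ⊕ Q₂) × (ℕ → ℕ), ReflTransGen (CounterStep Δ) (Sum.inl s₁, x) v →
        (∀ q, v.1 = Sum.inl q → ReflTransGen (CounterStep Δ₁) (s₁, x) (q, v.2)) ∧
        (∀ q, v.1 = Sum.inr q → ∃ z, R₁ x z ∧ ReflTransGen (CounterStep Δ₂) (s₂, z) (q, v.2)) := by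
      intro v hv
      induction hv with
      | refl =>
        refine ⟨?_, by simp⟩
        rintro q ⟨⟩
        exact ReflTransGen.refl
      | @tail u v _ huv ih =>
        obtain ⟨u, xu⟩ := u
        obtain ⟨v, xv⟩ := v
        obtain ⟨b, hb, hs⟩ := huv
        simp only at hb hs ih ⊢
        rcases hb with (⟨d, hd, he⟩ | ⟨d, hd, he⟩) | he
        · simp only [i₁, Prod.mk.injEq] at he
          obtain ⟨rfl, rfl, rfl⟩ := he
          refine ⟨?_, by simp⟩
          rintro q ⟨⟩
          exact (ih.1 _ rfl).tail ⟨d.2.1, hd, hs⟩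
        · simp only [i₂, Prod.mk.injEq] at he
          obtain ⟨rfl, rfl, rfl⟩ := he
          refine ⟨by simp, ?_⟩
          rintro q ⟨⟩
          obtain ⟨z, hz, hr⟩ := ih.2 _ rfl
          exact ⟨z, hz, hr.tail ⟨d.2.1, hd, hs⟩⟩
        · simp only [Set.mem_singleton_iff, Prod.mk.injEq] at he
          obtain ⟨rfl, rfl, rfl⟩ := he
          refine ⟨by simp, ?_⟩
          rintro q ⟨⟩
          cases hs
          exact ⟨xu, (h₁ _ _).1 (ih.1 _ rfl), ReflTransGen.refl⟩
    exact (by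
      obtain ⟨z, hz, hr⟩ := (this _ h).2 _ rfl
      exact ⟨z, hz, (h₂ _ _).1 hr⟩)
  · rintro ⟨z, h1, h2⟩
    have e1 := (h₁ _ _).2 h1
    have e2 := (h₂ _ _).2 h2
    have l1 : ReflTransGen (CounterStep Δ) (Sum.inl s₁, x) (Sum.inl t₁, z) :=
      ReflTransGen.lift (p := CounterStep Δ) (r := CounterStep Δ₁)
      (fun u : Q₁ × (ℕ → ℕ) => (Sum.inl u.1, u.2)) (fun u v ⟨a, ha, hs⟩ =>
        ⟨a, Or.inl (Or.inl ⟨_, ha, rfl⟩), hs⟩) _ _ e1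
    have l2 : ReflTransGen (CounterStep Δ) (Sum.inr s₂, z) (Sum.inr t₂, y) :=
      ReflTransGen.lift (p := CounterStep Δ) (r := CounterStep Δ₂)
      (fun u : Q₂ × (ℕ → ℕ) => (Sum.inr u.1, u.2)) (fun u v ⟨a, ha, hs⟩ =>
        ⟨a, Or.inl (Or.inr ⟨_, ha, rfl⟩), hs⟩) _ _ e2
    have l3 : CounterStep Δ (Sum.inl t₁, z) (Sum.inr s₂, z) :=
      ⟨CounterAct.skip, Or.inr rfl, rfl⟩
    exact (l1.tail l3).trans l2

theorem CounterImpl.star {R : (ℕ → ℕ) → (ℕ → ℕ) → Prop} (h : CounterImpl R) :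
    CounterImpl (ReflTransGen R) := by
  obtain ⟨Q, _, s, t, Δ₁, hf, h⟩ := h
  let i : Q × CounterAct × Q → Option Q × CounterAct × Option Q :=
    fun d => (some d.1, d.2.1, some d.2.2)
  let Δ := i '' Δ₁ ∪ {(none, CounterAct.skip, some s), (some t, CounterAct.skip, none)}
  have hlift : ∀ u v : Q × (ℕ → ℕ), ReflTransGen (CounterStep Δ₁) u v →
      ReflTransGen (CounterStep Δ) (some u.1, u.2) (some v.1, v.2) := fun u v huv =>
    ReflTransGen.lift (p := CounterStep Δ) (r := CounterStep Δ₁)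
      (fun u : Q × (ℕ → ℕ) => (some u.1, u.2))
      (fun u v ⟨a, ha, hs⟩ => ⟨a, Or.inl ⟨_, ha, rfl⟩, hs⟩) _ _ huv
  refine ⟨Option Q, inferInstance, none, none, Δ, (hf.image _).union (by simp),
    fun x y => ⟨fun hr => ?_, fun hr => ?_⟩⟩
  · have : ∀ v : Option Q × (ℕ → ℕ), ReflTransGen (CounterStep Δ) (none, x) v →
        (v.1 = none → ReflTransGen R x v.2) ∧
        (∀ q, v.1 = some q → ∃ z, ReflTransGen R x z ∧
          ReflTransGen (CounterStep Δ₁) (s, z) (q, v.2)) := by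
      intro v hv
      induction hv with
      | refl => exact ⟨fun _ => ReflTransGen.refl, by simp⟩
      | @tail u v _ huv ih =>
        obtain ⟨u, xu⟩ := u
        obtain ⟨v, xv⟩ := v
        obtain ⟨b, hb, hs⟩ := huv
        simp only at hb hs ih ⊢
        rcases hb with ⟨d, hd, he⟩ | he | he
        · simp only [i, Prod.mk.injEq] at he
          obtain ⟨rfl, rfl, rfl⟩ := he
          refine ⟨by simp, ?_⟩
          rintro q ⟨⟩
          obtain ⟨z, hz, hr⟩ := ih.2 _ rfl
          exact ⟨z, hz, hr.tail ⟨d.2.1, hd, hs⟩⟩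
        · simp only [Prod.mk.injEq] at he
          obtain ⟨rfl, rfl, rfl⟩ := he
          refine ⟨by simp, ?_⟩
          rintro q ⟨⟩
          cases hs
          exact ⟨xu, ih.1 rfl, ReflTransGen.refl⟩
        · simp only [Set.mem_singleton_iff, Prod.mk.injEq] at he
          obtain ⟨rfl, rfl, rfl⟩ := he
          refine ⟨fun _ => ?_, by simp⟩
          cases hs
          obtain ⟨z, hz, hr⟩ := ih.2 _ rfl
          exact hz.tail ((h _ _).1 hr)
    exact (this _ hr).1 rfl
  · induction hr with
    | refl => exact ReflTransGen.refl
    | @tail y z _ hyz ih =>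
      have h1 := hlift _ _ ((h _ _).2 hyz)
      have h2 : ReflTransGen (CounterStep Δ) (none, y) (some s, y) :=
        ReflTransGen.single ⟨CounterAct.skip, Or.inr (Or.inl rfl), rfl⟩
      exact ih.trans ((h2.trans h1).tail ⟨CounterAct.skip, Or.inr (Or.inr rfl), rfl⟩)

/-- Under the precondition `P`, the function `f` is computed by a counter automaton. -/
def CounterComp (P : (ℕ → ℕ) → Prop) (f : (ℕ → ℕ) → (ℕ → ℕ)) : Prop :=
  ∃ R, CounterImpl R ∧ ∀ x, P x → ∀ y, R x y ↔ y = f x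

theorem CounterComp.mono {P P' : (ℕ → ℕ) → Prop} {f f' : (ℕ → ℕ) → (ℕ → ℕ)}
    (h : CounterComp P f) (hP : ∀ x, P' x → P x) (hf : ∀ x, P' x → f x = f' x) :
    CounterComp P' f' := by
  obtain ⟨R, hR, h⟩ := h
  exact ⟨R, hR, fun x hx y => by rw [h x (hP x hx), hf x hx]⟩

theorem CounterComp.id (P : (ℕ → ℕ) → Prop) : CounterComp P fun x => x :=
  ⟨_, CounterImpl.act .skip, fun _ _ _ => Iff.rfl⟩

theorem CounterComp.inc (P : (ℕ → ℕ) → Prop) (i : ℕ) :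
    CounterComp P fun x => Function.update x i (x i + 1) :=
  ⟨_, CounterImpl.act (.inc i), fun _ _ _ => Iff.rfl⟩

theorem CounterComp.seq {P Q : (ℕ → ℕ) → Prop} {f g : (ℕ → ℕ) → (ℕ → ℕ)}
    (hf : CounterComp P f) (hg : CounterComp Q g) (hPQ : ∀ x, P x → Q (f x)) :
    CounterComp P fun x => g (f x) := by
  obtain ⟨R, hR, hf⟩ := hf
  obtain ⟨R', hR', hg⟩ := hg
  refine ⟨_, hR.seq hR', fun x hx y => ⟨?_, ?_⟩⟩
  · rintro ⟨z, h1, h2⟩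
    obtain rfl := (hf x hx z).1 h1
    exact (hg _ (hPQ x hx) y).1 h2
  · rintro rfl
    exact ⟨f x, (hf x hx _).2 rfl, (hg _ (hPQ x hx) _).2 rfl⟩

theorem CounterComp.loop {P Q : (ℕ → ℕ) → Prop} {f : (ℕ → ℕ) → (ℕ → ℕ)} (i : ℕ)
    (hf : CounterComp Q f)
    (hPQ : ∀ x, P x → 0 < x i → Q (Function.update x i (x i - 1)) ∧
      P (f (Function.update x i (x i - 1))) ∧ f (Function.update x i (x i - 1)) i = x i - 1)
    (h : (ℕ → ℕ) → (ℕ → ℕ)) (h0 : ∀ x, P x → x i = 0 → h x = x)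
    (h1 : ∀ x, P x → 0 < x i → h x = h (f (Function.update x i (x i - 1)))) :
    CounterComp P h := by
  obtain ⟨R, hR, hf⟩ := hf
  refine ⟨_, (((CounterImpl.act (.dec i)).seq hR).star).seq (CounterImpl.act (.zero i)),
    fun x hx y => ⟨?_, ?_⟩⟩
  · rintro ⟨z, hr, hz, rfl⟩
    induction hr using ReflTransGen.head_induction_on with
    | refl => exact (h0 _ hx hz).symm
    | @head x w hstep _ ih =>
      obtain ⟨v, ⟨hpos, rfl⟩, hv⟩ := hstep
      obtain ⟨a, b, c⟩ := hPQ x hx hpos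
      obtain rfl := (hf _ a _).1 hv
      rw [ih b, h1 x hx hpos]
  · rintro rfl
    suffices ReflTransGen (fun x y => ∃ z, (CounterAct.dec i).Sem x z ∧ R z y) x (h x) ∧
        h x i = 0 from ⟨_, this.1, this.2, rfl⟩
    obtain ⟨n, hn⟩ : ∃ n, x i = n := ⟨_, rfl⟩
    induction n generalizing x with
    | zero => rw [h0 x hx hn]; exact ⟨ReflTransGen.refl, hn⟩
    | succ n ih =>
      have hpos : 0 < x i := by omega
      obtain ⟨a, b, c⟩ := hPQ x hx hpos
      rw [h1 x hx hpos]
      obtain ⟨h1, h2⟩ := ih (f (Function.update x i (x i - 1))) b (by omega)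
      exact ⟨ReflTransGen.head ⟨_, ⟨hpos, rfl⟩, (hf _ a _).2 rfl⟩ h1, h2⟩

theorem CounterComp.clear (P : (ℕ → ℕ) → Prop) (i : ℕ) :
    CounterComp P fun x => Function.update x i 0 := by
  refine CounterComp.mono (P := fun _ => True) (CounterComp.loop i
    (CounterComp.id fun _ => True) (by simp) (fun x => Function.update x i 0) ?_ ?_)
    (fun _ _ => trivial) fun x _ => rfl
  · intro x _ hx
    simp [← hx]
  · simp

theorem CounterComp.move (P : (ℕ → ℕ) → Prop) {i j : ℕ} (hij : i ≠ j) :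
    CounterComp P fun x => Function.update (Function.update x j (x j + x i)) i 0 := by
  refine CounterComp.mono (P := fun _ => True) (CounterComp.loop i
    (CounterComp.inc (fun _ => True) j) (by simp [hij])
    (fun x => Function.update (Function.update x j (x j + x i)) i 0) ?_ ?_)
    (fun _ _ => trivial) fun x _ => rfl
  · intro x _ hx
    simp [hx]
  · intro x _ hx
    funext k
    by_cases h1 : k = i
    · subst h1; simp
    · by_cases h2 : k = j
      · subst h2; simp [hij.symm, hij]; omega
      · simp [h1, h2]

theorem CounterComp.move₂ (P : (ℕ → ℕ) → Prop) {i j l : ℕ} (hij : i ≠ j) (hil : i ≠ l)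
    (hjl : j ≠ l) : CounterComp P fun x =>
      Function.update (Function.update (Function.update x j (x j + x i)) l (x l + x i)) i 0 := by
  refine CounterComp.mono (P := fun _ => True) (CounterComp.loop i
    ((CounterComp.inc (fun _ => True) j).seq (CounterComp.inc (fun _ => True) l)
      fun _ _ => trivial) (by simp [hij, hil])
    (fun x => Function.update (Function.update (Function.update x j (x j + x i)) l (x l + x i))
      i 0) ?_ ?_) (fun _ _ => trivial) fun x _ => rfl
  · intro x _ hx
    simp [hx]
  · intro x _ hx
    funext k
    by_cases h1 : k = i
    · subst h1; simp
    · by_cases h2 : k = j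
      · subst h2; simp [hij.symm, hij, hil, hjl]; omega
      · by_cases h3 : k = l
        · subst h3; simp [hil.symm, hjl.symm, hil, hij]; omega
        · simp [h1, h2, h3]

/-- Copy register `i` to the empty register `j` using the empty register `l`. -/
theorem CounterComp.copy {i j l : ℕ} (hij : i ≠ j) (hil : i ≠ l) (hjl : j ≠ l) :
    CounterComp (fun x => x j = 0 ∧ x l = 0) fun x => Function.update x j (x i) := by
  refine ((CounterComp.move₂ (fun _ => True) hij hil hjl).seq
    (CounterComp.move (fun _ => True) hil.symm) fun _ _ => trivial).mono
    (fun _ _ => trivial) fun x hx => ?_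
  funext k
  by_cases h1 : k = i
  · subst h1; simp [hij, hil, hil.symm, hx.2]
  · by_cases h2 : k = j
    · subst h2; simp [hij.symm, hjl, hx.1]
    · by_cases h3 : k = l
      · subst h3; simp [hjl.symm, hx.2]
      · simp [h1, h2, h3]

end CounterAutomata

section CounterPrimrec

open Relation

theorem CounterComp.clearRange (P : (ℕ → ℕ) → Prop) (s k : ℕ) :
    CounterComp P fun x j => if s ≤ j ∧ j < s + k then 0 else x j := by
  induction k with
  | zero =>
    refine (CounterComp.id P).mono (fun _ h => h) fun x _ => ?_
    funext j
    rw [if_neg (by omega)]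
  | succ k ih =>
    refine (ih.seq (CounterComp.clear (fun _ => True) (s + k)) fun _ _ => trivial).mono
      (fun _ h => h) fun x _ => ?_
    funext j
    by_cases h1 : j = s + k
    · subst h1; simp
    · rw [Function.update_of_ne h1]
      have : (s ≤ j ∧ j < s + k) ↔ (s ≤ j ∧ j < s + (k + 1)) := by omega
      simp only [this]

/-- Every primitive recursive function is computed by a counter automaton on given
input registers `ρ`, output register `o` and scratch registers from `s` on. -/
theorem counterComp_of_primrec' {n : ℕ} {f : List.Vector ℕ n → ℕ} (hf : Nat.Primrec' f) :
    ∀ (ρ : Fin n → ℕ) (o s : ℕ), (∀ i, ρ i < s) → o < s → (∀ i, ρ i ≠ o) →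
      CounterComp (fun x => x o = 0 ∧ ∀ j, s ≤ j → x j = 0)
        (fun x => Function.update x o (f (List.Vector.ofFn fun i => x (ρ i)))) := by
  induction hf with
  | zero =>
    intro ρ o s _ _ _
    refine (CounterComp.id _).mono (fun _ h => h) fun x hx => ?_
    exact (Function.update_eq_self_iff.2 hx.1.symm).symm
  | succ =>
    intro ρ o s hρ ho hne
    refine ((CounterComp.copy (hne 0) (hρ 0).ne ho.ne).seq
      (CounterComp.inc (fun _ => True) o) fun _ _ => trivial).mono
      (fun x hx => ⟨hx.1, hx.2 s le_rfl⟩) fun x hx => ?_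
    simp
  | get i =>
    intro ρ o s hρ ho hne
    refine (CounterComp.copy (hne i) (hρ i).ne ho.ne).mono
      (fun x hx => ⟨hx.1, hx.2 s le_rfl⟩) fun x hx => ?_
    simp
  | @comp m n f g _ _ ihf ihg =>
    intro ρ o s hρ ho hne
    have key : ∀ k ≤ n, CounterComp (fun x => x o = 0 ∧ ∀ j, s ≤ j → x j = 0)
        (fun x j => if h : s ≤ j ∧ j < s + k ∧ j < s + n then
          g ⟨j - s, by omega⟩ (List.Vector.ofFn fun i => x (ρ i)) else x j) := by
      intro k hk
      induction k with
      | zero =>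
        refine (CounterComp.id _).mono (fun _ h => h) fun x hx => ?_
        funext j
        rw [dif_neg (by omega)]
      | succ k ih =>
        refine ((ih (by omega)).seq (ihg ⟨k, by omega⟩ ρ (s + k) (s + n)
          (fun i => (hρ i).trans_le (by omega)) (by omega)
          (fun i => ((hρ i).trans_le (by omega)).ne)) ?_).mono (fun _ h => h) ?_
        · intro x hx
          refine ⟨?_, fun j hj => ?_⟩
          · beta_reduce; rw [dif_neg (by omega)]; exact hx.2 _ (by omega)
          · beta_reduce; rw [dif_neg (by omega)]; exact hx.2 _ (by omega)
        · intro x hx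
          funext j
          by_cases h1 : j = s + k
          · subst h1
            rw [Function.update_self, dif_pos (by omega)]
            congr 1
            · simp
            · congr 1
              funext i
              have := hρ i
              beta_reduce; rw [dif_neg (by omega)]
          · rw [Function.update_of_ne h1]
            have : (s ≤ j ∧ j < s + k ∧ j < s + n) ↔ (s ≤ j ∧ j < s + (k + 1) ∧ j < s + n) := by
              omega
            simp only [this]
    refine (((key n le_rfl).seq (ihf (fun i => s + i) o (s + n) (fun i => by simp)
      (by omega) (fun i => by omega)) ?_).seq
      (CounterComp.clearRange (fun _ => True) s n) fun _ _ => trivial).mono (fun _ h => h) ?_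
    · intro x hx
      refine ⟨?_, fun j hj => ?_⟩
      · beta_reduce; rw [dif_neg (by omega)]; exact hx.1
      · beta_reduce; rw [dif_neg (by omega)]; exact hx.2 _ (by omega)
    · intro x hx
      funext j
      by_cases h1 : j = o
      · subst h1
        rw [if_neg (by omega), Function.update_self, Function.update_self]
        congr 2
        funext i
        beta_reduce; rw [dif_pos (by omega)]
        congr 1
        simp
      · rw [Function.update_of_ne h1, Function.update_of_ne h1]
        by_cases h2 : s ≤ j ∧ j < s + n
        · rw [if_pos h2, hx.2 _ h2.1]
        · rw [if_neg h2, dif_neg (by omega)]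
  | @prec n f g _ _ ihf ihg =>
    intro ρ o s hρ ho hne
    let tl : (ℕ → ℕ) → List.Vector ℕ n := fun x => List.Vector.ofFn fun i => x (ρ i.succ)
    let rc : (ℕ → ℕ) → ℕ → ℕ := fun x N =>
      Nat.rec (f (tl x)) (fun y IH => g (y ::ᵥ IH ::ᵥ tl x)) N
    have htl : ∀ x j v, (s ≤ j ∨ j = o) → tl (Function.update x j v) = tl x := by
      intro x j v hj
      simp only [tl]
      congr 1
      funext i
      have h1 := hρ i.succ
      have h2 := hne i.succ
      rw [Function.update_of_ne]
      rcases hj with hj | rfl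
      · omega
      · exact h2
    have hrc : ∀ x j v, (s ≤ j ∨ j = o) → rc (Function.update x j v) = rc x := by
      intro x j v hj
      simp only [rc, htl x j v hj]
    have body : CounterComp (fun z => ∀ j, s + 2 ≤ j → z j = 0)
        (fun z => Function.update (Function.update z o (g (z (s + 1) ::ᵥ z o ::ᵥ tl z)))
          (s + 1) (z (s + 1) + 1)) := by
      have h1 := ihg (Fin.cons (s + 1) (Fin.cons o fun i => ρ i.succ)) (s + 2) (s + 3)
        (fun i => by
          refine Fin.cases ?_ (fun i => Fin.cases ?_ (fun i => ?_) i) i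
          · simp
          · simp; omega
          · have := hρ i.succ
            simp; omega) (by omega)
        (fun i => by
          refine Fin.cases ?_ (fun i => Fin.cases ?_ (fun i => ?_) i) i
          · simp
          · simp; omega
          · have := hρ i.succ
            simp; omega)
      have hne1 : s + 2 ≠ o := by omega
      refine ((((h1.seq (CounterComp.clear (fun _ => True) o) fun _ _ => trivial).seq
        (CounterComp.move (fun _ => True) hne1) fun _ _ => trivial).seq
        (CounterComp.inc (fun _ => True) (s + 1)) fun _ _ => trivial)).mono
        (fun x hx => ⟨hx _ le_rfl, fun j hj => hx _ (by omega)⟩) ?_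
      intro z hz
      have hv : (List.Vector.ofFn fun i => z ((Fin.cons (s + 1)
          (Fin.cons o fun i => ρ i.succ : Fin (n + 1) → ℕ) : Fin (n + 2) → ℕ) i)) =
          z (s + 1) ::ᵥ z o ::ᵥ tl z := rfl
      simp only [hv]
      have hne2 : s + 1 ≠ o := by omega
      funext j
      by_cases h1 : j = s + 1
      · subst h1; simp [hne2]
      · by_cases h2 : j = o
        · subst h2; simp [hne1, hne1.symm, hne2.symm]
        · by_cases h3 : j = s + 2
          · subst h3; simp [hne1, hz (s + 2) le_rfl]
          · simp [h1, h2, h3]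
    have hos : o ≠ s := ho.ne
    have hos1 : o ≠ s + 1 := by omega
    have lp := CounterComp.loop
      (P := fun z => z o = rc z (z (s + 1)) ∧ ∀ j, s + 2 ≤ j → z j = 0) s body
      (by
        rintro z ⟨hz1, hz2⟩ hpos
        refine ⟨fun j hj => ?_, ⟨?_, fun j hj => ?_⟩, ?_⟩
        · rw [Function.update_of_ne (by omega)]; exact hz2 j hj
        · rw [hrc _ _ _ (by omega), hrc _ _ _ (by omega), hrc _ _ _ (by omega)]
          simp [hos1, hos, htl, hz1, rc]
        · rw [Function.update_of_ne (by omega), Function.update_of_ne (by omega),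
            Function.update_of_ne (by omega)]
          exact hz2 j hj
        · simp [hos.symm])
      (fun z => Function.update (Function.update (Function.update z o (rc z (z (s + 1) + z s)))
        s 0) (s + 1) (z (s + 1) + z s))
      (by
        rintro z ⟨hz1, hz2⟩ hz
        rw [hz]
        simp only [add_zero]
        rw [← hz1, ← hz]
        simp)
      (by
        rintro z ⟨hz1, hz2⟩ hpos
        have e : z (s + 1) + 1 + (z s - 1) = z (s + 1) + z s := by omega
        simp only [hrc _ _ _ (Or.inr rfl), hrc _ s _ (Or.inl le_rfl),
          hrc _ (s + 1) _ (Or.inl (Nat.le_succ s))]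
        funext j
        by_cases h1 : j = s + 1
        · subst h1; simp [hos.symm, e]
        · by_cases h2 : j = s
          · subst h2; simp
          · by_cases h3 : j = o
            · subst h3; simp [hos, hos1, e, hos.symm]
            · simp [h1, h2, h3])
    refine ((((ihf (fun i => ρ i.succ) o s (fun i => hρ _) ho fun i => hne _).seq
      (CounterComp.copy (i := ρ 0) (j := s) (l := s + 1) (hρ 0).ne (by have := hρ 0; omega)
        (by omega)) ?_).seq lp ?_).seq
      (CounterComp.clear (fun _ => True) (s + 1)) fun _ _ => trivial).mono (fun _ h => h) ?_
    · rintro x ⟨hx1, hx2⟩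
      rw [Function.update_of_ne (by omega), Function.update_of_ne (by omega)]
      exact ⟨hx2 _ le_rfl, hx2 _ (by omega)⟩
    · rintro x ⟨hx1, hx2⟩
      refine ⟨?_, fun j hj => ?_⟩
      · rw [hrc _ _ _ (by omega), hrc _ _ _ (by omega)]
        simp [hos, hos1.symm, hx2 (s + 1) (by omega), rc, tl]
      · rw [Function.update_of_ne (by omega), Function.update_of_ne (by omega)]
        exact hx2 _ (by omega)
    · rintro x ⟨hx1, hx2⟩
      have h0 := hne 0
      have e1 : x (s + 1) = 0 := hx2 _ (by omega)
      simp only [hrc _ _ _ (Or.inr rfl), hrc _ s _ (Or.inl le_rfl)]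
      have hr : (fun v : List.Vector ℕ (n + 1) => (v.head.rec (f v.tail)
          fun y IH => g (y ::ᵥ IH ::ᵥ v.tail) : ℕ)) (List.Vector.ofFn fun i => x (ρ i)) =
          rc x (x (ρ 0)) := rfl
      simp only at hr
      rw [hr]
      funext j
      by_cases h1 : j = s + 1
      · subst h1; simp [hos1.symm, e1]
      · by_cases h2 : j = s
        · subst h2; simp [hos.symm, hx2 j le_rfl]
        · by_cases h3 : j = o
          · subst h3; simp [hos, hos1, hos1.symm, h0, e1]
          · simp [h1, h2, h3]

end CounterPrimrec

section CounterUndecidable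

open Relation

theorem exists_primrec_halting : ∃ f : ℕ → ℕ → ℕ, Primrec₂ f ∧
    ¬ ComputablePred (fun n => ∃ k, f n k = 0) := by
  classical
  refine ⟨fun n k => Option.casesOn
    (Nat.Partrec.Code.evaln k (Denumerable.ofNat Nat.Partrec.Code n) 0) 1 (fun _ => 0), ?_, ?_⟩
  · refine Primrec.option_casesOn (o := fun (x : ℕ × ℕ) => Nat.Partrec.Code.evaln x.2
      (Denumerable.ofNat Nat.Partrec.Code x.1) 0) (f := fun _ => 1) (g := fun _ _ => 0) ?_
      (Primrec.const 1) (Primrec.const 0).to₂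
    exact Nat.Partrec.Code.primrec_evaln.comp (Primrec.pair (Primrec.pair Primrec.snd
      ((Primrec.ofNat _).comp Primrec.fst)) (Primrec.const 0))
  · intro h
    apply ComputablePred.halting_problem 0
    have h2 := ComputablePred.computable_iff.1 h
    obtain ⟨g, hg, hgP⟩ := h2
    refine ComputablePred.computable_iff.2
      ⟨fun c => g (Encodable.encode c), hg.comp Computable.encode, ?_⟩
    funext c
    have h3 := congrFun hgP (Encodable.encode c)
    rw [← h3]
    simp only [Denumerable.ofNat_encode, eq_iff_iff]
    rw [Part.dom_iff_mem]
    constructor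
    · rintro ⟨y, hy⟩
      obtain ⟨k, hk⟩ := Nat.Partrec.Code.evaln_complete.1 hy
      refine ⟨k, ?_⟩
      rw [Option.mem_def.1 hk]
    · rintro ⟨k, hk⟩
      cases hE : Nat.Partrec.Code.evaln k c 0 with
      | none => rw [hE] at hk; simp at hk
      | some y => exact ⟨y, Nat.Partrec.Code.evaln_sound (Option.mem_def.2 hE)⟩

theorem reflTransGen_inc (i : ℕ) (x y : ℕ → ℕ) :
    ReflTransGen (CounterAct.inc i).Sem x y ↔ ∃ k, y = Function.update x i (x i + k) := by
  constructor
  · intro h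
    induction h with
    | refl => exact ⟨0, by simp⟩
    | tail _ hs ih =>
      obtain ⟨k, rfl⟩ := ih
      refine ⟨k + 1, ?_⟩
      rw [hs]
      simp [add_assoc]
  · rintro ⟨k, rfl⟩
    induction k with
    | zero => simpa using ReflTransGen.refl
    | succ k ih =>
      refine ih.tail ?_
      simp [CounterAct.Sem, add_assoc]

/-- A counter automaton for a search problem. -/
theorem exists_counterImpl_search (f : ℕ → ℕ → ℕ) (hf : Primrec₂ f) :
    ∃ R, CounterImpl R ∧ ∀ n y, R (Function.update (0 : ℕ → ℕ) 0 n) y ↔ y = 0 ∧ ∃ k, f n k = 0 := by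
  have hf' := Nat.Primrec'.prim_iff₂.2 hf
  obtain ⟨R, hR, h⟩ := counterComp_of_primrec' hf' (fun i => i) 2 3 (fun i => by omega) (by omega)
    (fun i => by omega)
  obtain ⟨R', hR', h'⟩ := (CounterComp.clear (fun _ => True) 0).seq
    (CounterComp.clear (fun _ => True) 1) fun _ _ => trivial
  refine ⟨_, (((CounterImpl.act (.inc 1)).star.seq hR).seq (CounterImpl.act (.zero 2))).seq hR',
    fun n y => ?_⟩
  have key : ∀ k z, R (Function.update (Function.update (0 : ℕ → ℕ) 0 n) 1 k) z ↔
      z = Function.update (Function.update (Function.update (0 : ℕ → ℕ) 0 n) 1 k) 2 (f n k) := by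
    intro k z
    rw [h]
    · have : (fun v : List.Vector ℕ 2 => f v.head v.tail.head) (List.Vector.ofFn fun i : Fin 2 =>
          (Function.update (Function.update (0 : ℕ → ℕ) 0 n) 1 k) i) = f n k := by
        change f ((Function.update (Function.update (0 : ℕ → ℕ) 0 n) 1 k) 0)
          ((Function.update (Function.update (0 : ℕ → ℕ) 0 n) 1 k) 1) = _
        simp
      simp only at this
      beta_reduce; rw [this]
    · refine ⟨by simp, fun j hj => ?_⟩
      rw [Function.update_of_ne (by omega), Function.update_of_ne (by omega)]
      rfl
  have h0 : Function.update (0 : ℕ → ℕ) 0 n 1 = 0 := by simp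
  constructor
  · rintro ⟨z, ⟨w, ⟨v, h1, h2⟩, h3⟩, h4⟩
    obtain ⟨k, rfl⟩ := (reflTransGen_inc _ _ _).1 h1
    rw [h0, zero_add, key] at h2
    subst h2
    obtain ⟨h5, rfl⟩ := h3
    have h6 : f n k = 0 := by simpa using h5
    refine ⟨?_, k, h6⟩
    rw [(h' _ trivial y).1 h4]
    funext j
    by_cases j1 : j = 1
    · subst j1; simp
    by_cases j0 : j = 0
    · subst j0; simp
    by_cases j2 : j = 2
    · subst j2; simp [h6]
    · simp [j0, j1, j2]
  · rintro ⟨rfl, k, hk⟩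
    refine ⟨_, ⟨_, ⟨Function.update (Function.update (0 : ℕ → ℕ) 0 n) 1 k,
      (reflTransGen_inc _ _ _).2 ⟨k, ?_⟩, (key k _).2 rfl⟩, ?_, rfl⟩, (h' _ trivial _).2 ?_⟩
    · rw [h0, zero_add]
    · simp [hk]
    · funext j
      by_cases j1 : j = 1
      · subst j1; simp
      by_cases j0 : j = 0
      · subst j0; simp
      by_cases j2 : j = 2
      · subst j2; simp [hk]
      · simp [j0, j1, j2]

/-- Gödel encoding of the first `M` counters. -/
noncomputable def counterCode (M : ℕ) (c : ℕ → ℕ) : ℕ :=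
  ∏ i ∈ Finset.range M, Nat.nth Nat.Prime i ^ c i

theorem counterCode_inc {M i : ℕ} (hi : i < M) (c : ℕ → ℕ) :
    counterCode M (Function.update c i (c i + 1)) = Nat.nth Nat.Prime i * counterCode M c := by
  unfold counterCode
  rw [← Finset.mul_prod_erase _ _ (Finset.mem_range.2 hi),
    ← Finset.mul_prod_erase _ (fun j => Nat.nth Nat.Prime j ^ c j) (Finset.mem_range.2 hi),
    Function.update_self, pow_succ]
  have : ∏ j ∈ (Finset.range M).erase i, Nat.nth Nat.Prime j ^ Function.update c i (c i + 1) j =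
      ∏ j ∈ (Finset.range M).erase i, Nat.nth Nat.Prime j ^ c j :=
    Finset.prod_congr rfl fun j hj => by rw [Function.update_of_ne (Finset.ne_of_mem_erase hj)]
  rw [this]
  ring

theorem dvd_counterCode_iff {M i : ℕ} (hi : i < M) (c : ℕ → ℕ) :
    Nat.nth Nat.Prime i ∣ counterCode M c ↔ 0 < c i := by
  constructor
  · intro h
    obtain ⟨j, _, hj⟩ := ((Nat.prime_nth_prime i).prime.dvd_finsetProd_iff _).1 h
    have h1 := (Nat.prime_nth_prime i).prime.dvd_of_dvd_pow hj
    have h2 := (Nat.prime_dvd_prime_iff_eq (Nat.prime_nth_prime i) (Nat.prime_nth_prime j)).1 h1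
    have h3 := Nat.nth_injective Nat.infinite_setOfPred_prime h2
    subst h3
    by_contra h0
    have : c i = 0 := by omega
    rw [this, pow_zero] at hj
    exact (Nat.prime_nth_prime i).one_lt.ne' (Nat.dvd_one.1 hj)
  · intro h
    exact (dvd_pow_self _ h.ne').trans
      (Finset.dvd_prod_of_mem (fun j => Nat.nth Nat.Prime j ^ c j) (Finset.mem_range.2 hi))

end CounterUndecidable

section AffineUndecidable

open Relation

/-- Affine rules simulating a counter transition on states `ℓ, ℓ' < L`. -/
def CounterAct.affineRules (L ℓ ℓ' : ℕ) : CounterAct → Set (ℕ × ℕ × ℕ × ℕ)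
  | skip => {(L, ℓ, L, ℓ')}
  | inc i => {(L, ℓ, L * Nat.nth Nat.Prime i, ℓ')}
  | dec i => {(L * Nat.nth Nat.Prime i, ℓ, L, ℓ')}
  | zero i => (fun ρ => (L * Nat.nth Nat.Prime i, L * ρ + ℓ, L * Nat.nth Nat.Prime i, L * ρ + ℓ')) ''
      Set.Ioo 0 (Nat.nth Nat.Prime i)

/-- The index of the counter touched by an action. -/
def CounterAct.idx : CounterAct → ℕ
  | skip => 0
  | inc i => i
  | dec i => i
  | zero i => i

theorem CounterAct.affineRules_finite (L ℓ ℓ' : ℕ) (a : CounterAct) :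
    (a.affineRules L ℓ ℓ').Finite := by
  cases a with
  | skip => exact Set.finite_singleton _
  | inc i => exact Set.finite_singleton _
  | dec i => exact Set.finite_singleton _
  | zero i => exact (Set.finite_Ioo _ _).image _

theorem CounterAct.affineRules_pos {L ℓ ℓ' : ℕ} (hL : 0 < L) (a : CounterAct)
    {t : ℕ × ℕ × ℕ × ℕ} (ht : t ∈ a.affineRules L ℓ ℓ') : 0 < t.1 ∧ 0 < t.2.2.1 := by
  have hp : ∀ i, 0 < L * Nat.nth Nat.Prime i := fun i =>
    Nat.mul_pos hL (Nat.prime_nth_prime i).pos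
  cases a with
  | skip => obtain rfl := ht; exact ⟨hL, hL⟩
  | inc i => obtain rfl := ht; exact ⟨hL, hp i⟩
  | dec i => obtain rfl := ht; exact ⟨hp i, hL⟩
  | zero i => obtain ⟨ρ, _, rfl⟩ := ht; exact ⟨hp i, hp i⟩

theorem mul_add_inj_of_lt {L a b r s : ℕ} (hr : r < L) (hs : s < L)
    (h : L * a + r = L * b + s) : a = b ∧ r = s := by
  have h1 := congrArg (· / L) h
  have h2 := congrArg (· % L) h
  simp only [Nat.mul_add_div (Nat.zero_lt_of_lt hr), Nat.div_eq_of_lt hr, Nat.div_eq_of_lt hs,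
    Nat.mul_add_mod, Nat.mod_eq_of_lt hr, Nat.mod_eq_of_lt hs] at h1 h2
  exact ⟨by simpa using h1, h2⟩

theorem CounterAct.step_of_affineRules {L ℓ ℓ' ℓ₀ M : ℕ} (hℓ : ℓ < L) (hℓ₀ : ℓ₀ < L)
    {a : CounterAct} (ha : a.idx < M) {x : ℕ → ℕ} (hx : ∀ j, M ≤ j → x j = 0)
    {t : ℕ × ℕ × ℕ × ℕ} (ht : t ∈ a.affineRules L ℓ ℓ') {j n' : ℕ}
    (h1 : L * counterCode M x + ℓ₀ = t.1 * j + t.2.1) (h2 : n' = t.2.2.1 * j + t.2.2.2) :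
    ℓ₀ = ℓ ∧ ∃ y, a.Sem x y ∧ (∀ j, M ≤ j → y j = 0) ∧ n' = L * counterCode M y + ℓ' := by
  cases a with
  | skip =>
    obtain rfl := ht
    obtain ⟨rfl, rfl⟩ := mul_add_inj_of_lt hℓ₀ hℓ h1
    exact ⟨rfl, x, rfl, hx, h2⟩
  | inc i =>
    obtain rfl := ht
    obtain ⟨rfl, rfl⟩ := mul_add_inj_of_lt hℓ₀ hℓ h1
    refine ⟨rfl, _, rfl, fun j hj => ?_, ?_⟩
    · rw [Function.update_of_ne (by simp only [CounterAct.idx] at ha; omega), hx j hj]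
    · rw [counterCode_inc (i := i) ha, h2]; ring
  | dec i =>
    obtain rfl := ht
    simp only [CounterAct.idx, mul_assoc] at h1 h2 ha
    obtain ⟨h3, rfl⟩ := mul_add_inj_of_lt hℓ₀ hℓ h1
    have hpos : 0 < x i := (dvd_counterCode_iff ha x).1 ⟨_, h3⟩
    refine ⟨rfl, _, ⟨hpos, rfl⟩, fun j hj => ?_, ?_⟩
    · rw [Function.update_of_ne (by omega), hx j hj]
    · have h4 := counterCode_inc (i := i) ha (Function.update x i (x i - 1))
      rw [Function.update_self, Function.update_idem, show x i - 1 + 1 = x i by omega,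
        Function.update_eq_self, h3] at h4
      rw [← Nat.eq_of_mul_eq_mul_left (Nat.prime_nth_prime i).pos h4]
      exact h2
  | zero i =>
    obtain ⟨ρ, hρ, rfl⟩ := ht
    simp only [CounterAct.idx, mul_assoc, ← add_assoc, ← mul_add] at h1 h2 ha
    obtain ⟨h3, rfl⟩ := mul_add_inj_of_lt hℓ₀ hℓ h1
    refine ⟨rfl, x, ⟨?_, rfl⟩, hx, by rw [h2, h3]⟩
    by_contra h0
    have h4 := (dvd_counterCode_iff ha x).2 (Nat.pos_of_ne_zero h0)
    rw [h3, Nat.dvd_add_right (dvd_mul_right _ _)] at h4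
    exact absurd (Nat.le_of_dvd hρ.1 h4) (by have := hρ.2; omega)

theorem CounterAct.affineRules_of_step {L ℓ ℓ' M : ℕ} {a : CounterAct} (ha : a.idx < M)
    {x y : ℕ → ℕ} (hs : a.Sem x y) : ∃ t ∈ a.affineRules L ℓ ℓ', ∃ j,
      L * counterCode M x + ℓ = t.1 * j + t.2.1 ∧
      L * counterCode M y + ℓ' = t.2.2.1 * j + t.2.2.2 := by
  cases a with
  | skip => obtain rfl := hs; exact ⟨_, rfl, _, rfl, rfl⟩
  | inc i =>
    obtain rfl := hs
    refine ⟨_, rfl, _, rfl, ?_⟩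
    rw [counterCode_inc (i := i) ha]; ring
  | dec i =>
    obtain ⟨hpos, rfl⟩ := hs
    refine ⟨_, rfl, counterCode M (Function.update x i (x i - 1)), ?_, rfl⟩
    have h4 := counterCode_inc (i := i) ha (Function.update x i (x i - 1))
    rw [Function.update_self, Function.update_idem, show x i - 1 + 1 = x i by omega,
      Function.update_eq_self] at h4
    rw [h4]; ring
  | zero i =>
    obtain ⟨h0, rfl⟩ := hs
    have h1 : ¬ Nat.nth Nat.Prime i ∣ counterCode M y := by
      rw [dvd_counterCode_iff (i := i) ha, h0]; omega
    have h2 := Nat.mod_add_div (counterCode M y) (Nat.nth Nat.Prime i)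
    refine ⟨_, ⟨counterCode M y % Nat.nth Nat.Prime i,
      ⟨Nat.pos_of_ne_zero fun h => h1 (Nat.dvd_of_mod_eq_zero h),
        Nat.mod_lt _ (Nat.prime_nth_prime i).pos⟩, rfl⟩,
      counterCode M y / Nat.nth Nat.Prime i, ?_, ?_⟩ <;>
    · nth_rewrite 1 [← h2]; ring

theorem primrec_pow_const (P : ℕ) : Primrec fun n => P ^ n := by
  have h : Primrec₂ ((· ^ ·) : ℕ → ℕ → ℕ) :=
    (Primrec₂.unpaired'.1 Nat.Primrec.pow)
  exact h.comp (Primrec.const P) Primrec.id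

/-- Reachability by affine rules is undecidable. -/
theorem exists_undecidable_affineReach : ∃ (m : ℕ) (p r q s : Fin m → ℕ) (nf : ℕ) (enc : ℕ → ℕ),
    (∀ k, 0 < p k) ∧ (∀ k, 0 < q k) ∧ Computable enc ∧
    ¬ ComputablePred fun x => AffineReach p r q s (enc x) nf := by
  obtain ⟨f, hf, hund⟩ := exists_primrec_halting
  obtain ⟨R, ⟨Q, _, s, t, Δ, hΔ, hR⟩, hs⟩ := exists_counterImpl_search f hf
  obtain ⟨L, ⟨e⟩⟩ := Finite.exists_equiv_fin Q
  have hL : 0 < L := (Nat.zero_le _).trans_lt (e s).2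
  obtain ⟨M, hM⟩ : ∃ M, ∀ d ∈ Δ, d.2.1.idx < M := by
    obtain ⟨M, hM⟩ := (hΔ.image fun d => d.2.1.idx).bddAbove
    exact ⟨M + 1, fun d hd => Nat.lt_succ_of_le (hM ⟨d, hd, rfl⟩)⟩
  let N := M + 1
  have hN : ∀ d ∈ Δ, d.2.1.idx < N := fun d hd => (hM d hd).trans (Nat.lt_succ_self _)
  let Rl : Set (ℕ × ℕ × ℕ × ℕ) := ⋃ d ∈ Δ, d.2.1.affineRules L (e d.1) (e d.2.2)
  have hRl : Rl.Finite := hΔ.biUnion fun d _ => CounterAct.affineRules_finite _ _ _ _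
  have := hRl.to_subtype
  obtain ⟨m, ⟨E⟩⟩ := Finite.exists_equiv_fin Rl
  let rule : Fin m → ℕ × ℕ × ℕ × ℕ := fun k => (E.symm k : ℕ × ℕ × ℕ × ℕ)
  have hpos : ∀ k, 0 < (rule k).1 ∧ 0 < (rule k).2.2.1 := by
    intro k
    obtain ⟨d, _, hd⟩ := Set.mem_iUnion₂.1 (E.symm k).2
    exact CounterAct.affineRules_pos hL _ hd
  let code : Q × (ℕ → ℕ) → ℕ := fun v => L * counterCode N v.2 + e v.1
  have hsound : ∀ u : Q × (ℕ → ℕ), (∀ j, N ≤ j → u.2 j = 0) → ∀ n,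
      AffineReach (fun k => (rule k).1) (fun k => (rule k).2.1) (fun k => (rule k).2.2.1)
        (fun k => (rule k).2.2.2) (code u) n →
      ∃ v, ReflTransGen (CounterStep Δ) u v ∧ (∀ j, N ≤ j → v.2 j = 0) ∧ n = code v := by
    intro u hu n hn
    induction hn with
    | refl => exact ⟨u, ReflTransGen.refl, hu, rfl⟩
    | tail _ hstep ih =>
      obtain ⟨v, h1, h2, rfl⟩ := ih
      obtain ⟨k, j, h3, h4⟩ := hstep
      obtain ⟨d, hd, hk⟩ := Set.mem_iUnion₂.1 (E.symm k).2
      obtain ⟨h5, y, h6, h7, h8⟩ := CounterAct.step_of_affineRules (e d.1).2 (e v.1).2 (hN d hd)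
        h2 hk h3 h4
      have h9 : v.1 = d.1 := e.injective (Fin.ext h5)
      exact ⟨(d.2.2, y), h1.tail ⟨d.2.1, by rw [h9]; exact hd, h6⟩, h7, h8⟩
  have hcomplete : ∀ u v : Q × (ℕ → ℕ), ReflTransGen (CounterStep Δ) u v →
      AffineReach (fun k => (rule k).1) (fun k => (rule k).2.1) (fun k => (rule k).2.2.1)
        (fun k => (rule k).2.2.2) (code u) (code v) := by
    intro u v h
    induction h with
    | refl => exact ReflTransGen.refl
    | @tail v w _ hstep ih =>
      obtain ⟨a, ha, hs⟩ := hstep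
      obtain ⟨t, ht, j, h1, h2⟩ := CounterAct.affineRules_of_step (L := L) (ℓ := e v.1)
        (ℓ' := e w.1) (hN _ ha) hs
      refine ReflTransGen.tail ih ⟨E ⟨t, Set.mem_iUnion₂.2 ⟨_, ha, ht⟩⟩, j, ?_, ?_⟩
      · simpa [rule] using h1
      · simpa [rule] using h2
  refine ⟨m, fun k => (rule k).1, fun k => (rule k).2.1, fun k => (rule k).2.2.1,
    fun k => (rule k).2.2.2, code (t, 0), fun n => L * Nat.nth Nat.Prime 0 ^ n + e s,
    fun k => (hpos k).1, fun k => (hpos k).2, ?_, ?_⟩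
  · exact (Primrec.nat_add.comp (Primrec.nat_mul.comp (Primrec.const _) (primrec_pow_const _))
      (Primrec.const _)).to_comp
  · intro hcomp
    apply hund
    refine hcomp.of_eq fun n => ?_
    have hcode : L * Nat.nth Nat.Prime 0 ^ n + e s = code (s, Function.update 0 0 n) := by
      simp only [code, counterCode]
      rw [Finset.prod_eq_single 0]
      · simp
      · intro b _ hb
        simp [Function.update_of_ne hb]
      · simp [N]
    have hsupp : ∀ j, N ≤ j → Function.update (0 : ℕ → ℕ) 0 n j = 0 := by
      intro j hj
      rw [Function.update_of_ne (by omega)]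
      rfl
    beta_reduce
    rw [hcode]
    constructor
    · intro h
      obtain ⟨⟨t', y⟩, h1, h2, h3⟩ := hsound _ hsupp _ h
      obtain ⟨h4, h5⟩ := mul_add_inj_of_lt (e t).2 (e t').2 h3
      obtain rfl : t = t' := e.injective (Fin.ext h5)
      exact ((hs n y).1 ((hR _ _).1 h1)).2
    · intro h
      exact hcomplete _ _ ((hR _ _).2 ((hs n 0).2 ⟨rfl, h⟩))

end AffineUndecidable

theorem isTransitiveForest_of_nested {S : Type} [Fintype S] (I : S → S → Prop)
    (hirr : ∀ a : S, ¬ I a a) (hsym : ∀ a b : S, I a b → I b a)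
    (hn : ∀ a b c d : S, I a b → I b c → I c d → a ≠ c → b ≠ d → I a c ∨ I b d) :
    IsTransitiveForest I := by
  classical
  let N : S → Set S := fun a => {x | x = a ∨ I a x}
  let e := Fintype.equivFin S
  have nested : ∀ a b, I a b → N a ⊆ N b ∨ N b ⊆ N a := by
    intro a b hab
    by_contra! h
    obtain ⟨h1, h2⟩ := h
    obtain ⟨x, hx, hx'⟩ := Set.not_subset.1 h1
    obtain ⟨y, hy, hy'⟩ := Set.not_subset.1 h2
    simp only [N, Set.mem_ofPred_eq, not_or] at hx hx' hy hy'
    have hxa : I a x := by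
      rcases hx with rfl | hx
      · exact absurd (hsym _ _ hab) hx'.2
      · exact hx
    have hyb : I b y := by
      rcases hy with rfl | hy
      · exact absurd hab hy'.2
      · exact hy
    rcases hn x a b y (hsym _ _ hxa) hab hyb hx'.1 (Ne.symm hy'.1) with h | h
    · exact hx'.2 (hsym _ _ h)
    · exact hy'.2 h
  -- `r b a`: `a` and `b` are adjacent and `b` dominates `a`
  refine ⟨fun b a => I a b ∧ (N a ⊂ N b ∨ (N a = N b ∧ e b < e a)), ?_, ?_, ?_⟩
  · refine @IsStrictOrder.mk _ _ ⟨?_⟩ ⟨?_⟩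
    · intro a h; exact hirr a h.1
    · rintro a b c ⟨hab, h1⟩ ⟨hbc, h2⟩
      have hac : I c a ∨ a = c := by
        have hs : N b ⊆ N a := by
          rcases h1 with h | h
          · exact h.1
          · exact h.1.subset
        have : c ∈ N a := hs (Or.inr (hsym _ _ hbc))
        rcases this with h | h
        · exact Or.inr h.symm
        · exact Or.inl (hsym _ _ h)
      have h3 : N c ⊂ N a ∨ (N c = N a ∧ e a < e c) := by
        rcases h1 with h1 | ⟨h1, h1'⟩ <;> rcases h2 with h2 | ⟨h2, h2'⟩
        · exact Or.inl (h2.trans h1)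
        · exact Or.inl (h2 ▸ h1)
        · exact Or.inl (h1 ▸ h2)
        · exact Or.inr ⟨h2.trans h1, h1'.trans h2'⟩
      rcases hac with h | rfl
      · exact ⟨h, h3⟩
      · exfalso
        rcases h3 with h | h
        · exact h.ne rfl
        · exact lt_irrefl _ h.2
  · rintro a b c ⟨hab, h1⟩ ⟨hac, h2⟩
    by_cases hbc : b = c
    · exact Or.inr (Or.inl hbc)
    have hI : I b c := by
      have hs : N a ⊆ N b := by
        rcases h1 with h | h
        · exact h.1
        · exact h.1.subset
      have : c ∈ N b := hs (Or.inr hac)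
      rcases this with h | h
      · exact absurd h.symm hbc
      · exact h
    by_cases hN : N b = N c
    · rcases lt_or_gt_of_ne (fun h => hbc (e.injective h)) with h | h
      · exact Or.inl ⟨hsym _ _ hI, Or.inr ⟨hN.symm, h⟩⟩
      · exact Or.inr (Or.inr ⟨hI, Or.inr ⟨hN, h⟩⟩)
    · rcases nested b c hI with h | h
      · exact Or.inr (Or.inr ⟨hI, Or.inl (h.ssubset_of_ne hN)⟩)
      · exact Or.inl ⟨hsym _ _ hI, Or.inl (h.ssubset_of_ne (Ne.symm hN))⟩
  · intro a b
    constructor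
    · intro hI
      have hab : a ≠ b := by rintro rfl; exact hirr _ hI
      refine ⟨hab, ?_⟩
      by_cases hN : N a = N b
      · rcases lt_or_gt_of_ne (fun h => hab (e.injective h)) with h | h
        · exact Or.inl ⟨hsym _ _ hI, Or.inr ⟨hN.symm, h⟩⟩
        · exact Or.inr ⟨hI, Or.inr ⟨hN, h⟩⟩
      · rcases nested a b hI with h | h
        · exact Or.inr ⟨hI, Or.inl (h.ssubset_of_ne hN)⟩
        · exact Or.inl ⟨hsym _ _ hI, Or.inl (h.ssubset_of_ne (Ne.symm hN))⟩
    · rintro ⟨_, h | h⟩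
      · exact hsym _ _ h.1
      · exact h.1

section GraphGroupUndecidable

variable {S : Type}

theorem graphEval_surjective (I : S → S → Prop) : Function.Surjective (graphEval I) := by
  intro g
  obtain ⟨g, rfl⟩ := PresentedGroup.mk_surjective (GraphGroupRels I) g
  induction g using FreeGroup.induction_on with
  | C1 => exact ⟨1, by simp⟩
  | of x => exact ⟨FreeMonoid.of (Sum.inl x), by simp [graphEval]; rfl⟩
  | inv_of x _ => exact ⟨FreeMonoid.of (Sum.inr x), by simp [graphEval]; rfl⟩
  | mul x y hx hy =>
    obtain ⟨u, hu⟩ := hx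
    obtain ⟨v, hv⟩ := hy
    exact ⟨u * v, by simp [hu, hv]⟩

/-- The homomorphism to a group generated by two elements which kills all other generators. -/
theorem exists_graphGroup_hom {H : Type} [Group H] (I : S → S → Prop)
    (hsym : ∀ a b : S, I a b → I b a) {a c : S} (hne : a ≠ c) (hac : ¬ I a c) (u v : H) :
    ∃ f : GraphGroup I →* H, f (PresentedGroup.of a) = u ∧ f (PresentedGroup.of c) = v ∧
      ∀ x, x ≠ a → x ≠ c → f (PresentedGroup.of x) = 1 := by
  classical
  let φ : S → H := fun x => if x = a then u else if x = c then v else 1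
  have h : ∀ r ∈ GraphGroupRels I, FreeGroup.lift φ r = 1 := by
    rintro r ⟨x, y, hxy, rfl⟩
    simp only [map_mul, map_inv, FreeGroup.lift_apply_of, φ]
    by_cases h1 : x = a
    · subst h1
      by_cases h2 : y = x
      · simp [h2]
      · by_cases h3 : y = c
        · exact absurd (h3 ▸ hxy) hac
        · simp [h2, h3]
    · by_cases h2 : x = c
      · subst h2
        by_cases h3 : y = a
        · exact absurd (hsym _ _ (h3 ▸ hxy)) hac
        · by_cases h4 : y = x
          · subst h4; simp [h1]
          · simp [h3, h4]
      · simp [h1, h2]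
  refine ⟨PresentedGroup.toGroup h, ?_, ?_, ?_⟩
  · simp [φ]
  · simp [φ, hne.symm]
  · intro x h1 h2
    simp [φ, h1, h2]

theorem commute_of_rel {I : S → S → Prop} {a b : S} (h : I a b) :
    Commute (PresentedGroup.of (rels := GraphGroupRels I) a) (PresentedGroup.of b) := by
  have h1 : PresentedGroup.mk (GraphGroupRels I) (FreeGroup.of a * FreeGroup.of b *
      (FreeGroup.of a)⁻¹ * (FreeGroup.of b)⁻¹) = 1 :=
    PresentedGroup.one_of_mem ⟨a, b, h, rfl⟩
  simp only [map_mul, map_inv] at h1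
  rw [mul_inv_eq_one, mul_inv_eq_iff_eq_mul] at h1
  exact h1

theorem isTransitiveForest_of_computable [Fintype S] [DecidableEq S] (I : S → S → Prop)
    (hirr : ∀ a : S, ¬ I a a) (hsym : ∀ a b : S, I a b → I b a)
    (hcomp : ∀ W : Set (List (S ⊕ S)), W.Finite →
      ComputablePred (fun w : List (S ⊕ S) =>
        graphEval I (FreeMonoid.ofList w) ∈
          Submonoid.closure
            ((fun v : List (S ⊕ S) => graphEval I (FreeMonoid.ofList v)) '' W))) :
    IsTransitiveForest I := by
  by_contra hnot
  apply hnot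
  refine isTransitiveForest_of_nested I hirr hsym fun a b c d hab hbc hcd hac hbd => ?_
  by_contra hcon
  rw [not_or] at hcon
  obtain ⟨nac, nbd⟩ := hcon
  obtain ⟨m, p, r, q, s, nf, enc, hp, hq, henc, hund⟩ := exists_undecidable_affineReach
  apply hund
  have neab : a ≠ b := fun h => hirr b (h ▸ hab)
  have nebc : b ≠ c := fun h => hirr c (h ▸ hbc)
  have necd : c ≠ d := fun h => hirr d (h ▸ hcd)
  have nead : a ≠ d := fun h => nac (hsym _ _ (h ▸ hcd))
  obtain ⟨f, hfa, hfc, hf⟩ := exists_graphGroup_hom I hsym hac nac shT (shX 0)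
  obtain ⟨g, hgb, hgd, hg⟩ := exists_graphGroup_hom I hsym hbd nbd (shX 0) shT
  let A : GraphGroup I := PresentedGroup.of a
  let B : GraphGroup I := PresentedGroup.of b
  let C : GraphGroup I := PresentedGroup.of c
  let D : GraphGroup I := PresentedGroup.of d
  have hiff : ∀ n, simTarget m n A C D ∈
      Submonoid.closure (Set.range (simTok p r q s nf A B C D)) ↔ AffineReach p r q s n nf :=
    fun n => ⟨affineReach_of_simTarget_mem p r q s hp hq n nf f g hfa (hf b neab.symm nebc) hfc
      (hf d nead.symm necd.symm) (hg a neab nead) hgb (hg c nebc.symm necd) hgd,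
      simTarget_mem_of_affineReach p r q s (commute_of_rel hab) (commute_of_rel hbc)
        (commute_of_rel hcd)⟩
  choose word hword using graphEval_surjective I
  let W : Set (List (S ⊕ S)) := Set.range fun x => (word (simTok p r q s nf A B C D x)).toList
  have hW := hcomp W (Set.finite_range _)
  have himg : (fun v : List (S ⊕ S) => graphEval I (FreeMonoid.ofList v)) '' W =
      Set.range (simTok p r q s nf A B C D) := by
    rw [← Set.range_comp]
    congr 1
    funext x
    simp [hword]
  rw [himg] at hW
  let target : ℕ → List (S ⊕ S) := fun n =>
    (word (D ^ m)⁻¹).toList ++ (List.replicate (enc n) (Sum.inl c) ++ (word (A ^ 2)⁻¹).toList)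
  have htarget : ∀ n, graphEval I (FreeMonoid.ofList (target n)) =
      simTarget m (enc n) A C D := by
    intro n
    have h1 : ∀ k, graphEval I (FreeMonoid.ofList (List.replicate k (Sum.inl c))) = C ^ k := by
      intro k
      induction k with
      | zero => simp
      | succ k ih =>
        rw [List.replicate_succ, FreeMonoid.ofList_cons, map_mul, ih, pow_succ']
        rfl
    simp only [target, FreeMonoid.ofList_append, map_mul, h1, FreeMonoid.ofList_toList, hword]
    rw [simTarget, mul_assoc]
  have hcT : Computable target := by
    have h1 : Computable fun n => List.replicate (enc n) (Sum.inl c : S ⊕ S) := by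
      have h2 : Primrec fun n : ℕ => List.replicate n (Sum.inl c : S ⊕ S) := by
        refine (Primrec.list_map Primrec.list_range (Primrec.const (Sum.inl c : S ⊕ S)).to₂).of_eq
          fun n => ?_
        simp
      exact h2.to_comp.comp henc
    exact Computable.list_append.comp (Computable.const _)
      (Computable.list_append.comp h1 (Computable.const _))
  obtain ⟨χ, hχ, hχP⟩ := ComputablePred.computable_iff.1 hW
  refine ComputablePred.computable_iff.2 ⟨fun n => χ (target n), hχ.comp hcT, ?_⟩
  funext n
  rw [← hiff (enc n), ← htarget n]
  exact congrFun hχP (target n)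

end GraphGroupUndecidable

section Substitution

open Pointwise

variable {α M N : Type} [DecidableEq α] [AddCommMonoid M] [AddCommMonoid N]

/-- The relation between a Parikh vector and the Parikh images obtained from it by replacing every
occurrence of a letter `a` by some element of `A a`. -/
def Subst (A : α → Set M) : AddSubmonoid ((α → ℕ) × M) :=
  AddSubmonoid.closure {p | ∃ a, ∃ z ∈ A a, p = (Pi.single a 1, z)}

theorem subst_single {A : α → Set M} {a : α} {z : M} (h : z ∈ A a) :
    ((Pi.single a 1 : α → ℕ), z) ∈ Subst A :=
  AddSubmonoid.subset_closure ⟨a, z, h, rfl⟩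

theorem subst_add {A : α → Set M} {x y : α → ℕ} {z w : M} (h : (x, z) ∈ Subst A)
    (h' : (y, w) ∈ Subst A) : (x + y, z + w) ∈ Subst A :=
  add_mem h h'

theorem subst_zero (A : α → Set M) : ((0 : α → ℕ), (0 : M)) ∈ Subst A :=
  zero_mem (Subst A)

theorem subst_induction {A : α → Set M} {P : (α → ℕ) → M → Prop}
    (hs : ∀ a, ∀ z ∈ A a, P (Pi.single a 1) z) (h0 : P 0 0)
    (hadd : ∀ x y z w, P x z → P y w → P (x + y) (z + w)) {x : α → ℕ} {z : M}
    (h : (x, z) ∈ Subst A) : P x z := by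
  have : ∀ p ∈ Subst A, P p.1 p.2 := by
    intro p hp
    induction hp using AddSubmonoid.closure_induction with
    | mem p hp => obtain ⟨a, z, hz, rfl⟩ := hp; exact hs a z hz
    | zero => exact h0
    | add p q _ _ hp hq => exact hadd _ _ _ _ hp hq
  exact this _ h

omit [DecidableEq α] in
theorem exists_refinement {x y u v : α → ℕ} (h : x + y = u + v) :
    ∃ a b c d : α → ℕ, x = a + b ∧ y = c + d ∧ u = a + c ∧ v = b + d := by
  refine ⟨fun i => min (x i) (u i), fun i => x i - min (x i) (u i),
    fun i => u i - min (x i) (u i), fun i => y i - (u i - min (x i) (u i)), ?_, ?_, ?_, ?_⟩ <;>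
  · funext i
    have := congrFun h i
    simp only [Pi.add_apply] at this ⊢
    omega

theorem single_eq_add {a : α} {u v : α → ℕ} (h : Pi.single a 1 = u + v) :
    (u = 0 ∧ v = Pi.single a 1) ∨ (u = Pi.single a 1 ∧ v = 0) := by
  have h1 := congrFun h a
  simp only [Pi.single_eq_same, Pi.add_apply] at h1
  have h2 : ∀ i, i ≠ a → u i = 0 ∧ v i = 0 := by
    intro i hi
    have := congrFun h i
    simp only [Pi.single_eq_of_ne hi, Pi.add_apply] at this
    omega
  have h3 : (u a = 0 ∧ v a = 1) ∨ (u a = 1 ∧ v a = 0) := by omega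
  rcases h3 with ⟨h3, h4⟩ | ⟨h3, h4⟩
  · left
    constructor <;> funext i <;> by_cases hi : i = a
    · rw [hi, h3]; rfl
    · rw [(h2 i hi).1]; rfl
    · rw [hi, h4, Pi.single_eq_same]
    · rw [(h2 i hi).2, Pi.single_eq_of_ne hi]
  · right
    constructor <;> funext i <;> by_cases hi : i = a
    · rw [hi, h3, Pi.single_eq_same]
    · rw [(h2 i hi).1, Pi.single_eq_of_ne hi]
    · rw [hi, h4]; rfl
    · rw [(h2 i hi).2]; rfl

theorem subst_split {A : α → Set M} {x y : α → ℕ} {z : M} (h : (x + y, z) ∈ Subst A) :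
    ∃ z₁ z₂, z = z₁ + z₂ ∧ (x, z₁) ∈ Subst A ∧ (y, z₂) ∈ Subst A := by
  have : ∀ t z, (t, z) ∈ Subst A → ∀ x y : α → ℕ, t = x + y →
      ∃ z₁ z₂, z = z₁ + z₂ ∧ (x, z₁) ∈ Subst A ∧ (y, z₂) ∈ Subst A := by
    intro t z ht
    refine subst_induction (P := fun t z => ∀ x y : α → ℕ, t = x + y →
      ∃ z₁ z₂, z = z₁ + z₂ ∧ (x, z₁) ∈ Subst A ∧ (y, z₂) ∈ Subst A) ?_ ?_ ?_ ht
    · intro a z hz x y hxy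
      rcases single_eq_add hxy with ⟨rfl, rfl⟩ | ⟨rfl, rfl⟩
      · exact ⟨0, z, by simp, subst_zero A, subst_single hz⟩
      · exact ⟨z, 0, by simp, subst_single hz, subst_zero A⟩
    · intro x y hxy
      have hx : x = 0 := by
        funext i
        have := congrFun hxy i
        simp only [Pi.zero_apply, Pi.add_apply] at this ⊢
        omega
      have hy : y = 0 := by rw [hx, zero_add] at hxy; exact hxy.symm
      subst hx hy
      exact ⟨0, 0, by simp, subst_zero A, subst_zero A⟩
    · intro t t' z z' h h' x y hxy
      obtain ⟨a, b, c, d, rfl, rfl, rfl, rfl⟩ := exists_refinement hxy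
      obtain ⟨z₁, z₂, rfl, h1, h2⟩ := h a b rfl
      obtain ⟨z₃, z₄, rfl, h3, h4⟩ := h' c d rfl
      exact ⟨z₁ + z₃, z₂ + z₄, add_add_add_comm _ _ _ _, subst_add h1 h3, subst_add h2 h4⟩
  exact this _ _ h x y rfl

omit [DecidableEq α] in
theorem eq_zero_of_add_eq_zero_vec {u v : α → ℕ} (h : u + v = 0) : u = 0 ∧ v = 0 := by
  constructor <;> funext i <;> have := congrFun h i <;>
    simp only [Pi.zero_apply, Pi.add_apply] at this ⊢ <;> omega

theorem subst_zero_iff {A : α → Set M} {z : M} : ((0 : α → ℕ), z) ∈ Subst A ↔ z = 0 := by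
  refine ⟨fun h => ?_, fun h => h ▸ subst_zero A⟩
  refine subst_induction (P := fun x z => x = 0 → z = 0) ?_ ?_ ?_ h rfl
  · intro a z _ h
    have := congrFun h a
    simp at this
  · simp
  · intro x y z w h h' hxy
    obtain ⟨hx, hy⟩ := eq_zero_of_add_eq_zero_vec hxy
    simp [h hx, h' hy]

theorem subst_single_iff {A : α → Set M} {a : α} {z : M} :
    ((Pi.single a 1 : α → ℕ), z) ∈ Subst A ↔ z ∈ A a := by
  refine ⟨fun h => ?_, subst_single⟩
  refine subst_induction (P := fun x z => (x = 0 → z = 0) ∧ (∀ a, x = Pi.single a 1 → z ∈ A a))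
    ?_ ?_ ?_ h |>.2 a rfl
  · intro b z hz
    refine ⟨fun h => ?_, fun c h => ?_⟩
    · have := congrFun h b
      simp at this
    · have : c = b := by
        by_contra hne
        have := congrFun h c
        simp [Pi.single_eq_of_ne hne] at this
      rwa [this]
  · refine ⟨fun _ => rfl, fun a h => ?_⟩
    have := congrFun h a
    simp at this
  · intro x y z w h h'
    refine ⟨fun hxy => ?_, fun a hxy => ?_⟩
    · obtain ⟨hx, hy⟩ := eq_zero_of_add_eq_zero_vec hxy
      simp [h.1 hx, h'.1 hy]
    · rcases single_eq_add hxy.symm with ⟨hx, hy⟩ | ⟨hx, hy⟩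
      · rw [h.1 hx, zero_add]; exact h'.2 a hy
      · rw [h'.1 hy, add_zero]; exact h.2 a hx

theorem subst_mono_of_support {A B : α → Set M} {x : α → ℕ} {z : M} (h : (x, z) ∈ Subst A)
    (hAB : ∀ a, x a ≠ 0 → A a ⊆ B a) : (x, z) ∈ Subst B := by
  refine subst_induction (P := fun x z => (∀ a, x a ≠ 0 → A a ⊆ B a) → (x, z) ∈ Subst B)
    ?_ ?_ ?_ h hAB
  · intro a z hz hAB
    exact subst_single (hAB a (by simp) hz)
  · intro _; exact subst_zero B
  · intro x y z w h h' hAB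
    refine subst_add (h fun a ha => hAB a ?_) (h' fun a ha => hAB a ?_) <;>
      simp only [Pi.add_apply] <;> omega

theorem subst_mono {A B : α → Set M} {x : α → ℕ} {z : M} (h : (x, z) ∈ Subst A)
    (hAB : ∀ a, A a ⊆ B a) : (x, z) ∈ Subst B :=
  subst_mono_of_support h fun a _ => hAB a

theorem subst_trans {β : Type} [DecidableEq β] {B : α → Set (β → ℕ)} {D : β → Set M}
    {E : α → Set M}
    (h : ∀ a, ∀ u ∈ B a, ∀ z, (u, z) ∈ Subst D → z ∈ E a) {y : α → ℕ} {u : β → ℕ} {z : M}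
    (hy : (y, u) ∈ Subst B) (hu : (u, z) ∈ Subst D) : (y, z) ∈ Subst E := by
  refine subst_induction (P := fun y u => ∀ z, (u, z) ∈ Subst D → (y, z) ∈ Subst E)
    ?_ ?_ ?_ hy z hu
  · intro a u hu z hz
    exact subst_single (h a u hu z hz)
  · intro z hz
    rw [subst_zero_iff.1 hz]
    exact subst_zero E
  · intro x y u v h h' z hz
    obtain ⟨z₁, z₂, rfl, h1, h2⟩ := subst_split hz
    exact subst_add (h _ h1) (h' _ h2)

theorem subst_factor {β : Type} [DecidableEq β] {B : α → Set (β → ℕ)} {D : β → Set M}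
    {E : α → Set M}
    (h : ∀ a, ∀ z ∈ E a, ∃ u ∈ B a, (u, z) ∈ Subst D) {y : α → ℕ} {z : M}
    (hy : (y, z) ∈ Subst E) : ∃ u, (y, u) ∈ Subst B ∧ (u, z) ∈ Subst D := by
  refine subst_induction (P := fun y z => ∃ u, (y, u) ∈ Subst B ∧ (u, z) ∈ Subst D) ?_ ?_ ?_ hy
  · intro a z hz
    obtain ⟨u, hu, huz⟩ := h a z hz
    exact ⟨u, subst_single hu, huz⟩
  · exact ⟨0, subst_zero B, subst_zero D⟩
  · rintro x y z w ⟨u, h1, h2⟩ ⟨v, h3, h4⟩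
    exact ⟨u + v, subst_add h1 h3, subst_add h2 h4⟩

theorem subst_eq_self {A : α → Set (α → ℕ)} {x z : α → ℕ} (h : (x, z) ∈ Subst A)
    (hA : ∀ a, x a ≠ 0 → A a ⊆ {Pi.single a 1}) : z = x := by
  refine subst_induction (P := fun x z => (∀ a, x a ≠ 0 → A a ⊆ {Pi.single a 1}) → z = x)
    ?_ ?_ ?_ h hA
  · intro a z hz hA
    exact hA a (by simp) hz
  · intro _; rfl
  · intro x y z w h h' hAB
    rw [h fun a ha => hAB a ?_, h' fun a ha => hAB a ?_] <;>
      simp only [Pi.add_apply] <;> omega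

/-- A vector with a positive entry contains the corresponding unit vector. -/
theorem exists_eq_add_single {x : α → ℕ} {a : α} (h : x a ≠ 0) : ∃ y : α → ℕ, x = y + Pi.single a 1 := by
  refine ⟨fun i => x i - (Pi.single a 1 : α → ℕ) i, ?_⟩
  funext i
  by_cases hi : i = a
  · subst hi
    simp only [Pi.add_apply, Pi.single_eq_same]
    omega
  · simp [hi]

theorem subst_exists [Finite α] {A : α → Set M} (x : α → ℕ)
    (hA : ∀ a, x a ≠ 0 → (A a).Nonempty) : ∃ z, (x, z) ∈ Subst A := by
  have := Fintype.ofFinite α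
  induction hn : ∑ i, x i generalizing x with
  | zero =>
    have : x = 0 := by
      funext i
      exact (Finset.sum_eq_zero_iff.1 hn) i (Finset.mem_univ i)
    exact ⟨0, this ▸ subst_zero A⟩
  | succ n ih =>
    obtain ⟨a, -, ha⟩ : ∃ a ∈ Finset.univ, x a ≠ 0 := by
      by_contra! hne
      rw [Finset.sum_eq_zero hne] at hn
      omega
    obtain ⟨y, rfl⟩ := exists_eq_add_single ha
    obtain ⟨z, hz⟩ := ih y (fun b hb => hA b (by simp only [Pi.add_apply]; omega)) (by
      simp only [Pi.add_apply, Finset.sum_add_distrib, Finset.sum_pi_single',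
        Finset.mem_univ, if_true] at hn
      omega)
    obtain ⟨w, hw⟩ := hA a ha
    exact ⟨z + w, subst_add hz (subst_single hw)⟩

theorem subst_self [Finite α] {A : α → Set (α → ℕ)} (x : α → ℕ)
    (hA : ∀ a, x a ≠ 0 → Pi.single a 1 ∈ A a) : (x, x) ∈ Subst A := by
  obtain ⟨z, hz⟩ := subst_exists (A := fun a : α => ({Pi.single a 1} : Set (α → ℕ))) x
    fun a _ => Set.singleton_nonempty _
  have hzx : z = x := subst_eq_self hz fun a _ => le_rfl
  subst hzx
  exact subst_mono_of_support hz fun a ha => Set.singleton_subset_iff.2 (hA a ha)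

theorem subst_isSemilinearSet [Finite α] {A : α → Set M} (hA : ∀ a, IsSemilinearSet (A a)) :
    IsSemilinearSet (Subst A : Set ((α → ℕ) × M)) := by
  refine IsSemilinearSet.closure ?_
  have : {p : (α → ℕ) × M | ∃ a, ∃ z ∈ A a, p = (Pi.single a 1, z)} =
      ⋃ a, ((Pi.single a 1 : α → ℕ), (0 : M)) +ᵥ (AddMonoidHom.inr (α → ℕ) M '' A a) := by
    ext p
    simp only [Set.mem_ofPred_eq, Set.mem_iUnion]
    refine exists_congr fun a => ?_
    rw [← Set.image_vadd, Set.image_image]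
    constructor
    · rintro ⟨z, hz, rfl⟩
      exact ⟨z, hz, by simp⟩
    · rintro ⟨z, hz, rfl⟩
      exact ⟨z, hz, by simp⟩
  rw [this]
  exact IsSemilinearSet.iUnion fun a => ((hA a).image _).vadd _

/-- The set of all results of substituting into the elements of a set of vectors. -/
def substImage (A : α → Set M) (s : Set (α → ℕ)) : Set M :=
  {z | ∃ x ∈ s, (x, z) ∈ Subst A}

theorem substImage_isSemilinearSet [Finite α] [AddMonoid.FG M] {A : α → Set M}
    (hA : ∀ a, IsSemilinearSet (A a)) {s : Set (α → ℕ)} (hs : IsSemilinearSet s) :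
    IsSemilinearSet (substImage A s) := by
  have h1 := (subst_isSemilinearSet hA).inter
    (hs.preimage (AddMonoidHom.fst (α → ℕ) M))
  have h2 := h1.image (AddMonoidHom.snd (α → ℕ) M)
  convert h2 using 1
  ext z
  constructor
  · rintro ⟨x, hx, hxz⟩
    exact ⟨(x, z), ⟨hxz, hx⟩, rfl⟩
  · rintro ⟨⟨x, z⟩, ⟨hxz, hx⟩, rfl⟩
    exact ⟨x, hx, hxz⟩

end Substitution

section CommutativeGrammar

open Pointwise

variable {α : Type} [DecidableEq α]

/-- The commutative images of the sentential forms without symbols of `V` derivable from `a` in the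
grammar with nonterminals `V` and productions `a → y` for `y ∈ X a`. -/
def Derivable (X : α → Set (α → ℕ)) (V : Set α) (a : α) : Set (α → ℕ) :=
  {z | ∀ B : α → Set (α → ℕ), (∀ b ∉ V, Pi.single b 1 ∈ B b) →
    (∀ b ∈ V, ∀ y ∈ X b, ∀ w, (y, w) ∈ Subst B → w ∈ B b) → z ∈ B a}

variable {X : α → Set (α → ℕ)} {V : Set α}

theorem derivable_terminal {a : α} (ha : a ∉ V) : Pi.single a 1 ∈ Derivable X V a :=
  fun _ h _ => h a ha

theorem derivable_rule {a : α} (ha : a ∈ V) {y z : α → ℕ} (hy : y ∈ X a)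
    (h : (y, z) ∈ Subst (Derivable X V)) : z ∈ Derivable X V a :=
  fun B h1 h2 => h2 a ha y hy z (subst_mono h fun _ _ hz => hz B h1 h2)

theorem derivable_subset {B : α → Set (α → ℕ)} (h1 : ∀ b ∉ V, Pi.single b 1 ∈ B b)
    (h2 : ∀ b ∈ V, ∀ y ∈ X b, ∀ w, (y, w) ∈ Subst B → w ∈ B b) (a : α) :
    Derivable X V a ⊆ B a :=
  fun _ hz => hz B h1 h2

theorem derivable_eq_single {a : α} (ha : a ∉ V) : Derivable X V a = {Pi.single a 1} := by
  refine Set.Subset.antisymm ?_ (Set.singleton_subset_iff.2 (derivable_terminal ha))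
  have := derivable_subset (X := X) (V := V)
    (B := fun b => {z | b ∉ V → z = Pi.single b 1}) (by simp)
    (fun b hb y _ w _ h => absurd hb h) a
  exact fun z hz => this hz ha

theorem subst_apply_eq_zero {A : α → Set (α → ℕ)} {v : α} (hA : ∀ a, ∀ z ∈ A a, z v = 0)
    {x z : α → ℕ} (h : (x, z) ∈ Subst A) : z v = 0 := by
  refine subst_induction (A := A) (P := fun _ w => w v = 0) hA rfl ?_ h
  intro x y z w h h'
  simp only [Pi.add_apply]
  omega

theorem derivable_apply_eq_zero {v : α} (hv : v ∈ V) (a : α) {z : α → ℕ}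
    (hz : z ∈ Derivable X V a) : z v = 0 := by
  refine derivable_subset (X := X) (V := V) (B := fun _ => {z | z v = 0}) ?_ ?_ a hz
  · intro b hb
    have : v ≠ b := fun h => hb (h ▸ hv)
    simp [Pi.single_eq_of_ne this]
  · intro b _ y _ w hw
    exact subst_apply_eq_zero (A := fun _ => {z | z v = 0}) (fun a z hz => hz) hw

theorem subst_derivable_apply_eq_zero {v : α} (hv : v ∈ V) {x z : α → ℕ}
    (hz : (x, z) ∈ Subst (Derivable X V)) : z v = 0 :=
  subst_apply_eq_zero (fun a _ hz => derivable_apply_eq_zero hv a hz) hz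

theorem derivable_insert {v : α} (hv : v ∉ V) (a : α) :
    Derivable X (insert v V) a = substImage
      (Derivable (fun b => substImage (Derivable X {v}) (X b)) V) (Derivable X {v} a) := by
  set X' := fun b => substImage (Derivable X {v}) (X b) with hX'
  have hA : ∀ a, ∀ y ∈ Derivable X {v} a, ∀ z, (y, z) ∈ Subst (Derivable X (insert v V)) →
      z ∈ Derivable X (insert v V) a := by
    intro a
    refine derivable_subset (B := fun a => {y | ∀ z, (y, z) ∈ Subst (Derivable X (insert v V)) →
      z ∈ Derivable X (insert v V) a}) ?_ ?_ a
    · intro b _ z hz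
      exact subst_single_iff.1 hz
    · intro b hb y hy w hw z hz
      rw [Set.mem_singleton_iff] at hb
      exact derivable_rule (by simp [hb]) hy (subst_trans (fun a u hu => hu) hw hz)
  have hB : ∀ a, a ≠ v → Derivable X' V a ⊆ Derivable X (insert v V) a := by
    intro a ha z hz
    refine derivable_subset (X := X') (B := fun a => {z | a ≠ v →
      z ∈ Derivable X (insert v V) a}) ?_ ?_ a hz ha
    · intro b hb hbv
      exact derivable_terminal (by simp [hb, hbv])
    · rintro b hb y ⟨y₀, hy₀, hy⟩ w hw hbv
      refine derivable_rule (by simp [hb]) hy₀ (subst_trans hA hy ?_)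
      refine subst_mono_of_support hw fun c hc z hz => hz ?_
      rintro rfl
      exact hc (subst_derivable_apply_eq_zero (Set.mem_singleton _) hy)
  refine Set.Subset.antisymm ?_ ?_
  · refine derivable_subset (B := fun a => substImage (Derivable X' V) (Derivable X {v} a)) ?_ ?_ a
    · intro b hb
      simp only [Set.mem_insert_iff, not_or] at hb
      exact ⟨_, derivable_terminal hb.1, subst_single (derivable_terminal hb.2)⟩
    · intro b hb y hy z hz
      obtain ⟨u, hu, huz⟩ := subst_factor (B := Derivable X {v}) (D := Derivable X' V)
        (fun a z hz => hz) hz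
      by_cases hbv : b = v
      · subst hbv
        exact ⟨u, derivable_rule (Set.mem_singleton b) hy hu, huz⟩
      · refine ⟨_, derivable_terminal hbv, subst_single (derivable_rule ?_ ⟨y, hy, hu⟩ huz)⟩
        simpa [hbv] using hb
  · rintro z ⟨y, hy, hyz⟩
    refine hA a y hy z (subst_mono_of_support hyz fun c hc => hB c ?_)
    rintro rfl
    exact hc (derivable_apply_eq_zero (Set.mem_singleton _) a hy)

theorem derivable_singleton [Finite α] (v : α) :
    Derivable X {v} v = {x ∈ X v | x v = 0} +
      (AddSubmonoid.closure (substImage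
        (fun b => if b = v then {x ∈ X v | x v = 0} else {Pi.single b 1})
        {x | x + Pi.single v 1 ∈ X v}) : Set (α → ℕ)) := by
  set X₀ := {x ∈ X v | x v = 0} with hX₀
  set A : α → Set (α → ℕ) := fun b => if b = v then X₀ else {Pi.single b 1} with hA
  set W := substImage A {x | x + Pi.single v 1 ∈ X v} with hW
  have hAv : A v = X₀ := by simp [hA]
  have hAne : ∀ b, b ≠ v → A b = {Pi.single b 1} := fun b hb => by simp [hA, hb]
  have hX₀D : X₀ ⊆ Derivable X {v} v := by
    rintro x ⟨hx, hxv⟩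
    refine fun B h1 h2 => h2 v rfl x hx x ?_
    refine subst_self x fun a ha => h1 a ?_
    rintro rfl
    exact ha hxv
  have hAD : ∀ b, A b ⊆ Derivable X {v} b := by
    intro b
    by_cases hb : b = v
    · subst hb
      rw [hAv]; exact hX₀D
    · rw [hAne b hb, derivable_eq_single (by simpa using hb)]
  refine Set.Subset.antisymm ?_ ?_
  · have key : ∀ x z, (x, z) ∈ Subst (fun b => {z | ∃ z₀ ∈ A b, ∃ w ∈ AddSubmonoid.closure W,
        z = z₀ + w ∧ (b ≠ v → w = 0)}) → ∃ z₀, (x, z₀) ∈ Subst A ∧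
          ∃ w ∈ AddSubmonoid.closure W, z = z₀ + w ∧ (x v = 0 → w = 0) := by
      intro x z h
      refine subst_induction (P := fun x z => ∃ z₀, (x, z₀) ∈ Subst A ∧
          ∃ w ∈ AddSubmonoid.closure W, z = z₀ + w ∧ (x v = 0 → w = 0)) ?_ ?_ ?_ h
      · rintro b z ⟨z₀, h0, w, hw, rfl, hb⟩
        refine ⟨z₀, subst_single h0, w, hw, rfl, fun h => hb ?_⟩
        rintro rfl
        simp at h
      · exact ⟨0, subst_zero A, 0, zero_mem _, by simp, fun _ => rfl⟩
      · rintro x y z z' ⟨z₀, h0, w, hw, rfl, hb⟩ ⟨z₁, h1, w', hw', rfl, hb'⟩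
        refine ⟨z₀ + z₁, subst_add h0 h1, w + w', add_mem hw hw', add_add_add_comm _ _ _ _, ?_⟩
        intro h
        simp only [Pi.add_apply] at h
        rw [hb (by omega), hb' (by omega), add_zero]
    have := derivable_subset (X := X) (V := {v}) (B := fun b => {z | ∃ z₀ ∈ A b,
      ∃ w ∈ AddSubmonoid.closure W, z = z₀ + w ∧ (b ≠ v → w = 0)}) ?_ ?_ v
    · intro z hz
      obtain ⟨z₀, h0, w, hw, rfl, -⟩ := this hz
      rw [hAv] at h0
      exact Set.add_mem_add h0 hw
    · intro b hb
      refine ⟨_, ?_, 0, zero_mem _, (add_zero _).symm, fun _ => rfl⟩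
      rw [hAne b hb]; rfl
    · rintro b hb y hy z hz
      obtain rfl : b = v := hb
      obtain ⟨z₀, h0, w, hw, rfl, hyw⟩ := key y z hz
      by_cases hyb : y b = 0
      · have : z₀ = y := subst_eq_self h0 fun a ha => by
          rw [hAne a]
          rintro rfl
          exact ha hyb
        subst this
        exact ⟨z₀, by rw [hAv]; exact ⟨hy, hyb⟩, w, hw, rfl, fun h => absurd rfl h⟩
      · obtain ⟨y', rfl⟩ := exists_eq_add_single hyb
        obtain ⟨u, x₀, rfl, h1, h2⟩ := subst_split h0
        rw [subst_single_iff] at h2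
        exact ⟨x₀, h2, u + w, add_mem (AddSubmonoid.subset_closure ⟨y', hy, h1⟩) hw,
          by rw [← add_assoc, add_comm u], fun h => absurd rfl h⟩
  · rintro _ ⟨x, hx, w, hw, rfl⟩
    replace hx := hX₀D hx
    generalize x = y at hx ⊢
    induction hw using AddSubmonoid.closure_induction generalizing y with
    | mem w hw =>
      obtain ⟨t, ht, htw⟩ := hw
      refine derivable_rule (Set.mem_singleton v) ht ?_
      beta_reduce
      rw [add_comm y w]
      exact subst_add (subst_mono htw hAD) (subst_single hx)
    | zero => simpa using hx
    | add p q _ _ hp hq =>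
      have := hq _ (hp y hx)
      beta_reduce at this ⊢
      rwa [← add_assoc]

/-- Parikh's theorem for commutative grammars with semilinear sets of productions. -/
theorem derivable_isSemilinearSet [Finite α] (V : Set α) (X : α → Set (α → ℕ))
    (hX : ∀ a, IsSemilinearSet (X a)) (a : α) : IsSemilinearSet (Derivable X V a) := by
  have hsingle : ∀ (X : α → Set (α → ℕ)), (∀ a, IsSemilinearSet (X a)) → ∀ v a,
      IsSemilinearSet (Derivable X {v} a) := by
    intro X hX v a
    by_cases ha : a = v
    · subst ha
      rw [derivable_singleton]
      have h0 : IsSemilinearSet {x ∈ X a | x a = 0} := by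
        refine (hX a).inter ?_
        have := isSemilinearSet_setOfPred_eq (M := α → ℕ) (N := ℕ) 0 0
          (Pi.evalAddMonoidHom (fun _ : α => ℕ) a) (0 : (α → ℕ) →+ ℕ)
        simp only [zero_add, AddMonoidHom.zero_apply, Pi.evalAddMonoidHom_apply] at this
        exact this
      refine h0.add (IsSemilinearSet.closure (substImage_isSemilinearSet ?_ ?_))
      · intro b
        split_ifs
        · exact h0
        · exact IsSemilinearSet.singleton _
      · have h1 : IsSemilinearSet ((fun p : (α → ℕ) × (α → ℕ) => p.1) ''
          ({p : (α → ℕ) × (α → ℕ) | (Pi.single a 1 : α → ℕ) + AddMonoidHom.fst (α → ℕ) (α → ℕ) p =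
            0 + AddMonoidHom.snd (α → ℕ) (α → ℕ) p} ∩
            (AddMonoidHom.snd (α → ℕ) (α → ℕ)) ⁻¹' (X a))) :=
          ((isSemilinearSet_setOfPred_eq _ _ _ _).inter ((hX a).preimage _)).image
            (AddMonoidHom.fst (α → ℕ) (α → ℕ))
        convert h1 using 1
        ext x
        constructor
        · intro hx
          exact ⟨(x, x + Pi.single a 1), ⟨by simp [add_comm], (show x + Pi.single a 1 ∈ X a from hx)⟩, rfl⟩
        · rintro ⟨⟨x, y⟩, ⟨h, hy⟩, rfl⟩
          simp only [Set.mem_ofPred_eq, AddMonoidHom.coe_fst, AddMonoidHom.coe_snd,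
            zero_add] at h
          simp only [Set.mem_ofPred_eq]
          rw [add_comm, h]
          exact hy
    · rw [derivable_eq_single (by simpa using ha)]
      exact IsSemilinearSet.singleton _
  induction V, V.toFinite using Set.Finite.induction_on generalizing X a with
  | empty =>
    rw [derivable_eq_single (by simp)]
    exact IsSemilinearSet.singleton _
  | @insert v V hv _ ih =>
    rw [derivable_insert hv]
    exact substImage_isSemilinearSet
      (ih _ fun b => substImage_isSemilinearSet (hsingle X hX v) (hX b)) (hsingle X hX v a)

end CommutativeGrammar

section BoundedBase

open Pointwise

variable {E : Type} [Fintype E]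

/-- Every element of `s` lies in a linear subset of `s` with periods in `F` and with a base of size
at most `N`. -/
def BoundedBase (F : Set (E → ℕ)) (N : ℕ) (s : Set (E → ℕ)) : Prop :=
  ∀ x ∈ s, ∃ b : E → ℕ, ∃ P ⊆ F, ∑ i, b i ≤ N ∧
    (∃ y ∈ AddSubmonoid.closure P, x = b + y) ∧ ∀ y ∈ AddSubmonoid.closure P, b + y ∈ s

theorem BoundedBase.mono {F F' : Set (E → ℕ)} {N N' : ℕ} {s : Set (E → ℕ)}
    (h : BoundedBase F N s) (hF : F ⊆ F') (hN : N ≤ N') : BoundedBase F' N' s := by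
  intro x hx
  obtain ⟨b, P, hP, hb, h1, h2⟩ := h x hx
  exact ⟨b, P, hP.trans hF, hb.trans hN, h1, h2⟩

theorem BoundedBase.of_locally {F : Set (E → ℕ)} {N : ℕ} {s : Set (E → ℕ)}
    (h : ∀ x ∈ s, ∃ t ⊆ s, x ∈ t ∧ BoundedBase F N t) : BoundedBase F N s := by
  intro x hx
  obtain ⟨t, hts, hxt, ht⟩ := h x hx
  obtain ⟨b, P, hP, hb, h1, h2⟩ := ht x hxt
  exact ⟨b, P, hP, hb, h1, fun y hy => hts (h2 y hy)⟩

theorem BoundedBase.exists_le {F : Set (E → ℕ)} {N : ℕ} {s : Set (E → ℕ)}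
    (h : BoundedBase F N s) (hs : s.Nonempty) : ∃ b ∈ s, ∑ i, b i ≤ N := by
  obtain ⟨x, hx⟩ := hs
  obtain ⟨b, P, _, hb, _, h2⟩ := h x hx
  exact ⟨b, by simpa using h2 0 (zero_mem _), hb⟩

theorem BoundedBase.zero (F : Set (E → ℕ)) (N : ℕ) : BoundedBase F N {0} := by
  rintro x rfl
  exact ⟨0, ∅, Set.empty_subset _, by simp, ⟨0, zero_mem _, by simp⟩, by simp⟩

theorem BoundedBase.add {F : Set (E → ℕ)} {N N' : ℕ} {s t : Set (E → ℕ)}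
    (hs : BoundedBase F N s) (ht : BoundedBase F N' t) : BoundedBase F (N + N') (s + t) := by
  rintro _ ⟨x, hx, x', hx', rfl⟩
  obtain ⟨b, P, hP, hb, ⟨y, hy, rfl⟩, h2⟩ := hs x hx
  obtain ⟨b', P', hP', hb', ⟨y', hy', rfl⟩, h2'⟩ := ht x' hx'
  refine ⟨b + b', P ∪ P', Set.union_subset hP hP', ?_, ⟨y + y', ?_, ?_⟩, ?_⟩
  · simp only [Pi.add_apply, Finset.sum_add_distrib]
    omega
  · rw [AddSubmonoid.closure_union]
    exact AddSubmonoid.add_mem_sup hy hy'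
  · exact add_add_add_comm _ _ _ _
  · intro z hz
    rw [AddSubmonoid.closure_union, AddSubmonoid.mem_sup] at hz
    obtain ⟨u, hu, v, hv, rfl⟩ := hz
    rw [add_add_add_comm]
    exact Set.add_mem_add (h2 u hu) (h2' v hv)

omit [Fintype E] in
theorem BoundedBase.uniform {ι : Type} [Finite ι] {p : ι → Set (E → ℕ) → ℕ → Prop}
    (hp : ∀ i F F' N N', F ⊆ F' → N ≤ N' → p i F N → p i F' N')
    (h : ∀ i, ∃ F : Set (E → ℕ), F.Finite ∧ ∃ N, p i F N) :
    ∃ F : Set (E → ℕ), F.Finite ∧ ∃ N, ∀ i, p i F N := by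
  have := Fintype.ofFinite ι
  choose F hF N h using h
  exact ⟨⋃ i, F i, Set.finite_iUnion hF, ∑ i, N i, fun i => hp i _ _ _ _
    (Set.subset_iUnion F i) (Finset.single_le_sum (fun _ _ => Nat.zero_le _) (Finset.mem_univ i))
    (h i)⟩

theorem IsSemilinearSet.exists_boundedBase {s : Set (E → ℕ)} (hs : IsSemilinearSet s) :
    ∃ F : Set (E → ℕ), F.Finite ∧ ∃ N, BoundedBase F N s := by
  obtain ⟨S, hS, hlin, rfl⟩ := hs
  have : Finite S := hS
  have h1 : ∀ t : S, ∃ F : Set (E → ℕ), F.Finite ∧ ∃ N, BoundedBase F N t.1 := by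
    rintro ⟨t, ht⟩
    obtain ⟨a, P, hP, rfl⟩ := hlin t ht
    refine ⟨P, hP, ∑ i, a i, ?_⟩
    rintro _ ⟨y, hy, rfl⟩
    exact ⟨a, P, le_rfl, le_rfl, ⟨y, hy, rfl⟩, fun z hz => ⟨z, hz, rfl⟩⟩
  obtain ⟨F, hF, N, h⟩ := BoundedBase.uniform (fun i F F' N N' hF hN h => h.mono hF hN) h1
  refine ⟨F, hF, N, BoundedBase.of_locally fun x hx => ?_⟩
  obtain ⟨t, ht, hxt⟩ := hx
  exact ⟨t, Set.subset_sUnion_of_mem ht, hxt, h ⟨t, ht⟩⟩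

theorem BoundedBase.substImage_aux {α : Type} [Fintype α] [DecidableEq α]
    {F : Set (E → ℕ)} {K : ℕ} {A : α → Set (E → ℕ)} (hA : ∀ a, BoundedBase F K (A a))
    {b : α → ℕ} {z : E → ℕ} (h : (b, z) ∈ Subst A) :
    ∃ t, z ∈ t ∧ (∀ w ∈ t, (b, w) ∈ Subst A) ∧ BoundedBase F (K * ∑ i, b i) t := by
  refine subst_induction (P := fun b z => ∃ t, z ∈ t ∧ (∀ w ∈ t, (b, w) ∈ Subst A) ∧
    BoundedBase F (K * ∑ i, b i) t) ?_ ?_ ?_ h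
  · intro a z hz
    refine ⟨A a, hz, fun w hw => subst_single hw, ?_⟩
    simpa using hA a
  · refine ⟨{0}, rfl, ?_, BoundedBase.zero _ _⟩
    rintro w rfl
    exact subst_zero A
  · rintro x y z w ⟨t, h1, h2, h3⟩ ⟨t', h1', h2', h3'⟩
    refine ⟨t + t', Set.add_mem_add h1 h1', ?_, ?_⟩
    · rintro _ ⟨u, hu, v, hv, rfl⟩
      exact subst_add (h2 u hu) (h2' v hv)
    · simp only [Pi.add_apply, Finset.sum_add_distrib, mul_add]
      exact h3.add h3'

/-- Substituting semilinear sets preserves bounded bases. -/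
theorem BoundedBase.exists_substImage {α : Type} [Fintype α] [DecidableEq α]
    {A : α → Set (E → ℕ)} (hA : ∀ a, IsSemilinearSet (A a)) {F : Set (α → ℕ)} (hF : F.Finite) :
    ∃ F' : Set (E → ℕ), F'.Finite ∧ ∃ K, ∀ s N, BoundedBase F N s →
      BoundedBase F' (K * (N + 1)) (substImage A s) := by
  have : Finite (Set.powerset F) := hF.finite_subsets
  obtain ⟨F₁, hF₁, K₁, h1⟩ := BoundedBase.uniform (ι := α)
    (p := fun a F K => BoundedBase F K (A a)) (fun i F F' N N' hF hN h => h.mono hF hN)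
    fun a => (hA a).exists_boundedBase
  obtain ⟨F₂, hF₂, K₂, h2⟩ := BoundedBase.uniform (ι := Set.powerset F)
    (p := fun P F K => BoundedBase F K (substImage A (AddSubmonoid.closure P.1 : Set (α → ℕ))))
    (fun i F F' N N' hF hN h => h.mono hF hN)
    fun P => (substImage_isSemilinearSet hA
      (IsSemilinearSet.closure_of_finite (hF.subset P.2))).exists_boundedBase
  refine ⟨F₁ ∪ F₂, hF₁.union hF₂, K₁ + K₂, fun s N hs => BoundedBase.of_locally ?_⟩
  rintro z ⟨x, hx, hxz⟩
  obtain ⟨b, P, hP, hb, ⟨y, hy, rfl⟩, h4⟩ := hs x hx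
  obtain ⟨z₁, z₂, rfl, h5, h6⟩ := subst_split hxz
  obtain ⟨t, ht1, ht2, ht3⟩ := BoundedBase.substImage_aux h1 h5
  refine ⟨t + substImage A (AddSubmonoid.closure P : Set (α → ℕ)), ?_,
    Set.add_mem_add ht1 ⟨y, hy, h6⟩, ?_⟩
  · rintro _ ⟨u, hu, v, ⟨y', hy', hv⟩, rfl⟩
    exact ⟨b + y', h4 y' hy', subst_add (ht2 u hu) hv⟩
  · refine ((ht3.mono Set.subset_union_left le_rfl).add
      ((h2 ⟨P, hP⟩).mono Set.subset_union_right le_rfl)).mono le_rfl ?_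
    have : K₁ * ∑ i, b i ≤ K₁ * N := Nat.mul_le_mul_left _ hb
    nlinarith [Nat.zero_le (K₂ * N)]

/-- The slices of a semilinear set have bases of linearly bounded size. -/
theorem IsSemilinearSet.exists_boundedBase_slice {L : Set ((E → ℕ) × (ℕ × ℕ))}
    (hL : IsSemilinearSet L) :
    ∃ F : Set (E → ℕ), F.Finite ∧ ∃ K, ∀ k : ℕ × ℕ,
      BoundedBase F (K * (k.1 + k.2 + 1)) {y | (y, k) ∈ L} := by
  obtain ⟨S, hS, hlin, rfl⟩ := hL
  have : Finite S := hS
  have h1 : ∀ t : S, ∃ F : Set (E → ℕ), F.Finite ∧ ∃ K, ∀ k : ℕ × ℕ,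
      BoundedBase F (K * (k.1 + k.2 + 1)) {y | (y, k) ∈ t.1} := by
    rintro ⟨t, ht⟩
    obtain ⟨a, P, hP, rfl⟩ := hlin t ht
    obtain ⟨K, hK⟩ : ∃ K, ∀ p ∈ P, ∑ i, p.1 i ≤ K := by
      obtain ⟨K, hK⟩ := (hP.image fun p => ∑ i, p.1 i).bddAbove
      exact ⟨K, fun p hp => hK ⟨p, hp, rfl⟩⟩
    set P₀ : Set (E → ℕ) := {y | (y, (0, 0)) ∈ P} with hP₀
    have hfin : P₀.Finite := (hP.image Prod.fst).subset fun y hy => ⟨_, hy, rfl⟩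
    have hdec : ∀ c ∈ AddSubmonoid.closure P, ∃ c₁ ∈ AddSubmonoid.closure P,
        ∃ y ∈ AddSubmonoid.closure P₀, c = c₁ + (y, 0) ∧
          ∑ i, c₁.1 i ≤ K * (c₁.2.1 + c₁.2.2) := by
      intro c hc
      induction hc using AddSubmonoid.closure_induction with
      | mem p hp =>
        by_cases h : p.2 = 0
        · refine ⟨0, zero_mem _, p.1, AddSubmonoid.subset_closure ?_, ?_, by simp⟩
          · have : p = (p.1, (0, 0)) := Prod.ext rfl h
            rw [hP₀, Set.mem_ofPred_eq, ← this]
            exact hp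
          · rw [zero_add]
            exact Prod.ext rfl h
        · refine ⟨p, AddSubmonoid.subset_closure hp, 0, zero_mem _, (add_zero p).symm, ?_⟩
          have h2 : 1 ≤ p.2.1 + p.2.2 := by
            by_contra hlt
            exact h (Prod.ext (by simp; omega) (by simp; omega))
          exact (hK p hp).trans (Nat.le_mul_of_pos_right K h2)
      | zero => exact ⟨0, zero_mem _, 0, zero_mem _, by simp; rfl, by simp⟩
      | add p q _ _ hp hq =>
        obtain ⟨c, hc, y, hy, rfl, h⟩ := hp
        obtain ⟨c', hc', y', hy', rfl, h'⟩ := hq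
        refine ⟨c + c', add_mem hc hc', y + y', add_mem hy hy', ?_, ?_⟩
        · rw [add_add_add_comm]; rfl
        · simp only [Prod.fst_add, Prod.snd_add, Pi.add_apply, Finset.sum_add_distrib]
          nlinarith
    refine ⟨P₀, hfin, K + ∑ i, a.1 i, fun k x hx => ?_⟩
    obtain ⟨c, hc, hac⟩ := hx
    obtain ⟨c₁, hc₁, y, hy, rfl, hle⟩ := hdec c hc
    have h1 := congrArg Prod.fst hac
    have h2 := congrArg Prod.snd hac
    simp only [vadd_eq_add, Prod.fst_add, Prod.snd_add, add_zero] at h1 h2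
    refine ⟨a.1 + c₁.1, P₀, le_rfl, ?_, ⟨y, hy, by rw [← h1, add_assoc]⟩, ?_⟩
    · simp only [Pi.add_apply, Finset.sum_add_distrib]
      have h3 : c₁.2.1 + c₁.2.2 ≤ k.1 + k.2 := by
        rw [← h2]
        simp only [Prod.fst_add, Prod.snd_add]
        omega
      have h4 := Nat.mul_le_mul_left K h3
      nlinarith [Nat.zero_le ((∑ i, a.1 i) * (k.1 + k.2))]
    · intro y' hy'
      have h3 : (y', ((0 : ℕ), (0 : ℕ))) ∈ AddSubmonoid.closure P := by
        have h5 : AddSubmonoid.closure P₀ ≤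
            (AddSubmonoid.closure P).comap (AddMonoidHom.inl (E → ℕ) (ℕ × ℕ)) :=
          AddSubmonoid.closure_le.2 fun z hz => AddSubmonoid.subset_closure hz
        exact h5 hy'
      refine ⟨c₁ + (y', (0, 0)), add_mem hc₁ h3, ?_⟩
      simp only [vadd_eq_add]
      refine Prod.ext ?_ ?_
      · simp [add_assoc]
      · simp only [Prod.snd_add]
        rw [← h2]
        simp [Prod.ext_iff]
  obtain ⟨F, hF, N, h⟩ := BoundedBase.uniform (ι := S) (p := fun t F K => ∀ k : ℕ × ℕ,
      BoundedBase F (K * (k.1 + k.2 + 1)) {y | (y, k) ∈ t.1})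
    (fun i F F' N N' hF hN h k => (h k).mono hF (Nat.mul_le_mul_right _ hN)) h1
  refine ⟨F, hF, N, fun k => BoundedBase.of_locally fun x hx => ?_⟩
  obtain ⟨t, ht, hxt⟩ := hx
  exact ⟨{y | (y, k) ∈ t}, fun y hy => ⟨t, ht, hy⟩, hxt, h ⟨t, ht⟩ k⟩

/-- Intersecting with the fibres of a homomorphism to the integers preserves bounded bases. -/
theorem BoundedBase.exists_inter_fiber [DecidableEq E] {F : Set (E → ℕ)} (hF : F.Finite)
    (φ : (E → ℕ) →+ ℤ) :
    ∃ F' : Set (E → ℕ), F'.Finite ∧ ∃ K, ∀ s N (n : ℤ), BoundedBase F N s →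
      BoundedBase F' (K * (N + n.natAbs + 1)) {x ∈ s | φ x = n} := by
  have : Finite (Set.powerset F) := hF.finite_subsets
  have hsl : ∀ P : Set.powerset F, IsSemilinearSet {p : (E → ℕ) × (ℕ × ℕ) |
      p.1 ∈ AddSubmonoid.closure P.1 ∧ φ p.1 + p.2.2 = p.2.1} := by
    intro P
    refine IsSemilinearSet.inter (s₁ := {p : (E → ℕ) × (ℕ × ℕ) |
      p.1 ∈ AddSubmonoid.closure P.1}) ?_ ?_
    · exact (IsSemilinearSet.closure_of_finite (hF.subset P.2)).preimage
        (AddMonoidHom.fst (E → ℕ) (ℕ × ℕ))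
    · have := isSemilinearSet_setOfPred_eq (M := (E → ℕ) × (ℕ × ℕ)) (N := ℤ) 0 0
        (φ.comp (AddMonoidHom.fst (E → ℕ) (ℕ × ℕ)) + (Nat.castAddMonoidHom ℤ).comp
          ((AddMonoidHom.snd ℕ ℕ).comp (AddMonoidHom.snd (E → ℕ) (ℕ × ℕ))))
        ((Nat.castAddMonoidHom ℤ).comp
          ((AddMonoidHom.fst ℕ ℕ).comp (AddMonoidHom.snd (E → ℕ) (ℕ × ℕ))))
      simp only [zero_add] at this
      exact this
  obtain ⟨F', hF', K, h⟩ := BoundedBase.uniform (ι := Set.powerset F)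
    (p := fun P F' K => ∀ k : ℕ × ℕ, BoundedBase F' (K * (k.1 + k.2 + 1))
      {y | y ∈ AddSubmonoid.closure P.1 ∧ φ y + k.2 = k.1})
    (fun i F F' N N' hF hN h k => (h k).mono hF (Nat.mul_le_mul_right _ hN))
    fun P => (hsl P).exists_boundedBase_slice
  obtain ⟨B, hB⟩ : ∃ B : ℕ, ∀ b : E → ℕ, (φ b).natAbs ≤ B * ∑ i, b i := by
    refine ⟨∑ i, (φ (Pi.single i 1)).natAbs, fun b => ?_⟩
    have : b = ∑ i, b i • (Pi.single i 1 : E → ℕ) := by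
      funext j
      simp [Finset.sum_apply, Pi.single_apply]
    conv_lhs => rw [this]
    rw [map_sum]
    refine (Int.natAbs_sum_le _ _).trans ?_
    rw [Finset.mul_sum]
    refine Finset.sum_le_sum fun i _ => ?_
    rw [map_nsmul, nsmul_eq_mul, Int.natAbs_mul, Int.natAbs_natCast, mul_comm]
    exact Nat.mul_le_mul_right _ (Finset.single_le_sum
      (f := fun i => (φ (Pi.single i 1)).natAbs) (fun _ _ => Nat.zero_le _) (Finset.mem_univ i))
  refine ⟨F', hF', 1 + K * (B + 1), fun s N n hs => BoundedBase.of_locally ?_⟩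
  rintro x ⟨hx, hxn⟩
  obtain ⟨b, P, hP, hb, ⟨y, hy, rfl⟩, h4⟩ := hs x hx
  set k : ℕ × ℕ := ((n - φ b).toNat, (-(n - φ b)).toNat) with hk
  have hk1 : ∀ y, (φ y + k.2 = k.1 ↔ φ (b + y) = n) := by
    intro y
    rw [hk, map_add]
    constructor <;> intro h <;> simp only at h ⊢ <;> omega
  refine ⟨{b} + {y | y ∈ AddSubmonoid.closure P ∧ φ y + k.2 = k.1}, ?_, ?_, ?_⟩
  · rintro _ ⟨_, rfl, y', ⟨hy', hy'k⟩, rfl⟩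
    exact ⟨h4 y' hy', (hk1 y').1 hy'k⟩
  · exact Set.add_mem_add rfl ⟨hy, (hk1 y).2 hxn⟩
  · have h5 : BoundedBase F' N {b} := by
      rintro x rfl
      exact ⟨x, ∅, Set.empty_subset _, hb, ⟨0, zero_mem _, by simp⟩, by simp⟩
    refine (h5.add (h ⟨P, hP⟩ k)).mono le_rfl ?_
    have h6 := hB b
    have h7 : B * ∑ i, b i ≤ B * N := Nat.mul_le_mul_left _ hb
    have h8 : k.1 + k.2 ≤ n.natAbs + B * N := by
      rw [hk]
      simp only
      omega
    have h9 : K * (k.1 + k.2 + 1) ≤ K * (n.natAbs + B * N + 1) :=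
      Nat.mul_le_mul_left K (by omega)
    refine (Nat.add_le_add_left h9 N).trans ?_
    generalize n.natAbs = m
    have h10 : (1 + K * (B + 1)) * (N + m + 1) = N + K * (m + B * N + 1) +
      (m + 1 + K * N + K * B * m + K * B) := by ring
    omega

end BoundedBase

section LeastGrammar

variable {α M N : Type} [DecidableEq α] [AddCommMonoid M] [AddCommMonoid N]

theorem subst_map (f : M →+ N) {A : α → Set M} {x : α → ℕ} {z : M} (h : (x, z) ∈ Subst A) :
    (x, f z) ∈ Subst fun a => f '' A a := by
  refine subst_induction (P := fun x z => (x, f z) ∈ Subst fun a => f '' A a) ?_ ?_ ?_ h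
  · intro a z hz
    exact subst_single ⟨z, hz, rfl⟩
  · rw [map_zero]
    exact subst_zero _
  · intro x y z w h h'
    rw [map_add]
    exact subst_add h h'

theorem exists_subst_of_map (f : M →+ N) {A : α → Set M} {x : α → ℕ} {w : N}
    (h : (x, w) ∈ Subst fun a => f '' A a) : ∃ z, (x, z) ∈ Subst A ∧ f z = w := by
  refine subst_induction (P := fun x w => ∃ z, (x, z) ∈ Subst A ∧ f z = w) ?_ ?_ ?_ h
  · rintro a _ ⟨z, hz, rfl⟩
    exact ⟨z, subst_single hz, rfl⟩
  · exact ⟨0, subst_zero _, map_zero f⟩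
  · rintro x y _ _ ⟨z, hz, rfl⟩ ⟨w, hw, rfl⟩
    exact ⟨z + w, subst_add hz hw, map_add f z w⟩

/-- A commutative grammar with terminals `E`, nonterminals `N` and semilinear sets of productions
has a least solution, which consists of semilinear sets. -/
theorem exists_least_solution {E K : Type} [Finite E] [Finite K] [DecidableEq E] [DecidableEq K]
    (X : K → Set (E ⊕ K → ℕ)) (hX : ∀ k, IsSemilinearSet (X k)) :
    ∃ A : E ⊕ K → Set (E → ℕ), (∀ e, A (Sum.inl e) = {Pi.single e 1}) ∧
      (∀ a, IsSemilinearSet (A a)) ∧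
      (∀ k, ∀ y ∈ X k, ∀ z, (y, z) ∈ Subst A → z ∈ A (Sum.inr k)) ∧
      (∀ B : E ⊕ K → Set (E → ℕ), (∀ e, Pi.single e 1 ∈ B (Sum.inl e)) →
        (∀ k, ∀ y ∈ X k, ∀ z, (y, z) ∈ Subst B → z ∈ B (Sum.inr k)) → ∀ a, A a ⊆ B a) := by
  let f : (E ⊕ K → ℕ) →+ (E → ℕ) :=
    { toFun := fun z e => z (Sum.inl e), map_zero' := rfl, map_add' := fun _ _ => rfl }
  have hf : ∀ e, f (Pi.single (Sum.inl e) 1) = Pi.single e 1 := by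
    intro e
    funext e'
    by_cases h : e' = e
    · subst h
      simp [f]
    · have : (Sum.inl e' : E ⊕ K) ≠ Sum.inl e := by simpa using h
      simp [f, Pi.single_eq_of_ne this, Pi.single_eq_of_ne h]
  let X' : E ⊕ K → Set (E ⊕ K → ℕ) := Sum.elim (fun _ => ∅) X
  let V : Set (E ⊕ K) := Set.range Sum.inr
  refine ⟨fun a => f '' Derivable X' V a, ?_, ?_, ?_, ?_⟩
  · intro e
    have he : (Sum.inl e : E ⊕ K) ∉ V := by simp [V]
    beta_reduce
    rw [derivable_eq_single he, Set.image_singleton, hf]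
  · intro a
    refine IsSemilinearSet.image (derivable_isSemilinearSet V X' ?_ a) f
    rintro (e | k)
    · exact IsSemilinearSet.empty
    · exact hX k
  · intro k y hy z hz
    obtain ⟨w, hw, rfl⟩ := exists_subst_of_map f hz
    exact ⟨w, derivable_rule (by simp [V]) hy hw, rfl⟩
  · rintro B h1 h2 a _ ⟨z, hz, rfl⟩
    refine derivable_subset (X := X') (V := V) (B := fun a => {z | f z ∈ B a}) ?_ ?_ a hz
    · rintro (e | k) hb
      · rw [Set.mem_ofPred_eq, hf]
        exact h1 e
      · simp [V] at hb
    · rintro (e | k) hb y hy w hw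
      · simp [V] at hb
      · refine h2 k y hy _ (subst_mono (subst_map f hw) ?_)
        rintro a _ ⟨z, hz, rfl⟩
        exact hz

end LeastGrammar

section Paths

variable {Q E G : Type}

/-- The list of edges labels a path in the automaton with transition relation `tr`. -/
def IsPath (tr : Q → E → Q → Prop) : Q → List E → Q → Prop
  | p, [], q => p = q
  | p, e :: L, q => ∃ r, tr p e r ∧ IsPath tr r L q

theorem isPath_append {tr : Q → E → Q → Prop} {p q : Q} {L L' : List E} :
    IsPath tr p (L ++ L') q ↔ ∃ r, IsPath tr p L r ∧ IsPath tr r L' q := by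
  induction L generalizing p with
  | nil => simp [IsPath]
  | cons e L ih =>
    simp only [List.cons_append, IsPath, ih]
    constructor
    · rintro ⟨r, h, s, h1, h2⟩
      exact ⟨s, ⟨r, h, h1⟩, h2⟩
    · rintro ⟨s, ⟨r, h, h1⟩, h2⟩
      exact ⟨r, h, s, h1, h2⟩

variable [DecidableEq E]

/-- The Parikh vector of a list. -/
def parikh (L : List E) : E → ℕ := fun e => L.count e

theorem parikh_nil : parikh ([] : List E) = 0 := by
  funext e
  simp [parikh]

theorem parikh_append (L L' : List E) : parikh (L ++ L') = parikh L + parikh L' := by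
  funext e
  simp [parikh]

theorem parikh_singleton (e : E) : parikh [e] = Pi.single e 1 := by
  funext e'
  by_cases h : e' = e
  · subst h
    simp [parikh]
  · rw [Pi.single_eq_of_ne h]
    simp [parikh, Ne.symm h]

theorem parikh_cons (e : E) (L : List E) : parikh (e :: L) = Pi.single e 1 + parikh L := by
  rw [← List.singleton_append, parikh_append, parikh_singleton]

theorem sum_parikh [Fintype E] (L : List E) : ∑ e, parikh L e = L.length := by
  induction L with
  | nil => simp [parikh_nil]
  | cons e L ih =>
    rw [parikh_cons]
    simp only [Pi.add_apply, Finset.sum_add_distrib, ih, List.length_cons]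
    simp [add_comm]

variable [Group G]

/-- The Parikh vectors of the paths from `p` to `q` with label `g`. -/
def pathVectors (tr : Q → E → Q → Prop) (lab : E → G) (p q : Q) (g : G) : Set (E → ℕ) :=
  {x | ∃ L, IsPath tr p L q ∧ (L.map lab).prod = g ∧ parikh L = x}

variable {tr : Q → E → Q → Prop} {lab : E → G}

theorem pathVectors_add {p q r : Q} {g h : G} {x y : E → ℕ} (hx : x ∈ pathVectors tr lab p q g)
    (hy : y ∈ pathVectors tr lab q r h) : x + y ∈ pathVectors tr lab p r (g * h) := by
  obtain ⟨L, h1, h2, rfl⟩ := hx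
  obtain ⟨L', h1', h2', rfl⟩ := hy
  exact ⟨L ++ L', isPath_append.2 ⟨q, h1, h1'⟩, by simp [h2, h2'], parikh_append L L'⟩

theorem pathVectors_zero (p : Q) : (0 : E → ℕ) ∈ pathVectors tr lab p p 1 :=
  ⟨[], rfl, rfl, parikh_nil⟩

theorem pathVectors_single {p q : Q} {e : E} (h : tr p e q) :
    Pi.single e 1 ∈ pathVectors tr lab p q (lab e) :=
  ⟨[e], ⟨q, h, rfl⟩, by simp, parikh_singleton e⟩

/-- The automaton with an additional edge for every pair of states. -/
def virtualTr (tr : Q → E → Q → Prop) : Q → E ⊕ (Q × Q) → Q → Prop :=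
  fun p a q => Sum.elim (fun e => tr p e q) (fun r => r = (p, q)) a

/-- The additional edges have trivial labels. -/
def virtualLab (lab : E → G) : E ⊕ (Q × Q) → G := Sum.elim lab fun _ => 1

theorem pathVectors_of_virtual [DecidableEq Q] {p q : Q} {L : List (E ⊕ (Q × Q))}
    (hL : IsPath (virtualTr tr) p L q) {z : E → ℕ} {B : E ⊕ (Q × Q) → Set (E → ℕ)}
    (hB : ∀ e, B (Sum.inl e) ⊆ {Pi.single e 1})
    (hB' : ∀ r s, B (Sum.inr (r, s)) ⊆ pathVectors tr lab r s 1)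
    (hz : (parikh L, z) ∈ Subst B) :
    z ∈ pathVectors tr lab p q ((L.map (virtualLab lab)).prod) := by
  induction L generalizing p z with
  | nil =>
    obtain rfl : p = q := hL
    rw [parikh_nil, subst_zero_iff] at hz
    subst hz
    exact pathVectors_zero p
  | cons a L ih =>
    obtain ⟨r, h1, h2⟩ := hL
    rw [parikh_cons] at hz
    obtain ⟨z₁, z₂, rfl, h3, h4⟩ := subst_split hz
    rw [subst_single_iff] at h3
    rw [List.map_cons, List.prod_cons]
    refine pathVectors_add ?_ (ih h2 h4)
    rcases a with e | s
    · obtain rfl := hB e h3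
      exact pathVectors_single h1
    · obtain rfl : s = (p, r) := h1
      exact hB' _ _ h3

/-- The sets of Parikh vectors of the paths reading a word over `T` have, uniformly, bases of
size linearly bounded in the length of the word. -/
def LinearPaths (G : Type) [Group G] (T : Set G) : Prop :=
  ∀ (Q E : Type) [Fintype Q] [Fintype E] [DecidableEq E] (tr : Q → E → Q → Prop) (lab : E → G),
    (∀ e, lab e ∈ T) → ∃ F : Set (E → ℕ), F.Finite ∧ ∃ K, ∀ p q, ∀ w : List G, (∀ t ∈ w, t ∈ T) →
      BoundedBase F (K * (w.length + 1)) (pathVectors tr lab p q w.prod)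

theorem linearPaths_of_subsingleton (G : Type) [Group G] [Subsingleton G] (T : Set G) :
    LinearPaths G T := by
  classical
  intro Q E _ _ _ tr lab _
  let X : Q × Q → Set (E ⊕ (Q × Q) → ℕ) := fun pq =>
    {y | ∃ e r, tr pq.1 e r ∧ y = parikh [Sum.inl e, Sum.inr (r, pq.2)]} ∪ {y | pq.1 = pq.2 ∧ y = 0}
  obtain ⟨A, h1, h2, h3, h4⟩ := exists_least_solution X fun k => by
    refine IsSemilinearSet.of_finite (Set.Finite.union ?_ ?_)
    · exact (Set.finite_range fun er : E × Q =>
        parikh [Sum.inl er.1, Sum.inr (er.2, k.2)]).subset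
        (by rintro _ ⟨e, r, _, rfl⟩; exact ⟨(e, r), rfl⟩)
    · exact (Set.finite_singleton 0).subset (by rintro _ ⟨_, rfl⟩; rfl)
  have hA : ∀ p q g, pathVectors tr lab p q g = A (Sum.inr (p, q)) := by
    intro p q g
    refine Set.Subset.antisymm ?_ ?_
    · rintro _ ⟨L, hL, -, rfl⟩
      induction L generalizing p with
      | nil => exact h3 (p, q) 0 (Or.inr ⟨hL, rfl⟩) _ (by rw [parikh_nil]; exact subst_zero A)
      | cons e L ih =>
        obtain ⟨r, h, hr⟩ := hL
        refine h3 (p, q) _ (Or.inl ⟨e, r, h, rfl⟩) _ ?_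
        rw [parikh_cons, parikh_singleton, parikh_cons]
        exact subst_add (subst_single (by rw [h1]; rfl)) (subst_single (ih r hr))
    · have := h4 (Sum.elim (fun e => {Pi.single e 1}) fun r => pathVectors tr lab r.1 r.2 1)
        (fun e => rfl) ?_ (Sum.inr (p, q))
      · rwa [Subsingleton.elim g 1]
      · intro k y hy z hz
        have key : ∃ L, IsPath (virtualTr tr) k.1 L k.2 ∧ y = parikh L := by
          rcases hy with ⟨e, r, h, rfl⟩ | ⟨h, rfl⟩
          · exact ⟨[Sum.inl e, Sum.inr (r, k.2)], ⟨r, h, k.2, rfl, rfl⟩, rfl⟩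
          · exact ⟨[], h, parikh_nil.symm⟩
        obtain ⟨L, hL, rfl⟩ := key
        have := pathVectors_of_virtual (lab := lab) hL (fun e => le_rfl) (fun r s => le_rfl) hz
        rwa [Subsingleton.elim (List.map (virtualLab lab) L).prod 1] at this
  obtain ⟨F, hF, N, h⟩ := BoundedBase.uniform (ι := E ⊕ (Q × Q))
    (p := fun a F N => BoundedBase F N (A a)) (fun i F F' N N' hF hN h => h.mono hF hN)
    fun a => (h2 a).exists_boundedBase
  refine ⟨F, hF, N, fun p q w _ => ?_⟩
  rw [hA]
  exact (h _).mono le_rfl (Nat.le_mul_of_pos_right N (Nat.succ_pos _))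

theorem linearPaths_of_int_extension {H G : Type} [Group H] [Group G] {T : Set H} {T' : Set G}
    (hG : LinearPaths G T') (f : H →* G) (g : H →* Multiplicative ℤ)
    (hinj : ∀ x, f x = 1 → g x = 1 → x = 1) (hf : ∀ t ∈ T, f t ∈ T')
    (hg : ∀ t ∈ T, (g t).toAdd.natAbs ≤ 1) : LinearPaths H T := by
  intro Q E _ _ _ tr lab hlab
  obtain ⟨F, hF, K, h⟩ := hG Q E tr (fun e => f (lab e)) fun e => hf _ (hlab e)
  let φ : (E → ℕ) →+ ℤ :=
    { toFun := fun x => ∑ e, x e * (g (lab e)).toAdd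
      map_zero' := by simp
      map_add' := fun x y => by simp [add_mul, Finset.sum_add_distrib] }
  have hφ : ∀ L : List E, φ (parikh L) = (g (L.map lab).prod).toAdd := by
    intro L
    induction L with
    | nil => rw [parikh_nil, map_zero]; simp
    | cons e L ih =>
      rw [parikh_cons, map_add, ih]
      have : φ (Pi.single e 1) = (g (lab e)).toAdd := by
        simp [φ, Pi.single_apply]
      rw [this]
      simp
  obtain ⟨F', hF', K', h'⟩ := BoundedBase.exists_inter_fiber hF φ
  refine ⟨F', hF', K' * (K + 2), fun p q w hw => ?_⟩
  have heq : pathVectors tr lab p q w.prod =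
      {x ∈ pathVectors tr (fun e => f (lab e)) p q (w.map f).prod |
        φ x = (g w.prod).toAdd} := by
    ext x
    constructor
    · rintro ⟨L, h1, h2, rfl⟩
      refine ⟨⟨L, h1, ?_, rfl⟩, by rw [hφ, h2]⟩
      rw [← map_list_prod, ← h2, map_list_prod, List.map_map]
      rfl
    · rintro ⟨⟨L, h1, h2, rfl⟩, h3⟩
      refine ⟨L, h1, ?_, rfl⟩
      rw [hφ] at h3
      rw [← mul_inv_eq_one]
      apply hinj
      · rw [map_mul, map_inv, mul_inv_eq_one, map_list_prod, map_list_prod, ← h2, List.map_map]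
        rfl
      · rw [map_mul, map_inv, mul_inv_eq_one]
        exact h3
  rw [heq]
  have h1 := h p q (w.map f) (by
    intro t ht
    obtain ⟨s, hs, rfl⟩ := List.mem_map.1 ht
    exact hf s (hw s hs))
  refine (h' _ _ _ h1).mono le_rfl ?_
  have h2 : (g w.prod).toAdd.natAbs ≤ w.length := by
    clear h1 heq
    induction w with
    | nil => simp
    | cons t w ih =>
      rw [List.prod_cons, map_mul, toAdd_mul, List.length_cons]
      have h3 := hg t (hw t (by simp))
      have h4 := ih fun s hs => hw s (by simp [hs])
      omega
  rw [List.length_map, mul_assoc]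
  refine Nat.mul_le_mul_left _ ?_
  rw [add_mul]
  omega

end Paths

section SemilinearBase

open Pointwise

theorem BoundedBase.isSemilinearSet {E : Type} [Fintype E] {F : Set (E → ℕ)} (hF : F.Finite)
    {N : ℕ} {s : Set (E → ℕ)} (h : BoundedBase F N s) : IsSemilinearSet s := by
  have hfin : {b : E → ℕ | ∑ i, b i ≤ N}.Finite := by
    refine (Set.Finite.pi' fun _ : E => Set.finite_Iic N).subset fun b hb i => ?_
    exact (Finset.single_le_sum (fun _ _ => Nat.zero_le _) (Finset.mem_univ i)).trans hb
  have hfin' : {c : (E → ℕ) × Set (E → ℕ) | (∑ i, c.1 i ≤ N ∧ c.2 ⊆ F) ∧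
      ∀ y ∈ AddSubmonoid.closure c.2, c.1 + y ∈ s}.Finite :=
    (hfin.prod hF.finite_subsets).subset fun c hc => hc.1
  convert IsSemilinearSet.biUnion hfin'
    (t := fun c => c.1 +ᵥ (AddSubmonoid.closure c.2 : Set (E → ℕ))) ?_ using 1
  · ext x
    simp only [Set.mem_iUnion]
    constructor
    · intro hx
      obtain ⟨b, P, hP, hb, ⟨y, hy, rfl⟩, h2⟩ := h x hx
      exact ⟨(b, P), ⟨⟨hb, hP⟩, h2⟩, y, hy, rfl⟩
    · rintro ⟨c, hc, y, hy, rfl⟩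
      exact hc.2 y hy
  · intro c hc
    exact (IsSemilinearSet.closure_of_finite (hF.subset hc.1.2)).vadd _

end SemilinearBase

section ReducedList

variable {ι : Type} {G : ι → Type}

open scoped Classical in
/-- The list `i`-letter followed by a tail, where trivial letters are dropped. -/
noncomputable def reducedCons [∀ i, Group (G i)] (i : ι) (h : G i) (W : List (Σ i, G i)) :
    List (Σ i, G i) :=
  if h = 1 then W else ⟨i, h⟩ :: W

open scoped Classical in
/-- The reduced form of an element of a free product. -/
noncomputable def reducedForm [∀ i, Group (G i)] (g : Monoid.CoprodI G) : List (Σ i, G i) :=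
  (Monoid.CoprodI.Word.equiv g).toList

variable [∀ i, Group (G i)]

theorem reducedForm_one : reducedForm (1 : Monoid.CoprodI G) = [] := by
  classical
  have : (Monoid.CoprodI.Word.equiv (1 : Monoid.CoprodI G)) = Monoid.CoprodI.Word.empty :=
    one_smul (Monoid.CoprodI G) (Monoid.CoprodI.Word.empty : Monoid.CoprodI.Word G)
  exact congrArg Monoid.CoprodI.Word.toList this

theorem prod_reducedForm (g : Monoid.CoprodI G) :
    ((reducedForm g).map fun l => Monoid.CoprodI.of l.2).prod = g := by
  classical
  exact Monoid.CoprodI.Word.equiv.symm_apply_apply g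

open scoped Classical in
theorem toList_rcons (i : ι) (p : Monoid.CoprodI.Word.Pair G i) :
    (Monoid.CoprodI.Word.rcons p).toList = reducedCons i p.head p.tail.toList := by
  unfold reducedCons Monoid.CoprodI.Word.rcons
  split_ifs <;> rfl

theorem exists_reducedForm_eq (i : ι) (m : G i) (g : Monoid.CoprodI G) :
    ∃ h W, reducedForm g = reducedCons i h W ∧
      reducedForm (Monoid.CoprodI.of m * g) = reducedCons i (m * h) W := by
  classical
  let w : Monoid.CoprodI.Word G := Monoid.CoprodI.Word.equiv g
  let p := Monoid.CoprodI.Word.equivPair i w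
  refine ⟨p.head, p.tail.toList, ?_, ?_⟩
  · rw [← toList_rcons]
    exact congrArg Monoid.CoprodI.Word.toList
      ((Monoid.CoprodI.Word.equivPair i).symm_apply_apply w).symm
  · have h1 : reducedForm (Monoid.CoprodI.of m * g) =
        (Monoid.CoprodI.of m • w : Monoid.CoprodI.Word G).toList :=
      congrArg Monoid.CoprodI.Word.toList
        (mul_smul (Monoid.CoprodI.of m) g (Monoid.CoprodI.Word.empty : Monoid.CoprodI.Word G))
    rw [h1, Monoid.CoprodI.Word.of_smul_def, toList_rcons]

/-- The list of group elements has spellings over the generating sets of total length, including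
a separator after each of them, at most the given number. -/
def SpellingBound (T : ∀ i, Set (G i)) : List (Σ i, G i) → ℕ → Prop
  | [], _ => True
  | x :: W, n => ∃ K : List (G x.1), (∀ t ∈ K, t ∈ T x.1) ∧ K.prod = x.2 ∧
      ∃ m, SpellingBound T W m ∧ K.length + 1 + m ≤ n

theorem SpellingBound.mono {T : ∀ i, Set (G i)} {W : List (Σ i, G i)} {m n : ℕ}
    (h : SpellingBound T W m) (hmn : m ≤ n) : SpellingBound T W n := by
  cases W with
  | nil => trivial
  | cons x W =>
    obtain ⟨K, h1, h2, k, h3, h4⟩ := h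
    exact ⟨K, h1, h2, k, h3, h4.trans hmn⟩

theorem spellingBound_reducedForm {T : ∀ i, Set (G i)} (w : List (Monoid.CoprodI G))
    (hw : ∀ x ∈ w, x ∈ {x | ∃ i, ∃ t ∈ T i, x = Monoid.CoprodI.of t}) :
    SpellingBound T (reducedForm w.prod) (2 * w.length) := by
  induction w with
  | nil =>
    rw [List.prod_nil, reducedForm_one]
    trivial
  | cons x w ih =>
    obtain ⟨i, t, ht, rfl⟩ := hw x (by simp)
    have ih := ih fun y hy => hw y (by simp [hy])
    rw [List.prod_cons]
    obtain ⟨h, W, h1, h2⟩ := exists_reducedForm_eq i t w.prod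
    rw [h2]
    rw [h1] at ih
    unfold reducedCons at ih ⊢
    rw [List.length_cons]
    by_cases hh : h = 1
    · rw [if_pos hh] at ih
      split_ifs with hth
      · exact ih.mono (by omega)
      · refine ⟨[t], by simpa using ht, by simp [hh], _, ih, ?_⟩
        simp only [List.length_singleton]
        omega
    · rw [if_neg hh] at ih
      obtain ⟨K, h3, h4, m, h5, h6⟩ := ih
      split_ifs with hth
      · exact h5.mono (by omega)
      · refine ⟨t :: K, ?_, by simp [h4], m, h5, ?_⟩
        · intro s hs
          rcases List.mem_cons.1 hs with hs | hs
          · rw [hs]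
            exact ht
          · exact h3 s hs
        · simp only [List.length_cons]
          omega

end ReducedList

section FreeProduct

open Monoid

variable {Q E : Type} [DecidableEq Q] [DecidableEq E] {ι : Type} {G : ι → Type}
  [∀ i, Group (G i)]

/-- The automaton reading the letters of one factor, with virtual edges for loops in between. -/
def factorTr (tr : Q → E → Q → Prop) (ind : E → ι) (j : ι) : Q → E ⊕ (Q × Q) → Q → Prop :=
  fun p a q => Sum.elim (fun e => tr p e q ∧ ind e = j) (fun r => r = (p, q)) a

/-- Parikh vectors of paths with label in one factor, interspersed with loops. -/
def factorVectors (tr : Q → E → Q → Prop) (ind : E → ι) (lab : ∀ j, E → G j)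
    (A : E ⊕ (Q × Q) → Set (E → ℕ)) (j : ι) (h : G j) (p q : Q) : Set (E → ℕ) :=
  substImage A (pathVectors (factorTr tr ind j) (virtualLab (lab j)) p q h)

/-- Parikh vectors of the paths reading a reduced list. -/
def wordVectors (tr : Q → E → Q → Prop) (ind : E → ι) (lab : ∀ j, E → G j)
    (A : E ⊕ (Q × Q) → Set (E → ℕ)) : List (Σ i, G i) → Q → Q → Set (E → ℕ)
  | [], p, q => A (Sum.inr (p, q))
  | x :: W, p, q => {z | ∃ r s, ∃ a ∈ A (Sum.inr (p, r)),
      ∃ y ∈ factorVectors tr ind lab A x.1 x.2 r s, ∃ b ∈ wordVectors tr ind lab A W s q,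
        z = a + (y + b)}

variable {tr : Q → E → Q → Prop} {ind : E → ι} {lab : ∀ j, E → G j}
  {A : E ⊕ (Q × Q) → Set (E → ℕ)}

theorem factorVectors_add {j : ι} {h h' : G j} {p q r : Q} {x y : E → ℕ}
    (hx : x ∈ factorVectors tr ind lab A j h p q)
    (hy : y ∈ factorVectors tr ind lab A j h' q r) :
    x + y ∈ factorVectors tr ind lab A j (h * h') p r := by
  obtain ⟨u, hu, hux⟩ := hx
  obtain ⟨v, hv, hvy⟩ := hy
  exact ⟨u + v, pathVectors_add hu hv, subst_add hux hvy⟩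

theorem factorVectors_zero (j : ι) (p : Q) :
    (0 : E → ℕ) ∈ factorVectors tr ind lab A j 1 p p :=
  ⟨0, pathVectors_zero p, subst_zero A⟩

theorem factorVectors_edge (hA : ∀ e, A (Sum.inl e) = {Pi.single e 1}) {p q : Q} {e : E}
    (h : tr p e q) :
    Pi.single e 1 ∈ factorVectors tr ind lab A (ind e) (lab (ind e) e) p q := by
  refine ⟨Pi.single (Sum.inl e) 1, ?_, subst_single (by rw [hA]; exact Set.mem_singleton _)⟩
  exact pathVectors_single (lab := virtualLab (lab (ind e)))
    (tr := factorTr tr ind (ind e)) (e := Sum.inl e) ⟨h, rfl⟩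

theorem factorVectors_loop (j : ι) {p q : Q} {x : E → ℕ} (hx : x ∈ A (Sum.inr (p, q))) :
    x ∈ factorVectors tr ind lab A j 1 p q :=
  ⟨Pi.single (Sum.inr (p, q)) 1, pathVectors_single (lab := virtualLab (lab j))
    (tr := factorTr tr ind j) (e := Sum.inr (p, q)) rfl, subst_single hx⟩

theorem wordVectors_loop_add [Nonempty ι]
    (hA : ∀ j p q, factorVectors tr ind lab A j 1 p q ⊆ A (Sum.inr (p, q))) {W : List (Σ i, G i)}
    {p q r : Q} {x y : E → ℕ} (hx : x ∈ A (Sum.inr (p, q)))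
    (hy : y ∈ wordVectors tr ind lab A W q r) : x + y ∈ wordVectors tr ind lab A W p r := by
  obtain ⟨j⟩ := ‹Nonempty ι›
  have hadd : ∀ p q r : Q, ∀ x ∈ A (Sum.inr (p, q)), ∀ y ∈ A (Sum.inr (q, r)),
      x + y ∈ A (Sum.inr (p, r)) := by
    intro p q r x hx y hy
    refine hA j p r ?_
    have := factorVectors_add (factorVectors_loop (lab := lab) (tr := tr) (ind := ind) j hx)
      (factorVectors_loop j hy)
    rwa [mul_one] at this
  cases W with
  | nil => exact hadd p q r x hx y hy
  | cons c W =>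
    obtain ⟨s, t, a, ha, u, hu, b, hb, rfl⟩ := hy
    exact ⟨s, t, x + a, hadd _ _ _ _ hx _ ha, u, hu, b, hb, (add_assoc _ _ _).symm⟩

theorem mem_wordVectors_reducedCons [Nonempty ι]
    (hA : ∀ j p q, factorVectors tr ind lab A j 1 p q ⊆ A (Sum.inr (p, q)))
    {j : ι} {h : G j} {W : List (Σ i, G i)} {p q : Q} {z : E → ℕ} :
    z ∈ wordVectors tr ind lab A (reducedCons j h W) p q ↔
      z ∈ wordVectors tr ind lab A (⟨j, h⟩ :: W) p q := by
  unfold reducedCons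
  split_ifs with hh
  · subst hh
    constructor
    · intro hz
      exact ⟨p, p, 0, hA j _ _ (factorVectors_zero j p), 0, factorVectors_zero j p, z, hz,
        by simp⟩
    · rintro ⟨r, s, a, ha, y, hy, b, hb, rfl⟩
      exact wordVectors_loop_add hA ha (wordVectors_loop_add hA (hA j _ _ hy) hb)
  · exact Iff.rfl

theorem parikh_mem_wordVectors [Nonempty ι] (hA₀ : ∀ e, A (Sum.inl e) = {Pi.single e 1})
    (hA : ∀ j p q, factorVectors tr ind lab A j 1 p q ⊆ A (Sum.inr (p, q)))
    {L : List E} {p q : Q} (hL : IsPath tr p L q) :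
    parikh L ∈ wordVectors tr ind lab A
      (reducedForm (L.map fun e => CoprodI.of (lab (ind e) e)).prod) p q := by
  induction L generalizing p with
  | nil =>
    obtain rfl : p = q := hL
    rw [List.map_nil, List.prod_nil, reducedForm_one, parikh_nil]
    exact hA (Classical.arbitrary ι) _ _ (factorVectors_zero _ p)
  | cons e L ih =>
    obtain ⟨r, h1, h2⟩ := hL
    have ih := ih h2
    rw [List.map_cons, List.prod_cons]
    obtain ⟨h, W, h3, h4⟩ := exists_reducedForm_eq (ind e) (lab (ind e) e)
      (L.map fun e => CoprodI.of (lab (ind e) e)).prod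
    rw [h3, mem_wordVectors_reducedCons hA] at ih
    rw [h4, mem_wordVectors_reducedCons hA, parikh_cons]
    obtain ⟨s, t, a, ha, y, hy, b, hb, hz⟩ := ih
    refine ⟨p, t, 0, hA (ind e) _ _ (factorVectors_zero _ p), Pi.single e 1 + (a + y), ?_, b, hb,
      by rw [hz]; abel⟩
    have h5 := factorVectors_add (factorVectors_edge (ind := ind) (lab := lab) hA₀ h1)
      (factorVectors_add (factorVectors_loop (ind e) ha) hy)
    rwa [one_mul] at h5

theorem factorVectors_subset {lab₀ : E → CoprodI G}
    (hlab : ∀ j e, ind e = j → lab₀ e = CoprodI.of (lab j e))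
    (hA : ∀ e, A (Sum.inl e) ⊆ {Pi.single e 1})
    (hA' : ∀ p q, A (Sum.inr (p, q)) ⊆ pathVectors tr lab₀ p q 1) (j : ι) (h : G j) (p q : Q) :
    factorVectors tr ind lab A j h p q ⊆ pathVectors tr lab₀ p q (CoprodI.of h) := by
  rintro z ⟨_, ⟨L, hL, rfl, rfl⟩, hz⟩
  have key : IsPath (virtualTr tr) p L q ∧
      CoprodI.of (L.map (virtualLab (lab j))).prod = (L.map (virtualLab lab₀)).prod := by
    clear hz
    induction L generalizing p with
    | nil => exact ⟨hL, by simp⟩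
    | cons a L ih =>
      obtain ⟨r, h1, h2⟩ := hL
      obtain ⟨h3, h4⟩ := ih r h2
      rw [List.map_cons, List.prod_cons, map_mul, List.map_cons, List.prod_cons, h4]
      rcases a with e | s
      · exact ⟨⟨r, h1.1, h3⟩, by simp only [virtualLab, Sum.elim_inl, hlab j e h1.2]⟩
      · exact ⟨⟨r, h1, h3⟩, by simp only [virtualLab, Sum.elim_inr, map_one]⟩
  rw [key.2]
  exact pathVectors_of_virtual key.1 hA hA' hz

theorem wordVectors_subset {lab₀ : E → CoprodI G}
    (hA' : ∀ p q, A (Sum.inr (p, q)) ⊆ pathVectors tr lab₀ p q 1)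
    (hY : ∀ (j : ι) (h : G j) (p q : Q),
      factorVectors tr ind lab A j h p q ⊆ pathVectors tr lab₀ p q (CoprodI.of h))
    (W : List (Σ i, G i)) (p q : Q) : wordVectors tr ind lab A W p q ⊆
      pathVectors tr lab₀ p q (W.map fun l => CoprodI.of l.2).prod := by
  induction W generalizing p with
  | nil => exact hA' p q
  | cons x W ih =>
    rintro _ ⟨r, s, a, ha, y, hy, b, hb, rfl⟩
    have := pathVectors_add (hA' _ _ ha) (pathVectors_add (hY _ _ _ _ hy) (ih s hb))
    rwa [one_mul] at this

theorem wordVectors_boundedBase [Fintype E] {T : ∀ i, Set (G i)} {F : Set (E → ℕ)} {C : ℕ}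
    (hA : ∀ p q, BoundedBase F C (A (Sum.inr (p, q))))
    (hY : ∀ j p q, ∀ K : List (G j), (∀ t ∈ K, t ∈ T j) →
      BoundedBase F (C * (K.length + 1)) (factorVectors tr ind lab A j K.prod p q))
    {W : List (Σ i, G i)} {n : ℕ} (hW : SpellingBound T W n) (p q : Q) :
    BoundedBase F (C * (2 * n + 1)) (wordVectors tr ind lab A W p q) := by
  induction W generalizing n p with
  | nil => exact (hA p q).mono le_rfl (Nat.le_mul_of_pos_right C (Nat.succ_pos _))
  | cons x W ih =>
    obtain ⟨K, h1, h2, m, h3, h4⟩ := hW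
    refine BoundedBase.of_locally ?_
    rintro _ ⟨r, s, a, ha, y, hy, b, hb, rfl⟩
    have h5 := (hA p r).add ((hY x.1 r s K h1).add (ih h3 s))
    rw [h2] at h5
    refine ⟨_, ?_, Set.add_mem_add ha (Set.add_mem_add hy hb), h5.mono le_rfl ?_⟩
    · rintro _ ⟨a, ha, _, ⟨y, hy, b, hb, rfl⟩, rfl⟩
      exact ⟨r, s, a, ha, y, hy, b, hb, rfl⟩
    · have : C * (K.length + 1 + 1 + (2 * m + 1)) ≤ C * (2 * n + 1) :=
        Nat.mul_le_mul_left _ (by omega)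
      nlinarith

theorem linearPaths_coprodI [Finite ι] [Nonempty ι] {T : ∀ i, Set (G i)} (hT : ∀ i, 1 ∈ T i)
    (hG : ∀ i, LinearPaths (G i) (T i)) :
    LinearPaths (CoprodI G) {x | ∃ i, ∃ t ∈ T i, x = CoprodI.of t} := by
  classical
  intro Q E _ _ _ tr lab₀ hlab₀
  choose ind l hl hl' using hlab₀
  have : ∀ j e, ∃ t ∈ T j, ind e = j → lab₀ e = CoprodI.of t := by
    intro j e
    by_cases h : ind e = j
    · subst h
      exact ⟨l e, hl e, fun _ => hl' e⟩
    · exact ⟨1, hT j, fun h' => absurd h' h⟩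
  choose lab hlab hlab' using this
  have hpv : ∀ j, ∃ F : Set (E ⊕ (Q × Q) → ℕ), F.Finite ∧ ∃ K, ∀ p q, ∀ w : List (G j),
      (∀ t ∈ w, t ∈ T j) → BoundedBase F (K * (w.length + 1))
        (pathVectors (factorTr tr ind j) (virtualLab (lab j)) p q w.prod) := by
    intro j
    refine hG j Q (E ⊕ (Q × Q)) (factorTr tr ind j) (virtualLab (lab j)) ?_
    rintro (e | s)
    · exact hlab j e
    · exact hT j
  obtain ⟨A, hA₀, hA, hA₁, hA₂⟩ := exists_least_solution
    (fun k : Q × Q => ⋃ j, pathVectors (factorTr tr ind j) (virtualLab (lab j)) k.1 k.2 1) (by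
      intro k
      refine IsSemilinearSet.iUnion fun j => ?_
      obtain ⟨F, hF, K, h⟩ := hpv j
      have := h k.1 k.2 [] (by simp)
      rw [List.prod_nil] at this
      exact this.isSemilinearSet hF)
  have hY₁ : ∀ j p q, factorVectors tr ind lab A j 1 p q ⊆ A (Sum.inr (p, q)) := by
    rintro j p q z ⟨y, hy, hz⟩
    exact hA₁ (p, q) y (Set.mem_iUnion.2 ⟨j, hy⟩) z hz
  have hA₃ : ∀ p q, A (Sum.inr (p, q)) ⊆ pathVectors tr lab₀ p q 1 := by
    intro p q
    refine hA₂ (Sum.elim (fun e => {Pi.single e 1}) fun r => pathVectors tr lab₀ r.1 r.2 1)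
      (fun e => Set.mem_singleton _) ?_ (Sum.inr (p, q))
    intro k y hy z hz
    obtain ⟨j, hy⟩ := Set.mem_iUnion.1 hy
    have := factorVectors_subset (lab := lab) hlab' (fun e => le_rfl) (fun p q => le_rfl) j 1
      k.1 k.2 ⟨y, hy, hz⟩
    rwa [map_one] at this
  have hY₂ := factorVectors_subset (lab := lab) hlab' (fun e => (hA₀ e).le) hA₃
  obtain ⟨F₁, hF₁, C₁, h1⟩ := BoundedBase.uniform (ι := E ⊕ (Q × Q))
    (p := fun a F N => BoundedBase F N (A a)) (fun i F F' N N' hF hN h => h.mono hF hN)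
    fun a => (hA a).exists_boundedBase
  obtain ⟨F₂, hF₂, C₂, h2⟩ := BoundedBase.uniform (ι := ι) (E := E)
    (p := fun j F C => ∀ p q, ∀ K : List (G j), (∀ t ∈ K, t ∈ T j) →
      BoundedBase F (C * (K.length + 1)) (factorVectors tr ind lab A j K.prod p q))
    (fun i F F' N N' hF hN h p q K hK => (h p q K hK).mono hF (Nat.mul_le_mul_right _ hN)) (by
      intro j
      obtain ⟨F, hF, K, h⟩ := hpv j
      obtain ⟨F', hF', K', h'⟩ := BoundedBase.exists_substImage hA hF
      refine ⟨F', hF', K' * (K + 1), fun p q w hw => ?_⟩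
      refine (h' _ _ (h p q w hw)).mono le_rfl ?_
      rw [mul_assoc]
      exact Nat.mul_le_mul_left _ (by rw [add_mul]; omega))
  refine ⟨F₁ ∪ F₂, hF₁.union hF₂, (C₁ + C₂) * 4, fun p q w hw => ?_⟩
  have heq : pathVectors tr lab₀ p q w.prod =
      wordVectors tr ind lab A (reducedForm w.prod) p q := by
    refine Set.Subset.antisymm ?_ ?_
    · rintro _ ⟨L, hL, hg, rfl⟩
      have := parikh_mem_wordVectors hA₀ hY₁ hL
      rwa [← hg, List.map_congr_left fun e _ => hlab' _ e rfl]
    · have := wordVectors_subset hA₃ hY₂ (reducedForm w.prod) p q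
      rwa [prod_reducedForm] at this
  rw [heq]
  refine (wordVectors_boundedBase (T := T) (F := F₁ ∪ F₂) (C := C₁ + C₂) ?_ ?_
    (spellingBound_reducedForm w hw) p q).mono le_rfl ?_
  · exact fun p q => (h1 _).mono Set.subset_union_left (Nat.le_add_right _ _)
  · exact fun j p q K hK => (h2 j p q K hK).mono Set.subset_union_right
      (Nat.mul_le_mul_right _ (Nat.le_add_left _ _))
  · rw [mul_assoc]
    exact Nat.mul_le_mul_left _ (by omega)

end FreeProduct

section ForestGroups

open Monoid

variable {S H : Type} [Group H] {I : S → S → Prop}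

/-- The homomorphism from a graph group determined by the images of the generators. -/
def graphLift (φ : S → H) (h : ∀ a b, I a b → Commute (φ a) (φ b)) : GraphGroup I →* H :=
  PresentedGroup.toGroup (f := φ) (by
    rintro _ ⟨a, b, hab, rfl⟩
    simp only [map_mul, map_inv, FreeGroup.lift_apply_of]
    rw [(h a b hab).eq]
    group)

@[simp]
theorem graphLift_of (φ : S → H) (h : ∀ a b, I a b → Commute (φ a) (φ b)) (a : S) :
    graphLift φ h (PresentedGroup.of a) = φ a :=
  PresentedGroup.toGroup.of _

/-- The generators of a graph group, their inverses and the identity. -/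
def graphLetters (I : S → S → Prop) : Set (GraphGroup I) :=
  {x | x = 1 ∨ ∃ a, x = PresentedGroup.of a ∨ x = (PresentedGroup.of a)⁻¹}

theorem commute_of_forall_rel {v : S} (hv : ∀ x, x ≠ v → I v x) (g : GraphGroup I) :
    Commute g (PresentedGroup.of v) := by
  have h : (⊤ : Subgroup (GraphGroup I)) ≤
      Subgroup.centralizer {PresentedGroup.of (rels := GraphGroupRels I) v} := by
    rw [← PresentedGroup.closure_range_of, Subgroup.closure_le]
    rintro _ ⟨x, rfl⟩
    by_cases hx : x = v
    · subst hx
      exact Subgroup.mem_centralizer_singleton_iff.2 rfl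
    · exact Subgroup.mem_centralizer_singleton_iff.2 (commute_of_rel (hv x hx)).symm
  exact Subgroup.mem_centralizer_singleton_iff.1 (h (Subgroup.mem_top g))

theorem linearPaths_of_dominating {v : S} (hv : ∀ x, x ≠ v → I v x)
    (h : LinearPaths (GraphGroup fun x y : {x // x ≠ v} => I x y) (graphLetters _)) :
    LinearPaths (GraphGroup I) (graphLetters I) := by
  classical
  let f : GraphGroup I →* GraphGroup fun x y : {x // x ≠ v} => I x y :=
    graphLift (fun x => if hx : x ≠ v then PresentedGroup.of ⟨x, hx⟩ else 1) (by
      intro a b hab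
      split_ifs
      · exact commute_of_rel (I := fun x y : {x // x ≠ v} => I x y) hab
      · exact Commute.one_right _
      · exact Commute.one_left _
      · exact Commute.one_left _)
  let g : GraphGroup I →* Multiplicative ℤ :=
    graphLift (fun x => if x = v then Multiplicative.ofAdd 1 else 1) fun a b _ => mul_comm _ _
  let s : GraphGroup (fun x y : {x // x ≠ v} => I x y) →* GraphGroup I :=
    graphLift (fun x => PresentedGroup.of x.1) fun a b hab => commute_of_rel hab
  let φ : GraphGroup I →* GraphGroup I := (s.noncommCoprod
    (zpowersHom _ (PresentedGroup.of (rels := GraphGroupRels I) v)) (fun m n =>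
      (commute_of_forall_rel hv _).zpow_right _)).comp (f.prod g)
  have hg : ∀ x, g (PresentedGroup.of x) = if x = v then Multiplicative.ofAdd 1 else 1 :=
    fun x => graphLift_of _ _ x
  have hφ' : ∀ x, φ x = s (f x) * PresentedGroup.of v ^ (g x).toAdd := fun x => rfl
  have hφ : φ = MonoidHom.id _ := by
    refine PresentedGroup.ext fun x => ?_
    rw [hφ', hg]
    by_cases hx : x = v
    · simp [s, f, hx]
    · simp [s, f, hx]
  refine linearPaths_of_int_extension h f g ?_ ?_ ?_
  · intro x h1 h2
    have : φ x = x := by rw [hφ]; rfl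
    rw [← this, hφ', h1, h2]
    simp
  · rintro _ (rfl | ⟨x, rfl | rfl⟩)
    · exact Or.inl (map_one f)
    · by_cases hx : x = v
      · exact Or.inl (by simp [f, hx])
      · exact Or.inr ⟨⟨x, hx⟩, Or.inl (by simp [f, hx])⟩
    · by_cases hx : x = v
      · exact Or.inl (by simp [f, hx])
      · exact Or.inr ⟨⟨x, hx⟩, Or.inr (by simp [f, hx])⟩
  · rintro _ (rfl | ⟨x, rfl | rfl⟩)
    · simp
    · rw [hg]
      split_ifs <;> simp
    · rw [map_inv, hg]
      split_ifs <;> simp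

theorem linearPaths_of_separated (c : S → Bool) (hc : ∀ a b, I a b → c a = c b)
    (h : ∀ i, LinearPaths (GraphGroup fun x y : {x // c x = i} => I x y) (graphLetters _)) :
    LinearPaths (GraphGroup I) (graphLetters I) := by
  let G : Bool → Type := fun i => GraphGroup fun x y : {x // c x = i} => I x y
  have hG := linearPaths_coprodI (G := G) (fun i => Or.inl rfl) h
  let ψ : S → CoprodI G := fun x => CoprodI.of (M := G) (i := c x) (PresentedGroup.of ⟨x, rfl⟩)
  have hψ : ∀ x i (hi : c x = i),
      ψ x = CoprodI.of (M := G) (i := i) (PresentedGroup.of ⟨x, hi⟩) := by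
    rintro x _ rfl
    rfl
  let f : GraphGroup I →* CoprodI G := graphLift ψ (by
    intro a b hab
    rw [hψ a _ (hc a b hab)]
    exact Commute.map (commute_of_rel (I := fun x y : {x // c x = c b} => I x y) hab) _)
  let s : CoprodI G →* GraphGroup I := CoprodI.lift fun i =>
    graphLift (fun x => PresentedGroup.of x.1) fun a b hab => commute_of_rel hab
  have hs : s.comp f = MonoidHom.id _ := by
    refine PresentedGroup.ext fun x => ?_
    simp only [MonoidHom.comp_apply, f, graphLift_of, ψ, s, CoprodI.lift_of, MonoidHom.id_apply]
    exact graphLift_of _ _ _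
  refine linearPaths_of_int_extension hG f 1 ?_ ?_ ?_
  · intro x hx _
    have : s (f x) = x := DFunLike.congr_fun hs x
    rw [← this, hx, map_one]
  · rintro _ (rfl | ⟨x, rfl | rfl⟩)
    · exact ⟨true, 1, Or.inl rfl, by rw [map_one, map_one]⟩
    · exact ⟨c x, _, Or.inr ⟨⟨x, rfl⟩, Or.inl rfl⟩, graphLift_of _ _ _⟩
    · refine ⟨c x, _, Or.inr ⟨⟨x, rfl⟩, Or.inr rfl⟩, ?_⟩
      rw [map_inv, map_inv]
      exact congrArg _ (graphLift_of _ _ _)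
  · intro t _
    simp

theorem IsTransitiveForest.restrict (h : IsTransitiveForest I) (P : S → Prop) :
    IsTransitiveForest fun x y : {x // P x} => I x y := by
  obtain ⟨r, hr, h1, h2⟩ := h
  refine ⟨fun x y => r x y, { irrefl := fun x => hr.irrefl x.1, trans := fun x y z => hr.trans x.1 y.1 z.1 },
    fun a b c hab hac => ?_, fun a b => ?_⟩
  · rcases h1 a b c hab hac with h | h | h
    · exact Or.inl h
    · exact Or.inr (Or.inl (Subtype.ext h))
    · exact Or.inr (Or.inr h)
  · beta_reduce
    rw [h2, Ne, Ne, Subtype.ext_iff]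

theorem IsTransitiveForest.linearPaths_of_card (n : ℕ) : ∀ {S : Type} [Finite S]
    {I : S → S → Prop}, IsTransitiveForest I → Nat.card S ≤ n →
      LinearPaths (GraphGroup I) (graphLetters I) := by
  classical
  induction n with
  | zero =>
    intro S _ I hI hn
    have : IsEmpty S := Finite.card_eq_zero_iff.1 (Nat.le_zero.1 hn)
    have : Subsingleton (GraphGroup I) := by
      have h1 : Function.Surjective (PresentedGroup.mk (GraphGroupRels I)) :=
        PresentedGroup.mk_surjective _
      exact h1.subsingleton
    exact linearPaths_of_subsingleton _ _
  | succ n ih =>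
    intro S _ I hI hn
    have hsub : ∀ P : S → Prop, (∃ x, ¬ P x) → Nat.card {x // P x} ≤ n := by
      intro P hP
      obtain ⟨x, hx⟩ := hP
      have : Nat.card {x // P x} < Nat.card S := Finite.card_subtype_lt hx
      omega
    cases isEmpty_or_nonempty S with
    | inl h => exact ih hI (by rw [Nat.card_eq_zero.2 (Or.inl h)]; omega)
    | inr h =>
      obtain ⟨r, hr, h1, h2⟩ := id hI
      have hwf : WellFounded r := Finite.wellFounded_of_trans_of_irrefl r
      obtain ⟨v, -, hv⟩ := hwf.has_min Set.univ Set.univ_nonempty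
      have hv : ∀ x, ¬ r x v := fun x => hv x trivial
      by_cases hall : ∀ x, x ≠ v → r v x
      · exact linearPaths_of_dominating (fun x hx => (h2 v x).2 ⟨hx.symm, Or.inl (hall x hx)⟩)
          (ih (hI.restrict _) (hsub _ ⟨v, by simp⟩))
      · push Not at hall
        obtain ⟨u, hu, hu'⟩ := hall
        have hcl : ∀ a b, r a b → ((a = v ∨ r v a) ↔ (b = v ∨ r v b)) := by
          intro a b hab
          constructor
          · rintro (rfl | ha)
            · exact Or.inr hab
            · exact Or.inr (hr.trans _ _ _ ha hab)
          · rintro (rfl | hb)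
            · exact absurd hab (hv a)
            · rcases h1 b v a hb hab with h | h | h
              · exact Or.inr h
              · exact Or.inl h.symm
              · exact absurd h (hv a)
        refine linearPaths_of_separated (fun x => decide (x = v ∨ r v x)) ?_ ?_
        · intro a b hab
          rcases ((h2 a b).1 hab).2 with h | h
          · exact decide_eq_decide.2 (hcl a b h)
          · exact decide_eq_decide.2 (hcl b a h).symm
        · intro i
          refine ih (hI.restrict _) (hsub _ ?_)
          cases i with
          | true => exact ⟨u, by simp [hu, hu']⟩
          | false => exact ⟨v, by simp⟩

theorem IsTransitiveForest.linearPaths [Finite S] (h : IsTransitiveForest I) :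
    LinearPaths (GraphGroup I) (graphLetters I) :=
  h.linearPaths_of_card _ le_rfl

end ForestGroups

section Pilings

variable {S : Type}

/-- The generator underlying a letter. -/
def letterBase (x : S ⊕ S) : S := Sum.elim id id x

/-- The element of the graph group represented by a letter. -/
def letterEval (I : S → S → Prop) (x : S ⊕ S) : GraphGroup I :=
  Sum.elim (fun a => PresentedGroup.of a) (fun a => (PresentedGroup.of a)⁻¹) x

theorem graphEval_ofList (I : S → S → Prop) (w : List (S ⊕ S)) :
    graphEval I (FreeMonoid.ofList w) = (w.map (letterEval I)).prod := by
  rw [graphEval, FreeMonoid.lift_apply, FreeMonoid.toList_ofList]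
  rfl

theorem letterBase_swap (x : S ⊕ S) : letterBase x.swap = letterBase x := by
  cases x <;> rfl

theorem letterEval_swap (I : S → S → Prop) (x : S ⊕ S) :
    letterEval I x.swap = (letterEval I x)⁻¹ := by
  cases x
  · rfl
  · exact (inv_inv _).symm

theorem letter_ext {x y : S ⊕ S} (h : letterBase x = letterBase y) (h' : x.isLeft = y.isLeft) :
    x = y := by
  rcases x with x | x <;> rcases y with y | y
  · exact congrArg Sum.inl h
  · simp at h'
  · simp at h'
  · exact congrArg Sum.inr h

theorem isLeft_swap (x : S ⊕ S) : x.swap.isLeft = !x.isLeft := by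
  cases x <;> rfl

/-- The letter cancels against the top of its pile. -/
def Cancels (s : S → List (Option Bool)) (x : S ⊕ S) : Prop :=
  (s (letterBase x)).head? = some (some !x.isLeft)

variable (I : S → S → Prop)

open scoped Classical in
/-- The action of letters on pilings: either the letter is put on its pile, and a blank is put on
the piles of the other generators which do not commute with it, or this is undone. -/
noncomputable def pile (x : S ⊕ S) (s : S → List (Option Bool)) : S → List (Option Bool) :=
  fun b => if I (letterBase x) b then s b
    else if Cancels s x then (s b).tail
    else (if b = letterBase x then some x.isLeft else none) :: s b

/-- The pilings obtained from the empty one without cancellation. -/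
inductive ReducedPiling : (S → List (Option Bool)) → Prop
  | empty : ReducedPiling fun _ => []
  | cons {s x} : ReducedPiling s → ¬ Cancels s x → ReducedPiling (pile I x s)

variable {I}

theorem pile_of_rel {s : S → List (Option Bool)} {x : S ⊕ S} {b : S} (h : I (letterBase x) b) :
    pile I x s b = s b := if_pos h

theorem pile_of_not_cancels {s : S → List (Option Bool)} {x : S ⊕ S} {b : S}
    (h : ¬ I (letterBase x) b) (hc : ¬ Cancels s x) [Decidable (b = letterBase x)] :
    pile I x s b = (if b = letterBase x then some x.isLeft else none) :: s b := by
  unfold pile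
  rw [if_neg h, if_neg hc]
  congr

theorem pile_of_cancels {s : S → List (Option Bool)} {x : S ⊕ S} {b : S}
    (h : ¬ I (letterBase x) b) (hc : Cancels s x) : pile I x s b = (s b).tail := by
  unfold pile
  rw [if_neg h, if_pos hc]

theorem cancels_pile_iff {s : S → List (Option Bool)} {x y : S ⊕ S}
    (h : I (letterBase x) (letterBase y)) : Cancels (pile I x s) y ↔ Cancels s y := by
  unfold Cancels
  rw [pile_of_rel h]

section

variable (hirr : ∀ a, ¬ I a a)
include hirr

theorem pile_self {s : S → List (Option Bool)} {x : S ⊕ S} (hc : ¬ Cancels s x) :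
    pile I x s (letterBase x) = some x.isLeft :: s (letterBase x) := by
  classical
  rw [pile_of_not_cancels (hirr _) hc, if_pos rfl]

theorem pile_swap_pile {s : S → List (Option Bool)} {x : S ⊕ S} (hc : ¬ Cancels s x) :
    pile I x.swap (pile I x s) = s := by
  have hc' : Cancels (pile I x s) x.swap := by
    unfold Cancels
    rw [letterBase_swap, pile_self hirr hc, isLeft_swap, Bool.not_not]
    rfl
  classical
  funext b
  by_cases h : I (letterBase x) b
  · rw [pile_of_rel (by rwa [letterBase_swap]), pile_of_rel h]
  · rw [pile_of_cancels (by rwa [letterBase_swap]) hc', pile_of_not_cancels h hc, List.tail_cons]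

variable (hsym : ∀ a b, I a b → I b a)
include hsym

omit hirr in
theorem pile_comm_of_not_cancels {s : S → List (Option Bool)} {x y : S ⊕ S}
    (h : I (letterBase x) (letterBase y)) (hx : ¬ Cancels s x) (hy : ¬ Cancels s y) :
    pile I x (pile I y s) = pile I y (pile I x s) := by
  classical
  have hx' : ¬ Cancels (pile I y s) x := by rwa [cancels_pile_iff (hsym _ _ h)]
  have hy' : ¬ Cancels (pile I x s) y := by rwa [cancels_pile_iff h]
  funext b
  by_cases h1 : I (letterBase x) b
  · rw [pile_of_rel h1]
    by_cases h2 : I (letterBase y) b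
    · rw [pile_of_rel h2, pile_of_rel h2, pile_of_rel h1]
    · rw [pile_of_not_cancels h2 hy, pile_of_not_cancels h2 hy', pile_of_rel h1]
  · rw [pile_of_not_cancels h1 hx']
    by_cases h2 : I (letterBase y) b
    · rw [pile_of_rel h2, pile_of_rel h2, pile_of_not_cancels h1 hx]
    · rw [pile_of_not_cancels h2 hy, pile_of_not_cancels h2 hy', pile_of_not_cancels h1 hx]
      have h3 : b ≠ letterBase x := by
        rintro rfl
        exact h2 (hsym _ _ h)
      have h4 : b ≠ letterBase y := by
        rintro rfl
        exact h1 h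
      rw [if_neg h3, if_neg h4]

omit hirr in
theorem ReducedPiling.exists_of_cancels {s : S → List (Option Bool)} (hs : ReducedPiling I s)
    {x : S ⊕ S} (hx : Cancels s x) :
    ∃ s', ReducedPiling I s' ∧ ¬ Cancels s' x.swap ∧ s = pile I x.swap s' := by
  classical
  induction hs with
  | empty => simp [Cancels] at hx
  | @cons s y hs hy ih =>
    by_cases h : I (letterBase y) (letterBase x)
    · rw [cancels_pile_iff h] at hx
      obtain ⟨s', h1, h2, rfl⟩ := ih hx
      have h' : I (letterBase y) (letterBase x.swap) := by rwa [letterBase_swap]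
      have hy' : ¬ Cancels s' y := by rwa [cancels_pile_iff (hsym _ _ h')] at hy
      refine ⟨pile I y s', h1.cons hy', by rwa [cancels_pile_iff h'], ?_⟩
      exact pile_comm_of_not_cancels hsym h' hy' h2
    · unfold Cancels at hx
      rw [pile_of_not_cancels h hy, List.head?_cons] at hx
      split_ifs at hx with hb
      · have : y = x.swap := by
          refine letter_ext (by rw [letterBase_swap, hb]) ?_
          rw [isLeft_swap]
          simpa using hx
        subst this
        exact ⟨s, hs, hy, rfl⟩
      · simp at hx

theorem ReducedPiling.pile_mem {s : S → List (Option Bool)} (hs : ReducedPiling I s)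
    (x : S ⊕ S) : ReducedPiling I (pile I x s) := by
  by_cases hx : Cancels s x
  · obtain ⟨s', h1, h2, rfl⟩ := hs.exists_of_cancels hsym hx
    have := pile_swap_pile hirr h2
    rw [Sum.swap_swap] at this
    rwa [this]
  · exact hs.cons hx

theorem ReducedPiling.pile_swap {s : S → List (Option Bool)} (hs : ReducedPiling I s)
    (x : S ⊕ S) : pile I x.swap (pile I x s) = s := by
  by_cases hx : Cancels s x
  · obtain ⟨s', h1, h2, rfl⟩ := hs.exists_of_cancels hsym hx
    have := pile_swap_pile hirr h2
    rw [Sum.swap_swap] at this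
    rw [this]
  · exact pile_swap_pile hirr hx

theorem ReducedPiling.pile_comm_of_forall {s : S → List (Option Bool)} (hs : ReducedPiling I s)
    {x y : S ⊕ S} (h : pile I x.swap (pile I y s) =
      pile I y (pile I x.swap s)) :
    pile I x (pile I y (pile I x.swap s)) =
      pile I y (pile I x (pile I x.swap s)) := by
  have h1 := hs.pile_swap hirr hsym x.swap
  have h2 := (hs.pile_mem hirr hsym y).pile_swap hirr hsym x.swap
  rw [Sum.swap_swap] at h1 h2
  rw [← h, h1, h2]

theorem ReducedPiling.pile_comm {s : S → List (Option Bool)} (hs : ReducedPiling I s)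
    {x y : S ⊕ S} (h : I (letterBase x) (letterBase y)) :
    pile I x (pile I y s) = pile I y (pile I x s) := by
  have key : ∀ {x y : S ⊕ S} {s}, ReducedPiling I s → I (letterBase x) (letterBase y) →
      ¬ Cancels s x → pile I x (pile I y s) =
        pile I y (pile I x s) := by
    intro x y s hs h hx
    by_cases hy : Cancels s y
    · obtain ⟨s', h1, h2, rfl⟩ := hs.exists_of_cancels hsym hy
      have h' : I (letterBase x) (letterBase y.swap) := by rwa [letterBase_swap]
      rw [cancels_pile_iff (hsym _ _ h')] at hx
      exact (h1.pile_comm_of_forall hirr hsym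
        (pile_comm_of_not_cancels hsym (hsym _ _ h') h2 hx)).symm
    · exact pile_comm_of_not_cancels hsym h hx hy
  by_cases hx : Cancels s x
  · obtain ⟨s', h1, h2, rfl⟩ := hs.exists_of_cancels hsym hx
    exact h1.pile_comm_of_forall hirr hsym (key h1 (by rwa [letterBase_swap]) h2)
  · exact key hs h hx

theorem exists_pile_hom : ∃ f : GraphGroup I →* Equiv.Perm {s // ReducedPiling I s},
    ∀ x s, (f (letterEval I x) s).1 = pile I x s.1 := by
  let φ : S → Equiv.Perm {s // ReducedPiling I s} := fun a =>
    { toFun := fun s => ⟨pile I (Sum.inl a) s.1, s.2.pile_mem hirr hsym _⟩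
      invFun := fun s => ⟨pile I (Sum.inr a) s.1, s.2.pile_mem hirr hsym _⟩
      left_inv := fun s => Subtype.ext (s.2.pile_swap hirr hsym (Sum.inl a))
      right_inv := fun s => Subtype.ext (s.2.pile_swap hirr hsym (Sum.inr a)) }
  refine ⟨graphLift φ fun a b hab => Equiv.ext fun s => Subtype.ext ?_, ?_⟩
  · exact s.2.pile_comm hirr hsym (x := Sum.inl a) (y := Sum.inl b) hab
  · rintro (a | a) s
    · rfl
    · simp only [letterEval, Sum.elim_inr, map_inv]
      rfl

theorem foldr_pile_eq {u v : List (S ⊕ S)}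
    (h : (u.map (letterEval I)).prod = (v.map (letterEval I)).prod) :
    u.foldr (pile I) (fun _ => []) = v.foldr (pile I) (fun _ => []) := by
  obtain ⟨f, hf⟩ := exists_pile_hom hirr hsym
  have key : ∀ u : List (S ⊕ S), u.foldr (pile I) (fun _ => []) =
      (f (u.map (letterEval I)).prod ⟨fun _ => [], ReducedPiling.empty⟩).1 := by
    intro u
    induction u with
    | nil => simp
    | cons x u ih => rw [List.foldr_cons, ih, List.map_cons, List.prod_cons, map_mul,
        Equiv.Perm.mul_apply, hf]
  rw [key, key, h]

omit hirr hsym in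
theorem exists_shorter_of_cancels {u : List (S ⊕ S)}
    (hu : ∀ v, v <:+ u → ∀ x, x :: v <:+ u → ¬ Cancels (v.foldr (pile I) fun _ => []) x)
    {x : S ⊕ S} (hx : Cancels (u.foldr (pile I) fun _ => []) x) :
    ∃ v : List (S ⊕ S), v.length < u.length ∧
      (v.map (letterEval I)).prod = letterEval I x * (u.map (letterEval I)).prod := by
  classical
  induction u with
  | nil => simp [Cancels] at hx
  | cons y u ih =>
    have hy := hu u (List.suffix_cons y u) y List.suffix_rfl
    have ih := ih fun v hv x hx => hu v (hv.trans (List.suffix_cons y u)) x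
      (hx.trans (List.suffix_cons y u))
    rw [List.foldr_cons] at hx
    by_cases h : I (letterBase y) (letterBase x)
    · rw [cancels_pile_iff h] at hx
      obtain ⟨v, h1, h2⟩ := ih hx
      refine ⟨y :: v, by simpa using h1, ?_⟩
      have hcomm : Commute (letterEval I y) (letterEval I x) := by
        have h3 := commute_of_rel h
        rcases x with x | x <;> rcases y with y | y
        · exact h3
        · exact h3.inv_left
        · exact h3.inv_right
        · exact h3.inv_left.inv_right
      rw [List.map_cons, List.prod_cons, h2, List.map_cons, List.prod_cons, ← mul_assoc, ← mul_assoc,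
        hcomm.eq]
    · unfold Cancels at hx
      rw [pile_of_not_cancels h hy, List.head?_cons] at hx
      split_ifs at hx with hb
      · have : y = x.swap := by
          refine letter_ext (by rw [letterBase_swap, hb]) ?_
          rw [isLeft_swap]
          simpa using hx
        subst this
        refine ⟨u, by simp, ?_⟩
        rw [List.map_cons, List.prod_cons, letterEval_swap, mul_inv_cancel_left]
      · simp at hx

/-- A word represents the identity if and only if its piling is empty. -/
theorem foldr_pile_eq_empty_iff (w : List (S ⊕ S)) :
    (w.foldr (pile I) fun _ => []) = (fun _ => []) ↔ (w.map (letterEval I)).prod = 1 := by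
  classical
  constructor
  · intro hw
    have hex : ∃ n, ∃ u : List (S ⊕ S), u.length = n ∧
        (u.map (letterEval I)).prod = (w.map (letterEval I)).prod := ⟨_, w, rfl, rfl⟩
    obtain ⟨u, hu, huw⟩ := Nat.find_spec hex
    have hmin : ∀ v : List (S ⊕ S), (v.map (letterEval I)).prod = (u.map (letterEval I)).prod →
        u.length ≤ v.length := by
      intro v hv
      rw [hu]
      exact Nat.find_min' hex ⟨v, rfl, hv.trans huw⟩
    have hpush : ∀ v : List (S ⊕ S), v <:+ u → ∀ x, x :: v <:+ u →
        ¬ Cancels (v.foldr (pile I) fun _ => []) x := by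
      intro v
      induction hn : v.length using Nat.strong_induction_on generalizing v with
      | _ n ih =>
        subst hn
        intro hv x hx hc
        obtain ⟨v', h1, h2⟩ := exists_shorter_of_cancels (u := v) (fun v₁ h1 y h3 => by
          refine ih v₁.length ?_ v₁ rfl (h1.trans hv) y (h3.trans hv)
          have := h3.length_le
          simp only [List.length_cons] at this
          omega) hc
        obtain ⟨t, rfl⟩ := hx
        have := hmin (t ++ v') (by simp [h2])
        simp only [List.length_append, List.length_cons] at this
        omega
    rw [← foldr_pile_eq hirr hsym huw] at hw
    cases u with
    | nil => rw [← huw]; rfl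
    | cons x u =>
      have := congrFun hw (letterBase x)
      rw [List.foldr_cons, pile_self hirr (hpush u (List.suffix_cons x u) x List.suffix_rfl)] at this
      simp at this
  · intro hw
    exact foldr_pile_eq hirr hsym (v := []) hw

end

end Pilings

section MembershipProblem

variable {S : Type}

theorem exists_flatten_of_isPath {W Z : Set (List (S ⊕ S))} {L : List (S ⊕ S)} :
    ∀ {p q : Z}, q.1 = [] →
      IsPath (fun (p : Z) (c : S ⊕ S) (q : Z) => p.1 = c :: q.1 ∨ (p.1 = [] ∧ c :: q.1 ∈ W)) p L q →
      ∃ ws : List (List (S ⊕ S)), (∀ v ∈ ws, v ∈ W) ∧ L = p.1 ++ ws.flatten ∧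
        ws.length ≤ L.length := by
  induction L with
  | nil =>
    intro p q hq h
    have h' : p = q := h
    exact ⟨[], by simp, by simp [h', hq], by simp⟩
  | cons c L ih =>
    intro p q hq h
    obtain ⟨r, hr, h⟩ := h
    obtain ⟨ws, hws, hL, hlen⟩ := ih hq h
    rcases hr with hr | ⟨hp, hr⟩
    · exact ⟨ws, hws, by simp [hr, hL], by simp; omega⟩
    · refine ⟨(c :: r.1) :: ws, ?_, by simp [hp, hL], by simp; omega⟩
      intro v hv
      rcases List.mem_cons.1 hv with hv | hv
      · exact hv ▸ hr
      · exact hws v hv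

theorem isPath_suffix {W Z : Set (List (S ⊕ S))} (hZ : ∀ (c : S ⊕ S) u, c :: u ∈ Z → u ∈ Z)
    (h0 : [] ∈ Z) (u : List (S ⊕ S)) (hu : u ∈ Z) :
      IsPath (fun (p : Z) (c : S ⊕ S) (q : Z) => p.1 = c :: q.1 ∨ (p.1 = [] ∧ c :: q.1 ∈ W))
        ⟨u, hu⟩ u ⟨[], h0⟩ := by
  induction u with
  | nil => exact rfl
  | cons c u ih => exact ⟨⟨u, hZ c u hu⟩, Or.inl rfl, ih (hZ c u hu)⟩

theorem isPath_flatten {W Z : Set (List (S ⊕ S))} (hZ : ∀ (c : S ⊕ S) u, c :: u ∈ Z → u ∈ Z)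
    (h0 : [] ∈ Z) (hWZ : W ⊆ Z) (ws : List (List (S ⊕ S))) (hws : ∀ v ∈ ws, v ∈ W) :
      IsPath (fun (p : Z) (c : S ⊕ S) (q : Z) => p.1 = c :: q.1 ∨ (p.1 = [] ∧ c :: q.1 ∈ W))
        ⟨[], h0⟩ ws.flatten ⟨[], h0⟩ := by
  induction ws with
  | nil => exact rfl
  | cons v ws ih =>
    have ih := ih fun v hv => hws v (List.mem_cons_of_mem _ hv)
    have hv : v ∈ W := hws v (List.mem_cons_self ..)
    cases v with
    | nil => exact ih
    | cons c v =>
      refine ⟨⟨v, hZ c v (hWZ hv)⟩, Or.inr ⟨rfl, hv⟩, ?_⟩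
      exact isPath_append.2 ⟨_, isPath_suffix hZ h0 v _, ih⟩

/-- If the alphabet is a transitive forest, then membership in a finitely generated submonoid is
witnessed by a product of linearly many generators. -/
theorem IsTransitiveForest.exists_linear_bound [Finite S] {I : S → S → Prop}
    (h : IsTransitiveForest I) {W : Set (List (S ⊕ S))} (hW : W.Finite) :
    ∃ C : ℕ, ∀ (w : List (S ⊕ S)) (ws : List (List (S ⊕ S))), (∀ v ∈ ws, v ∈ W) →
      (ws.flatten.map (letterEval I)).prod = (w.map (letterEval I)).prod →
      ∃ ws : List (List (S ⊕ S)), (∀ v ∈ ws, v ∈ W) ∧ ws.length ≤ C * (w.length + 1) ∧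
        (ws.flatten.map (letterEval I)).prod = (w.map (letterEval I)).prod := by
  classical
  set Z : Set (List (S ⊕ S)) := {u | u = [] ∨ ∃ v ∈ W, u <:+ v} with hZdef
  have hZfin : Z.Finite := by
    have : Z ⊆ {[]} ∪ ⋃ v ∈ W, {u | u ∈ v.tails} := by
      rintro u (hu | ⟨v, hv, hu⟩)
      · exact Or.inl hu
      · exact Or.inr (Set.mem_biUnion hv ((List.mem_tails _ _).2 hu))
    exact ((Set.finite_singleton _).union
      (hW.biUnion fun v _ => List.finite_toSet v.tails)).subset this
  have hZ : ∀ (c : S ⊕ S) u, c :: u ∈ Z → u ∈ Z := by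
    rintro c u (hu | ⟨v, hv, hu⟩)
    · simp at hu
    · exact Or.inr ⟨v, hv, (List.suffix_cons c u).trans hu⟩
  have h0 : [] ∈ Z := Or.inl rfl
  have hWZ : W ⊆ Z := fun v hv => Or.inr ⟨v, hv, List.suffix_refl v⟩
  have hletters : ∀ x, letterEval I x ∈ graphLetters I := by
    rintro (a | a)
    · exact Or.inr ⟨a, Or.inl rfl⟩
    · exact Or.inr ⟨a, Or.inr rfl⟩
  have : Fintype Z := hZfin.fintype
  have : Fintype S := Fintype.ofFinite S
  obtain ⟨F, -, K, hK⟩ := h.linearPaths Z (S ⊕ S)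
    (fun (p : Z) (c : S ⊕ S) (q : Z) => p.1 = c :: q.1 ∨ (p.1 = [] ∧ c :: q.1 ∈ W))
    (letterEval I) hletters
  refine ⟨K, fun w ws hws hprod => ?_⟩
  have hb := hK ⟨[], h0⟩ ⟨[], h0⟩ (w.map (letterEval I)) (by
    intro t ht
    obtain ⟨x, -, rfl⟩ := List.mem_map.1 ht
    exact hletters x)
  obtain ⟨b, ⟨L, hL, hLprod, rfl⟩, hle⟩ := hb.exists_le
    ⟨_, ws.flatten, isPath_flatten hZ h0 hWZ ws hws, hprod, rfl⟩
  obtain ⟨ws', hws', hL', hlen⟩ := exists_flatten_of_isPath rfl hL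
  have hL'' : L = ws'.flatten := hL'
  rw [sum_parikh, List.length_map] at hle
  exact ⟨ws', hws', hlen.trans hle, hL'' ▸ hLprod⟩

/-- Membership in the submonoid generated by a set of words, in terms of concatenations. -/
theorem graphEval_mem_closure_iff {I : S → S → Prop} {W : Set (List (S ⊕ S))}
    {w : List (S ⊕ S)} :
    graphEval I (FreeMonoid.ofList w) ∈ Submonoid.closure
        ((fun v : List (S ⊕ S) => graphEval I (FreeMonoid.ofList v)) '' W) ↔
      ∃ ws : List (List (S ⊕ S)), (∀ v ∈ ws, v ∈ W) ∧
        (ws.flatten.map (letterEval I)).prod = (w.map (letterEval I)).prod := by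
  simp only [← graphEval_ofList]
  constructor
  · intro h
    suffices ∀ g ∈ Submonoid.closure
        ((fun v : List (S ⊕ S) => graphEval I (FreeMonoid.ofList v)) '' W),
        ∃ ws : List (List (S ⊕ S)), (∀ v ∈ ws, v ∈ W) ∧
          graphEval I (FreeMonoid.ofList ws.flatten) = g from this _ h
    intro g hg
    induction hg using Submonoid.closure_induction with
    | mem x hx =>
      obtain ⟨v, hv, rfl⟩ := hx
      exact ⟨[v], by simpa using hv, by simp⟩
    | one => exact ⟨[], by simp, by simp⟩
    | mul x y _ _ ihx ihy =>
      obtain ⟨ws, hws, rfl⟩ := ihx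
      obtain ⟨ws', hws', rfl⟩ := ihy
      refine ⟨ws ++ ws', fun v hv => (List.mem_append.1 hv).elim (hws v) (hws' v), ?_⟩
      rw [List.flatten_append, FreeMonoid.ofList_append, map_mul]
  · rintro ⟨ws, hws, h⟩
    rw [← h]
    clear h
    induction ws with
    | nil => simp
    | cons v ws ih =>
      rw [List.flatten_cons, FreeMonoid.ofList_append, map_mul]
      exact mul_mem (Submonoid.subset_closure ⟨v, hws v (List.mem_cons_self ..), rfl⟩)
        (ih fun v hv => hws v (List.mem_cons_of_mem _ hv))

theorem prod_map_letterEval_swap (I : S → S → Prop) (w : List (S ⊕ S)) :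
    ((w.reverse.map Sum.swap).map (letterEval I)).prod = ((w.map (letterEval I)).prod)⁻¹ := by
  rw [List.prod_inv_reverse, List.map_map, List.map_map, List.map_reverse]
  congr 2
  exact List.map_congr_left fun x _ => letterEval_swap I x

/-- Prepend at most one of the given words to each of the words of a list. -/
def prependAll {A : Type} (Wl X : List (List A)) : List (List A) :=
  X ++ X.flatMap fun u => Wl.map fun v => v ++ u

theorem mem_iterate_prependAll {A : Type} (Wl : List (List A)) (w u : List A) (n : ℕ) :
    u ∈ (prependAll Wl)^[n] [w] ↔
      ∃ ws : List (List A), (∀ v ∈ ws, v ∈ Wl) ∧ ws.length ≤ n ∧ u = ws.flatten ++ w := by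
  induction n generalizing u with
  | zero =>
    constructor
    · intro h
      exact ⟨[], by simp, by simp, by simpa using h⟩
    · rintro ⟨ws, -, hlen, rfl⟩
      simp [List.length_eq_zero_iff.1 (Nat.le_zero.1 hlen)]
  | succ n ih =>
    rw [Function.iterate_succ_apply', prependAll, List.mem_append, List.mem_flatMap]
    simp only [ih, List.mem_map]
    constructor
    · rintro (⟨ws, hws, hlen, hu⟩ | ⟨_, ⟨ws, hws, hlen, rfl⟩, v, hv, rfl⟩)
      · exact ⟨ws, hws, by omega, hu⟩
      · refine ⟨v :: ws, ?_, by simpa using hlen, by simp⟩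
        intro v' hv'
        rcases List.mem_cons.1 hv' with hv' | hv'
        · exact hv' ▸ hv
        · exact hws v' hv'
    · rintro ⟨ws, hws, hlen, rfl⟩
      cases ws with
      | nil => exact Or.inl ⟨[], by simp, by simp, rfl⟩
      | cons v ws =>
        exact Or.inr ⟨_, ⟨ws, fun v hv => hws v (List.mem_cons_of_mem _ hv), by simpa using hlen, rfl⟩,
          v, hws v (List.mem_cons_self ..), by simp⟩

theorem primrec_prependAll {A : Type} [Primcodable A] (Wl : List (List A)) :
    Primrec (prependAll Wl) :=
  Primrec.list_append.comp Primrec.id (Primrec.list_flatMap Primrec.id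
    (Primrec.list_map (Primrec.const Wl)
      (Primrec.list_append.comp Primrec.snd (Primrec.snd.comp Primrec.fst)).to₂).to₂)

variable [Fintype S] [DecidableEq S]

/-- The action of letters on pilings whose piles are numbered. -/
noncomputable def pileFin (I : S → S → Prop) {n : ℕ} (e : S ≃ Fin n) (x : S ⊕ S)
    (t : Fin n → List (Option Bool)) : Fin n → List (Option Bool) :=
  pile I x (t ∘ e) ∘ e.symm

omit [Fintype S] [DecidableEq S] in
theorem foldr_pileFin (I : S → S → Prop) {n : ℕ} (e : S ≃ Fin n) (w : List (S ⊕ S)) :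
    w.foldr (pileFin I e) (fun _ => []) = (w.foldr (pile I) fun _ => []) ∘ e.symm := by
  induction w with
  | nil => rfl
  | cons x w ih =>
    rw [List.foldr_cons, List.foldr_cons, ih, pileFin, Function.comp_assoc]
    simp

theorem primrec_pileFin (I : S → S → Prop) {n : ℕ} (e : S ≃ Fin n) :
    Primrec₂ (pileFin I e) := by
  classical
  have base : Primrec fun p : ((S ⊕ S) × (Fin n → List (Option Bool))) × Fin n => p.1.1 :=
    Primrec.fst.comp Primrec.fst
  have piles : Primrec fun p : ((S ⊕ S) × (Fin n → List (Option Bool))) × Fin n => p.1.2 :=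
    Primrec.snd.comp Primrec.fst
  have current : Primrec fun p : ((S ⊕ S) × (Fin n → List (Option Bool))) × Fin n => p.1.2 p.2 :=
    Primrec.fin_app.comp piles Primrec.snd
  have top : Primrec fun p : ((S ⊕ S) × (Fin n → List (Option Bool))) × Fin n =>
      p.1.2 (e (letterBase p.1.1)) :=
    Primrec.fin_app.comp piles
      ((Primrec.dom_finite fun x : S ⊕ S => e (letterBase x)).comp base)
  have fin : ∀ P : (S ⊕ S) × Fin n → Prop, PrimrecPred
      fun p : ((S ⊕ S) × (Fin n → List (Option Bool))) × Fin n => P (p.1.1, p.2) := fun P =>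
    (show PrimrecPred P from ⟨Classical.decPred P, Primrec.dom_finite _⟩).comp
      (Primrec.pair base Primrec.snd)
  have cancel : PrimrecPred fun p : ((S ⊕ S) × (Fin n → List (Option Bool))) × Fin n =>
      (p.1.2 (e (letterBase p.1.1))).head? = some (some !p.1.1.isLeft) :=
    Primrec.eq.comp (Primrec.list_head?.comp top)
      ((Primrec.dom_finite fun x : S ⊕ S => some (some !x.isLeft)).comp base)
  have symbol : Primrec fun p : ((S ⊕ S) × (Fin n → List (Option Bool))) × Fin n =>
      if e.symm p.2 = letterBase p.1.1 then some p.1.1.isLeft else none :=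
    Primrec.ite (fin fun p => e.symm p.2 = letterBase p.1)
      ((Primrec.dom_finite fun x : S ⊕ S => some x.isLeft).comp base) (Primrec.const none)
  have key := Primrec.ite (fin fun p => I (letterBase p.1) (e.symm p.2)) current
    (Primrec.ite cancel (Primrec.list_tail.comp current) (Primrec.list_cons.comp symbol current))
  refine Primrec.fin_curry.2 (key.of_eq ?_)
  rintro ⟨⟨x, t⟩, i⟩
  simp only [pileFin, Function.comp_apply, pile, Cancels, Equiv.apply_symm_apply]
  congr

/-- The word problem of a graph group is primitive recursive. -/
theorem primrecPred_wordProblem (I : S → S → Prop) (hirr : ∀ a, ¬ I a a)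
    (hsym : ∀ a b, I a b → I b a) :
    PrimrecPred fun w : List (S ⊕ S) => (w.map (letterEval I)).prod = 1 := by
  have e := Fintype.equivFin S
  have fold : Primrec fun w : List (S ⊕ S) => w.foldr (pileFin I e) fun _ => [] :=
    Primrec.list_foldr Primrec.id (Primrec.const _)
      ((primrec_pileFin I e).comp (Primrec.fst.comp Primrec.snd)
        (Primrec.snd.comp Primrec.snd)).to₂
  refine (Primrec.eq.comp fold (Primrec.const fun _ => [])).of_eq fun w => ?_
  rw [← foldr_pile_eq_empty_iff hirr hsym, foldr_pileFin]
  constructor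
  · intro h
    funext a
    simpa using congrFun h (e a)
  · intro h
    rw [h]
    rfl

/-- The submonoid membership problem is decidable for transitive forests. -/
theorem IsTransitiveForest.computablePred {I : S → S → Prop} (h : IsTransitiveForest I)
    (hirr : ∀ a, ¬ I a a) (hsym : ∀ a b, I a b → I b a) {W : Set (List (S ⊕ S))}
    (hW : W.Finite) :
    ComputablePred (fun w : List (S ⊕ S) =>
      graphEval I (FreeMonoid.ofList w) ∈ Submonoid.closure
        ((fun v : List (S ⊕ S) => graphEval I (FreeMonoid.ofList v)) '' W)) := by
  obtain ⟨C, hC⟩ := h.exists_linear_bound hW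
  have candidates : Primrec fun w : List (S ⊕ S) =>
      (prependAll hW.toFinset.toList)^[C * (w.length + 1)] [w.reverse.map Sum.swap] :=
    Primrec.nat_iterate
      (Primrec.nat_mul.comp (Primrec.const C) (Primrec.succ.comp Primrec.list_length))
      (Primrec.list_cons.comp
        (Primrec.list_map Primrec.list_reverse ((Primrec.dom_finite Sum.swap).comp Primrec.snd).to₂)
        (Primrec.const []))
      ((primrec_prependAll _).comp Primrec.snd).to₂
  refine (((primrecPred_wordProblem I hirr hsym).exists_mem_list.comp candidates).of_eq
    fun w => ?_).computablePred
  have key : ∀ ws : List (List (S ⊕ S)),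
      ((ws.flatten ++ w.reverse.map Sum.swap).map (letterEval I)).prod = 1 ↔
        (ws.flatten.map (letterEval I)).prod = (w.map (letterEval I)).prod := by
    intro ws
    rw [List.map_append, List.prod_append, prod_map_letterEval_swap, mul_inv_eq_one]
  rw [graphEval_mem_closure_iff]
  constructor
  · rintro ⟨u, hu, hprod⟩
    obtain ⟨ws, hws, -, rfl⟩ := (mem_iterate_prependAll _ _ _ _).1 hu
    exact ⟨ws, fun v hv => by simpa using hws v hv, (key ws).1 hprod⟩
  · rintro ⟨ws, hws, hprod⟩
    obtain ⟨ws, hws, hlen, hprod⟩ := hC w ws hws hprod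
    exact ⟨_, (mem_iterate_prependAll _ _ _ _).2
      ⟨ws, fun v hv => by simpa using hws v hv, hlen, rfl⟩, (key ws).2 hprod⟩

end MembershipProblem

/-- The submonoid membership problem for a graph group is decidable if and only
if the independence alphabet is a transitive forest. -/
theorem submonoidMembership_computable_iff_transitiveForest
    {S : Type} [Fintype S] [DecidableEq S] (I : S → S → Prop)
    (hirr : ∀ a : S, ¬ I a a) (hsym : ∀ a b : S, I a b → I b a) :
    (∀ W : Set (List (S ⊕ S)), W.Finite →
      ComputablePred (fun w : List (S ⊕ S) =>
        graphEval I (FreeMonoid.ofList w) ∈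
          Submonoid.closure
            ((fun v : List (S ⊕ S) => graphEval I (FreeMonoid.ofList v)) '' W)))
    ↔ IsTransitiveForest I :=
  ⟨isTransitiveForest_of_computable I hirr hsym, fun h _ hW => h.computablePred hirr hsym hW⟩
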